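/- The only rational points on the smooth projective plane quartic curve C₂ : 3x³y + y³z + 2z³x = 0 are (1 : 0 : 0), (0 : 1 : 0), (0 : 0 : 1), (1 : 1 : −1), and (1 : −2 : −1). Equivalently, every triple of coprime integers (x, y, z), not all zero, satisfying 3x³y + y³z + 2z³x = 0 equals ±(1,0,0), ±(0,1,0), ±(0,0,1), ±(1,1,−1), or ±(1,−2,−1). -/

import Mathlib

set_option linter.all false

namespace C2
open Polynomial Module

/-- degree-seven field data -/
class KD (K : Type) [Field K] [NumberField K] where
  b : K
  hb : b ^ 7 = 18
  bas : Basis (Fin 7) ℚ K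
  hbas : ∀ i, bas i = b ^ (i : ℕ)

/-- vectors of integers -/
@[ext] structure V where
  a0 : ℤ
  a1 : ℤ
  a2 : ℤ
  a3 : ℤ
  a4 : ℤ
  a5 : ℤ
  a6 : ℤ
deriving DecidableEq

namespace V
def mul (x y : V) : V :=
  ⟨x.a0*y.a0 + 18*(x.a1*y.a6+x.a2*y.a5+x.a3*y.a4+x.a4*y.a3+x.a5*y.a2+x.a6*y.a1),
   x.a0*y.a1+x.a1*y.a0 + 18*(x.a2*y.a6+x.a3*y.a5+x.a4*y.a4+x.a5*y.a3+x.a6*y.a2),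
   x.a0*y.a2+x.a1*y.a1+x.a2*y.a0 + 18*(x.a3*y.a6+x.a4*y.a5+x.a5*y.a4+x.a6*y.a3),
   x.a0*y.a3+x.a1*y.a2+x.a2*y.a1+x.a3*y.a0 + 18*(x.a4*y.a6+x.a5*y.a5+x.a6*y.a4),
   x.a0*y.a4+x.a1*y.a3+x.a2*y.a2+x.a3*y.a1+x.a4*y.a0 + 18*(x.a5*y.a6+x.a6*y.a5),
   x.a0*y.a5+x.a1*y.a4+x.a2*y.a3+x.a3*y.a2+x.a4*y.a1+x.a5*y.a0 + 18*(x.a6*y.a6),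
   x.a0*y.a6+x.a1*y.a5+x.a2*y.a4+x.a3*y.a3+x.a4*y.a2+x.a5*y.a1+x.a6*y.a0⟩
def add (x y : V) : V :=
  ⟨x.a0+y.a0, x.a1+y.a1, x.a2+y.a2, x.a3+y.a3, x.a4+y.a4, x.a5+y.a5, x.a6+y.a6⟩
def smul (n : ℤ) (y : V) : V :=
  ⟨n*y.a0, n*y.a1, n*y.a2, n*y.a3, n*y.a4, n*y.a5, n*y.a6⟩
def C (n : ℤ) : V := ⟨n,0,0,0,0,0,0⟩
def sub (x y : V) : V := x.add (smul (-1) y)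
end V

variable {K : Type} [Field K] [NumberField K] [KD K]

local notation "β" => (KD.b : K)

def ev (x : V) : K :=
  x.a0 + x.a1*β + x.a2*β^2 + x.a3*β^3 + x.a4*β^4 + x.a5*β^5 + x.a6*β^6

lemma hb : (β)^7 = 18 := KD.hb

lemma b_ne : (β) ≠ 0 := by
  intro h; have := hb (K := K); rw [h] at this; norm_num at this

lemma ev_mul (x y : V) : (ev (x.mul y) : K) = ev x * ev y := by
  have h := hb (K := K)
  have h8 : (β)^8 = 18*β := by rw [pow_succ, h]
  have h9 : (β)^9 = 18*β^2 := by linear_combination β^2*h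
  have h10 : (β)^10 = 18*β^3 := by linear_combination β^3*h
  have h11 : (β)^11 = 18*β^4 := by linear_combination β^4*h
  have h12 : (β)^12 = 18*β^5 := by linear_combination β^5*h
  simp only [ev, V.mul]
  push_cast
  ring_nf
  rw [h, h8, h9, h10, h11, h12]
  ring

lemma ev_add (x y : V) : (ev (x.add y) : K) = ev x + ev y := by
  simp only [ev, V.add]; push_cast; ring
lemma ev_smul (n : ℤ) (y : V) : (ev (y.smul n) : K) = n * ev y := by
  simp only [ev, V.smul]; push_cast; ring
lemma ev_C (n : ℤ) : (ev (V.C n) : K) = n := by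
  simp [ev, V.C]
lemma ev_sub (x y : V) : (ev (x.sub y) : K) = ev x - ev y := by
  rw [V.sub, ev_add, ev_smul]; push_cast; ring

lemma ev_sum (x : V) : (ev x : K) =
   ∑ i : Fin 7, ((![x.a0,x.a1,x.a2,x.a3,x.a4,x.a5,x.a6] i : ℤ) : ℚ) • (KD.bas (K := K) i) := by
  simp [Fin.sum_univ_succ, ev, KD.hbas, Algebra.smul_def]
  ring

lemma ev_inj {x y : V} (h : (ev x : K) = ev y) : x = y := by
  rw [ev_sum, ev_sum] at h
  have h2 := fun i => congrArg (fun v => (KD.bas (K := K)).repr v i) h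
  simp [Finsupp.single_apply] at h2
  ext
  exacts [h2 0, h2 1, h2 2, h2 3, h2 4, h2 5, h2 6]

def V.co (x : V) : Fin 7 → ℤ := ![x.a0,x.a1,x.a2,x.a3,x.a4,x.a5,x.a6]

lemma repr_ev (x : V) (i : Fin 7) : (KD.bas (K := K)).repr (ev x) i = (x.co i : ℚ) := by
  rw [ev_sum]
  simp [Finsupp.single_apply, V.co]

lemma exists_ev (a : K) : ∃ n : ℤ, n ≠ 0 ∧ ∃ c : V, (n : K) * a = ev c := by
  classical
  set q := (KD.bas (K := K)).repr a with hq
  set n : ℤ := ∏ i : Fin 7, ((q i).den : ℤ) with hn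
  have hd : ∀ i : Fin 7, ∃ m : ℤ, (n : ℚ) * q i = m := by
    intro i
    obtain ⟨k, hk⟩ : ((q i).den : ℤ) ∣ n := Finset.dvd_prod_of_mem _ (Finset.mem_univ i)
    refine ⟨k * (q i).num, ?_⟩
    rw [hk]; push_cast
    have := Rat.mul_den_eq_num (q i)
    linear_combination (k : ℚ) * this
  choose m hm using hd
  refine ⟨n, ?_, ⟨m 0, m 1, m 2, m 3, m 4, m 5, m 6⟩, ?_⟩
  · rw [hn]; exact Finset.prod_ne_zero_iff.mpr (fun i _ => by exact_mod_cast (q i).den_nz)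
  · apply (KD.bas (K := K)).repr.injective
    ext i
    rw [repr_ev]
    have h1 : (n : K) * a = (n : ℚ) • a := by rw [Algebra.smul_def]; simp
    rw [h1, map_smul, Finsupp.smul_apply, smul_eq_mul, ← hq, hm]
    fin_cases i <;> simp [V.co]

/-! determinants -/

def stepC (a : ℤ) (r : List ℤ) : List ℤ → List ℤ
  | [] => []
  | c :: cs => List.zipWith (fun x y => a * x - c * y) cs r

def detC : ℕ → List (List ℤ) → Option ℤ
  | 0, _ => some 1
  | n+1, (a :: r) :: rows =>
    if a = 0 then none else
      match detC n (rows.map (stepC a r)) with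
      | none => none
      | some d => some (a * d / a ^ n)
  | _, _ => none

def toM (n : ℕ) (M : List (List ℤ)) : Matrix (Fin n) (Fin n) ℤ :=
  fun i j => (M.getD i []).getD j 0

lemma chio {n : ℕ} (M : Matrix (Fin (n+1)) (Fin (n+1)) ℤ) :
    M 0 0 * Matrix.det (fun i j : Fin n => M 0 0 * M i.succ j.succ - M i.succ 0 * M 0 j.succ)
      = M 0 0 ^ n * M.det := by
  set v : Fin (n+1) → ℤ := Fin.cons 1 (fun _ => M 0 0) with hv
  set B : Matrix (Fin (n+1)) (Fin (n+1)) ℤ := fun i j => v i * M i j with hB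
  set A : Matrix (Fin (n+1)) (Fin (n+1)) ℤ :=
    fun i j => B i j + (Fin.cons 0 (fun k : Fin n => - M k.succ 0) : Fin (n+1) → ℤ) i * B 0 j with hA
  have h1 : A.det = B.det :=
    Matrix.det_eq_of_forall_row_eq_smul_add_const
      (Fin.cons 0 (fun k : Fin n => - M k.succ 0) : Fin (n+1) → ℤ) 0 (by simp) (fun i j => rfl)
  have h2 : B.det = (∏ i, v i) * M.det := Matrix.det_mul_column v M
  have h3 : ∏ i, v i = M 0 0 ^ n := by rw [Fin.prod_univ_succ]; simp [hv]
  rw [← h3, ← h2, ← h1, Matrix.det_succ_column_zero, Fin.sum_univ_succ]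
  have h4 : ∀ i : Fin n, A i.succ 0 = 0 := by
    intro i; simp [hA, hB, hv]; ring
  simp only [h4]
  simp only [Fin.val_zero, pow_zero, one_mul, mul_zero, zero_mul, Finset.sum_const_zero, add_zero]
  have h5 : A 0 0 = M 0 0 := by simp [hA, hB, hv]
  rw [h5]
  congr 2
  ext i j
  rw [Matrix.submatrix_apply]
  simp [hA, hB, hv]; ring

lemma detC_spec : ∀ (n : ℕ) (M : List (List ℤ)) (d : ℤ), M.length = n →
    (∀ r ∈ M, r.length = n) → detC n M = some d → (toM n M).det = d
  | 0, M, d, _, _, h => by simp [detC] at h; simp [← h]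
  | n+1, [], d, h1, _, _ => by simp at h1
  | n+1, [] :: rows, d, h1, h2, _ => by have := h2 [] (by simp); simp at this
  | n+1, (a :: r) :: rows, d, h1, h2, h => by
    simp only [detC] at h
    split_ifs at h with ha
    set M' := rows.map (stepC a r) with hM'
    rcases hd : detC n M' with _ | d'
    · rw [hd] at h; simp at h
    rw [hd] at h
    simp only [Option.some.injEq] at h
    have hr : r.length = n := by have := h2 (a :: r) (by simp); simpa using this
    have hrows : ∀ s ∈ rows, s.length = n + 1 := fun s hs => h2 s (by simp [hs])
    have hl : rows.length = n := by simpa using h1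
    have ih := detC_spec n M' d' (by simp [hM', hl]) (by
      intro s hs
      rw [hM', List.mem_map] at hs
      obtain ⟨t, ht, rfl⟩ := hs
      have := hrows t ht
      cases t with
      | nil => simp at this
      | cons c cs => simp at this; simp [stepC, this, hr]) hd
    have key := chio (toM (n+1) ((a :: r) :: rows))
    have e : (fun i j : Fin n => toM (n+1) ((a :: r) :: rows) 0 0 *
        toM (n+1) ((a :: r) :: rows) i.succ j.succ -
        toM (n+1) ((a :: r) :: rows) i.succ 0 * toM (n+1) ((a :: r) :: rows) 0 j.succ)
        = toM n M' := by
      ext i j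
      have hi : (i : ℕ) < rows.length := by rw [hl]; exact i.2
      have hsl := hrows rows[i] (List.getElem_mem hi)
      simp only [toM, hM']
      have hj : (j : ℕ) < r.length := by rw [hr]; exact j.2
      simp [List.getD_eq_getElem?_getD, hi]
      rcases hrow : rows[(i:ℕ)] with _ | ⟨c, cs⟩
      · simp [hrow] at hsl
      · have hcs : cs.length = n := by simpa [hrow] using hsl
        have hj2 : (j : ℕ) < cs.length := by rw [hcs]; exact j.2
        simp [stepC, hj, hj2]
    rw [e, ih] at key
    have h00 : toM (n+1) ((a :: r) :: rows) 0 0 = a := by simp [toM]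
    rw [h00] at key
    rw [← h, key, Int.mul_ediv_cancel_left _ (pow_ne_zero _ ha)]

def V.sh (x : V) : V := ⟨18*x.a6, x.a0, x.a1, x.a2, x.a3, x.a4, x.a5⟩
def V.li (x : V) : List ℤ := [x.a0,x.a1,x.a2,x.a3,x.a4,x.a5,x.a6]
def V.rows (x : V) : List (List ℤ) :=
  [x.li, x.sh.li, x.sh.sh.li, x.sh.sh.sh.li, x.sh.sh.sh.sh.li, x.sh.sh.sh.sh.sh.li,
    x.sh.sh.sh.sh.sh.sh.li]
def V.nm (x : V) : Option ℤ := detC 7 x.rows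

lemma ev_sh (x : V) : (ev x.sh : K) = ev x * β := by
  simp only [ev, V.sh]; push_cast; linear_combination (- x.a6 : K) * hb (K := K)

lemma norm_ev (x : V) (d : ℤ) (h : x.nm = some d) : Algebra.norm ℚ (ev x : K) = d := by
  have h1 := detC_spec 7 x.rows d (by simp [V.rows]) (by simp [V.rows, V.li]) h
  rw [Algebra.norm_eq_matrix_det (KD.bas (K := K)), ← h1, ← Matrix.det_transpose]
  rw [← eq_intCast (algebraMap ℤ ℚ), RingHom.map_det]
  congr 1
  ext i j
  rw [Matrix.transpose_apply, Algebra.leftMulMatrix_eq_repr_mul, KD.hbas]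
  have key : ∀ n : ℕ, (ev x : K) * β ^ n = ev (V.sh^[n] x) := by
    intro n
    induction n with
    | zero => simp
    | succ n ih => rw [pow_succ, ← mul_assoc, ih, Function.iterate_succ_apply', ev_sh]
  rw [key, repr_ev]
  simp only [RingHom.mapMatrix_apply, Matrix.map_apply, eq_intCast, Int.cast_inj]
  fin_cases i <;> fin_cases j <;> rfl

end C2

namespace C2
open Polynomial Module NumberField

variable {K : Type} [Field K] [NumberField K] [KD K]
local notation "β" => (KD.b : K)

def tab : List (ℕ × V) := [
  (5,⟨2,0,-1,0,1,0,0⟩), (11,⟨2,-1,0,0,0,0,0⟩), (13,⟨1,1,0,0,-1,0,0⟩), (17,⟨1,-1,0,0,0,0,0⟩),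
  (19,⟨1,1,0,0,0,0,0⟩), (23,⟨2,0,1,0,-1,-1,0⟩), (31,⟨1,0,0,0,-1,-1,0⟩), (37,⟨1,0,1,0,1,0,0⟩),
  (41,⟨2,-2,1,0,0,0,0⟩), (47,⟨1,0,0,0,-1,0,0⟩), (53,⟨2,-2,0,0,0,-1,0⟩), (59,⟨1,-1,0,0,-2,0,1⟩),
  (61,⟨1,0,-1,0,1,0,0⟩), (67,⟨2,-1,0,0,0,1,0⟩), (73,⟨2,1,0,0,0,0,0⟩), (79,⟨2,0,-2,0,0,1,0⟩),
  (83,⟨2,0,1,0,1,0,0⟩), (89,⟨1,1,0,0,2,0,0⟩), (97,⟨2,1,0,0,1,0,0⟩), (101,⟨2,0,-2,-1,0,0,0⟩),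
  (103,⟨1,0,1,0,-1,1,0⟩), (107,⟨1,2,0,0,0,-1,0⟩), (109,⟨1,0,0,0,1,-1,0⟩),
  (113,⟨1,0,-1,0,2,0,0⟩), (113,⟨2,0,1,0,0,0,0⟩), (113,⟨2,1,0,0,0,0,-1⟩),
  (113,⟨2,-1,0,0,2,0,-1⟩), (113,⟨2,-1,0,0,0,-1,0⟩), (113,⟨2,1,0,0,0,-1,0⟩),
  (113,⟨2,2,0,0,0,0,1⟩), (131,⟨1,1,0,0,0,-1,0⟩), (137,⟨1,-1,0,1,0,0,0⟩), (139,⟨1,0,1,0,0,1,0⟩),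
  (149,⟨2,0,0,1,0,0,0⟩), (151,⟨1,0,0,0,0,0,1⟩), (157,⟨1,0,-2,0,2,0,0⟩), (163,⟨2,0,0,0,1,0,-1⟩),
  (167,⟨1,0,0,-1,0,1,0⟩), (173,⟨1,0,0,0,0,1,0⟩), (179,⟨2,0,0,0,2,1,0⟩), (181,⟨2,1,0,-1,0,0,0⟩),
  (191,⟨2,2,0,0,-1,0,0⟩), (193,⟨1,-1,0,0,2,0,0⟩), (199,⟨1,1,-1,0,0,0,0⟩),
  (223,⟨1,-1,2,-1,0,0,0⟩), (227,⟨2,-1,0,0,0,0,1⟩), (229,⟨1,0,0,1,0,-1,0⟩),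
  (233,⟨2,0,-1,0,0,0,-1⟩), (241,⟨2,0,0,0,0,0,-1⟩), (251,⟨1,-1,-1,0,1,0,0⟩),
  (257,⟨1,0,1,0,0,0,1⟩), (263,⟨2,0,-1,0,2,-1,0⟩), (269,⟨1,1,1,0,-1,0,0⟩),
  (271,⟨2,1,-2,0,0,0,0⟩), (277,⟨1,0,0,0,-1,0,1⟩), (283,⟨2,-1,1,0,1,0,0⟩),
  (293,⟨1,2,0,0,-1,1,0⟩), (307,⟨1,0,0,1,0,0,0⟩), (311,⟨1,-2,0,0,0,-1,0⟩), (313,⟨2,0,1,0,2,0,0⟩),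
  (317,⟨2,0,0,0,1,1,0⟩), (331,⟨2,0,-2,0,0,-1,0⟩), (347,⟨1,0,0,0,0,1,1⟩),
  (349,⟨2,0,-1,0,0,-1,0⟩), (353,⟨1,0,0,1,0,0,-1⟩)]

lemma int_b : IsIntegral ℤ (β) := by
  refine ⟨X^7 - C 18, monic_X_pow_sub_C _ (by norm_num), ?_⟩
  simp [hb]
omit [NumberField K] [KD K] in
lemma int_pow {a : K} {n : ℤ} (h : a ^ 7 = n) : IsIntegral ℤ a := by
  refine ⟨X^7 - C n, monic_X_pow_sub_C _ (by norm_num), ?_⟩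
  rw [eval₂_sub, eval₂_pow, eval₂_X, eval₂_C, h]; simp
lemma int_t4 : IsIntegral ℤ ((β)^4/3) := int_pow (n := 48) (by
  have h := hb (K := K)
  rw [div_pow, ← pow_mul, show 4*7 = 7*4 by rfl, pow_mul, h]; norm_num)
lemma int_t5 : IsIntegral ℤ ((β)^5/3) := int_pow (n := 864) (by
  have h := hb (K := K)
  rw [div_pow, ← pow_mul, show 5*7 = 7*5 by rfl, pow_mul, h]; norm_num)
lemma int_t6 : IsIntegral ℤ ((β)^6/3) := int_pow (n := 15552) (by
  have h := hb (K := K)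
  rw [div_pow, ← pow_mul, show 6*7 = 7*6 by rfl, pow_mul, h]; norm_num)

def V.t3 (c : V) : V := ⟨3*c.a0,3*c.a1,3*c.a2,3*c.a3,c.a4,c.a5,c.a6⟩

omit [NumberField K] [KD K] in
lemma int_int (n : ℤ) : IsIntegral ℤ (n : K) := by
  simpa using isIntegral_algebraMap (R := ℤ) (A := K) (x := n)

lemma int_t3 (c : V) : IsIntegral ℤ ((ev c.t3 : K)/3) := by
  have e : (ev c.t3 : K)/3 = c.a0 + c.a1 * β + c.a2 * β^2 + c.a3 * β^3 + c.a4 * (β^4/3)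
      + c.a5*(β^5/3) + c.a6*(β^6/3) := by
    simp only [ev, V.t3]; push_cast; ring
  rw [e]
  have hb := int_b (K := K)
  exact (((((((int_int _).add ((int_int _).mul hb)).add ((int_int _).mul (hb.pow 2))).add
    ((int_int _).mul (hb.pow 3))).add ((int_int _).mul int_t4)).add
    ((int_int _).mul int_t5)).add ((int_int _).mul int_t6))

omit [NumberField K] [KD K] in
lemma oext {a b : 𝓞 K} (h : algebraMap (𝓞 K) K a = algebraMap (𝓞 K) K b) : a = b :=
  RingOfIntegers.coe_injective h

noncomputable def bO : 𝓞 K := ⟨β, int_b⟩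
lemma coe_bO : algebraMap (𝓞 K) K bO = β := rfl

noncomputable def evO (x : V) : 𝓞 K :=
  (x.a0 : 𝓞 K) + x.a1*(bO : 𝓞 K) + x.a2*(bO : 𝓞 K)^2 + x.a3*(bO : 𝓞 K)^3 + x.a4*(bO : 𝓞 K)^4
    + x.a5*(bO : 𝓞 K)^5 + x.a6*(bO : 𝓞 K)^6
lemma coe_evO (x : V) : algebraMap (𝓞 K) K (evO x) = ev x := by
  simp only [evO, ev, map_add, map_mul, map_pow, coe_bO, map_intCast]

noncomputable def gO (c : V) : 𝓞 K := ⟨(ev c.t3 : K)/3, int_t3 c⟩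
lemma coe_gO (c : V) : algebraMap (𝓞 K) K (gO c) = ev c.t3/3 := rfl
lemma gO3 (c : V) : (3 : 𝓞 K) * gO c = evO c.t3 := by
  apply oext
  rw [map_mul, coe_gO, coe_evO]
  rw [map_ofNat]; field_simp

lemma bO7 : (bO : 𝓞 K)^7 = 18 := by
  apply oext
  rw [map_pow, coe_bO, hb, map_ofNat]

def V.at (x : V) (r : ℤ) : ℤ :=
  x.a0 + x.a1*r + x.a2*r^2 + x.a3*r^3 + x.a4*r^4 + x.a5*r^5 + x.a6*r^6

lemma mk_evO (P : Ideal (𝓞 K)) (r : ℤ) (h : (bO : 𝓞 K) - (r : 𝓞 K) ∈ P) (x : V) :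
    evO x - ((x.at r : ℤ) : 𝓞 K) ∈ P := by
  rw [← Ideal.Quotient.mk_eq_mk_iff_sub_mem] at h ⊢
  simp only [evO, V.at]
  push_cast
  simp only [map_add, map_mul, map_pow, h]

lemma finr : finrank ℚ K = 7 := by
  rw [Module.finrank_eq_card_basis (KD.bas (K := K))]; simp

lemma norm_O (γ : 𝓞 K) (m : ℕ) (c : V) (h : (m : K) * algebraMap (𝓞 K) K γ = ev c) (d : ℤ)
    (hd : c.nm = some d) : (m : ℤ)^7 * Algebra.norm ℤ γ = d := by
  have h1 := norm_ev (K := K) _ _ hd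
  have h2 : (m : K) = algebraMap ℚ K m := by simp
  rw [← h, h2, map_mul, Algebra.norm_algebraMap, finr, ← Algebra.coe_norm_int] at h1
  exact_mod_cast h1

omit [KD K] in
lemma mem_prime {P : Ideal (𝓞 K)} (hP : P.IsPrime) {p : ℕ} (hp : p.Prime)
    (h : (p : 𝓞 K) ∈ P) {m : ℤ} (hm : (m : 𝓞 K) ∈ P) : (p : ℤ) ∣ m := by
  by_contra hn
  have hc : IsCoprime (p : ℤ) m := (Nat.prime_iff_prime_int.mp hp).coprime_iff_not_dvd.mpr hn
  obtain ⟨a, b, hab⟩ := hc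
  apply hP.ne_top
  rw [Ideal.eq_top_iff_one]
  have : (1 : 𝓞 K) = a * (p : 𝓞 K) + b * m := by exact_mod_cast hab.symm
  rw [this]
  exact P.add_mem (P.mul_mem_left _ h) (P.mul_mem_left _ hm)

end C2

namespace C2
open Polynomial Module NumberField

variable {K : Type} [Field K] [NumberField K] [KD K]
local notation "β" => (KD.b : K)

/-- polynomial check -/
def V.chk (c : V) (s6 s5 s4 s3 s2 s1 s0 : ℤ) : Bool :=
  let c2 := c.mul c
  let c3 := c2.mul c
  let c4 := c3.mul c
  let c5 := c4.mul c
  let c6 := c5.mul c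
  let c7 := c6.mul c
  ((((((((c7.add (c6.smul (21*s6))).add (c5.smul (21^2*s5))).add (c4.smul (21^3*s4))).add
    (c3.smul (21^4*s3))).add (c2.smul (21^5*s2))).add (c.smul (21^6*s1))).add (V.C (21^7*s0)))
     = V.C 0)

lemma int21 (c : V) (s6 s5 s4 s3 s2 s1 s0 : ℤ) (h : c.chk s6 s5 s4 s3 s2 s1 s0 = true) :
    IsIntegral ℤ ((ev c : K)/21) := by
  have h1 := congrArg (ev (K := K)) (of_decide_eq_true h)
  simp only [ev_add, ev_smul, ev_mul, ev_C] at h1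
  push_cast at h1
  refine ⟨X^7 + C s6 * X^6 + C s5 * X^5 + C s4 * X^4 + C s3 * X^3 + C s2 * X^2 + C s1 * X + C s0,
    by monicity!, ?_⟩
  simp only [eval₂_add, eval₂_mul, eval₂_pow, eval₂_X, eval₂_C]
  simp only [eq_intCast]
  field_simp
  linear_combination h1

noncomputable def hO (c : V) (h : IsIntegral ℤ ((ev c : K)/21)) : 𝓞 K := ⟨(ev c : K)/21, h⟩
lemma coe_hO (c : V) (h : IsIntegral ℤ ((ev c : K)/21)) :
  algebraMap (𝓞 K) K (hO c h) = (ev c : K)/21 := rfl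

def vu1 : V := ⟨21,0,-21,21,-7,0,0⟩
def vu3 : V := ⟨-15,-9,3,6,-2,3,-1⟩
def vu4 : V := ⟨57,-12,-3,15,-12,11,-6⟩
def vp1 : V := ⟨-15,-9,3,6,5,3,-1⟩
def vp2 : V := ⟨3,-15,12,3,-1,-2,3⟩
def vw : V := ⟨20487,-18057,-23871,-11790,724,5760,4436⟩
def vg3 : V := ⟨448245,296814,196308,129843,85981,56903,37625⟩

noncomputable def u1 : 𝓞 K := hO vu1 (int21 _ (-7) 63 (-371) 1379 (-441) (-35) (-1) (by decide +kernel))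
noncomputable def u3 : 𝓞 K := hO vu3 (int21 _ 5 9 19 65 117 79 (-1) (by decide +kernel))
noncomputable def u4 : 𝓞 K := hO vu4 (int21 _ (-19) 195 (-143) (-205) (-69) (-11) (-1) (by decide +kernel))
noncomputable def p1 : 𝓞 K := hO vp1 (int21 _ 5 (-3) (-29) 23 3 1 (-7) (by decide +kernel))
noncomputable def p2 : 𝓞 K := hO vp2 (int21 _ (-1) 21 (-35) 77 (-147) 49 (-7) (by decide +kernel))
noncomputable def wO : 𝓞 K := hO vw (int21 _ (-6829) 84596181 (-6894581) (-3654907) (-211521) 139 (-1) (by decide +kernel))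
noncomputable def g3 : 𝓞 K := hO vg3 (int21 _ (-149415) (-4259577) (-202649097) (-8098125) (-129717) (-987) (-3) (by decide +kernel))

lemma nO (c : V) (h : IsIntegral ℤ ((ev c : K)/21)) (d : ℤ) (hd : c.nm = some (21^7*d)) :
    Algebra.norm ℤ (hO c h) = d := by
  have := norm_O (K := K) (hO c h) 21 c (by rw [coe_hO]; push_cast; field_simp) _ hd
  push_cast at this
  linarith
lemma nu1 : Algebra.norm ℤ (u1 : 𝓞 K) = 1 := nO _ _ _ (by decide +kernel)
lemma nu3 : Algebra.norm ℤ (u3 : 𝓞 K) = 1 := nO _ _ _ (by decide +kernel)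
lemma nu4 : Algebra.norm ℤ (u4 : 𝓞 K) = 1 := nO _ _ _ (by decide +kernel)
lemma np1 : Algebra.norm ℤ (p1 : 𝓞 K) = 7 := nO _ _ _ (by decide +kernel)
lemma np2 : Algebra.norm ℤ (p2 : 𝓞 K) = 7 := nO _ _ _ (by decide +kernel)
lemma nw : Algebra.norm ℤ (wO : 𝓞 K) = 1 := nO _ _ _ (by decide +kernel)
lemma ng3 : Algebra.norm ℤ (g3 : 𝓞 K) = 3 := nO _ _ _ (by decide +kernel)

lemma seven_fac : (7 : 𝓞 K) = wO * p1 * p2 ^ 6 := by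
  apply oext
  have h : (vw.mul (vp1.mul (vp2.mul (vp2.mul (vp2.mul (vp2.mul (vp2.mul vp2))))))) = V.C (7*21^8) := by
    decide +kernel
  have h1 := congrArg (ev (K := K)) h
  simp only [ev_mul, ev_C] at h1
  push_cast at h1
  rw [map_ofNat, map_mul, map_mul, map_pow, wO, p1, p2, coe_hO, coe_hO, coe_hO]
  field_simp
  linear_combination -h1

lemma ngO (c : V) (d : ℤ) (hd : c.t3.nm = some d) : 3^7 * Algebra.norm ℤ (gO c : 𝓞 K) = d := by
  have := norm_O (K := K) (gO c) 3 c.t3 (by rw [coe_gO]; push_cast; field_simp) _ hd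
  exact_mod_cast this

def okN (e : ℕ × V) : Bool := match e.2.t3.nm with
  | none => false
  | some d => decide (d ≠ 0 ∧ |d| < 3^7 * (e.1 : ℤ)^2)

lemma tab_ok : tab.all okN = true := by decide +kernel

def bp (p : ℕ) : Bool := (List.range p).all (fun d => decide (d < 2) || decide (p % d ≠ 0))

lemma tab_cov : (List.range 354).all (fun p => decide (p < 2) || !(bp p) || decide (p = 2) || decide (p = 3) || decide (p = 7) ||
   (List.range p).all (fun r => decide ((r^7) % p ≠ 18 % p) ||
    tab.any (fun e => decide (e.1 = p) && decide ((e.2.t3.at r) % (p:ℤ) = 0)))) = true := by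
  decide +kernel

end C2

namespace C2
open Polynomial Module NumberField

variable {K : Type} [Field K] [NumberField K] [KD K]
local notation "β" => (KD.b : K)

omit [KD K] in
lemma nz_of_norm {γ : 𝓞 K} (h : Algebra.norm ℤ γ ≠ 0) : γ ≠ 0 := by
  rintro rfl; simp at h

lemma tab_use (P : Ideal (𝓞 K)) (hP : P.IsPrime) (p : ℕ) (hp : p.Prime) (hpP : (p : 𝓞 K) ∈ P)
    (hlt : p < 354) (h2 : p ≠ 2) (h3 : p ≠ 3) (h7 : p ≠ 7) (r : ℤ)
    (hr : (bO : 𝓞 K) - (r : 𝓞 K) ∈ P) :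
    ∃ γ : 𝓞 K, γ ∈ P ∧ γ ≠ 0 ∧ |Algebra.norm ℤ γ| < (p : ℤ)^2 := by
  have hp0 : (0:ℤ) < p := by exact_mod_cast hp.pos
  obtain ⟨s, hs⟩ := Int.eq_ofNat_of_zero_le (Int.emod_nonneg r hp0.ne')
  have hsp : s < p := by have := Int.emod_lt_of_pos r hp0; omega
  have hrs : (bO : 𝓞 K) - ((s : ℤ) : 𝓞 K) ∈ P := by
    have e : r = (p : ℤ) * (r / p) + s := by rw [← hs]; exact (Int.mul_ediv_add_emod r p).symm
    have : (bO : 𝓞 K) - ((s : ℤ) : 𝓞 K) = ((bO : 𝓞 K) - (r : 𝓞 K)) + ((r / p : ℤ) : 𝓞 K) * (p : 𝓞 K) := by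
      have e' := congrArg (Int.cast : ℤ → 𝓞 K) e
      push_cast at e' ⊢
      linear_combination e'
    rw [this]
    exact P.add_mem hr (P.mul_mem_left _ hpP)
  have h18 : (p : ℤ) ∣ (s : ℤ)^7 - 18 := by
    apply mem_prime hP hp hpP
    have h1 := mk_evO P s hrs ⟨0,0,0,0,0,0,1⟩
    have h1 : (bO : 𝓞 K)^7 - ((s : ℤ) : 𝓞 K)^7 ∈ P := by
      rw [← Ideal.Quotient.mk_eq_mk_iff_sub_mem] at hrs ⊢
      rw [map_pow, map_pow, hrs]
    rw [bO7] at h1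
    have := P.neg_mem h1
    rw [neg_sub] at this
    exact_mod_cast this
  have hb : bp p = true := by
    simp only [bp, List.all_eq_true, List.mem_range, Bool.or_eq_true, decide_eq_true_eq]
    intro d hd
    by_cases h : d < 2
    · left; exact h
    · right; intro h0
      rcases (Nat.dvd_prime hp).mp (Nat.dvd_of_mod_eq_zero h0) with h | h <;> omega
  have hc := tab_cov
  simp only [List.all_eq_true, List.mem_range] at hc
  have hc := hc p hlt
  simp only [hb, h2, h3, h7, Bool.or_eq_true, decide_eq_true_eq, Bool.not_true, decide_false,
    Bool.false_eq_true, or_false, List.all_eq_true, List.mem_range, List.any_eq_true,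
    Bool.and_eq_true] at hc
  rcases hc with hc | hc
  · exact absurd hp.two_le (by omega)
  rcases hc s hsp with hc | ⟨e, he, he1, he2⟩
  · exfalso; apply hc
    zify
    exact (Int.modEq_iff_dvd.mpr h18).symm
  · have hk := (List.all_eq_true.mp tab_ok) e he
    rcases e with ⟨q, c⟩
    simp only at he1 he2
    subst he1
    unfold okN at hk
    simp only at hk
    split at hk
    · exact absurd hk (by simp)
    · rename_i d hd
      rw [decide_eq_true_eq] at hk
      have hn := ngO (K := K) c d hd
      refine ⟨gO c, ?_, ?_, ?_⟩
      · have h1 := mk_evO P s hrs c.t3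
        obtain ⟨k, hk2⟩ := Int.dvd_of_emod_eq_zero he2
        have h2 : evO (K := K) c.t3 ∈ P := by
          have : evO (K := K) c.t3 = (evO c.t3 - ((c.t3.at s : ℤ) : 𝓞 K)) + (k : 𝓞 K) * (q : 𝓞 K) := by
            rw [hk2]; push_cast; ring
          rw [this]
          exact P.add_mem h1 (P.mul_mem_left _ hpP)
        rw [← gO3] at h2
        rcases hP.mem_or_mem h2 with h | h
        · exfalso
          have := mem_prime hP hp hpP (m := 3) (by exact_mod_cast h)
          have h4 : q ∣ 3 := by exact_mod_cast this
          rcases (Nat.dvd_prime Nat.prime_three).mp h4 with h | h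
          · exact hp.one_lt.ne' h
          · exact h3 h
        · exact h
      · apply nz_of_norm; intro h0; rw [h0] at hn; exact hk.1 (by rw [← hn]; simp)
      · rw [← hn, abs_mul] at hk
        have := hk.2
        norm_num at this ⊢
        linarith

lemma g2_mem (P : Ideal (𝓞 K)) (hP : P.IsPrime) (h2 : (2 : 𝓞 K) ∈ P) :
    gO ⟨2,1,-1,-1,-1,0,1⟩ ∈ P := by
  have hb : (bO : 𝓞 K) ∈ P := by
    apply hP.mem_of_pow_mem 7
    rw [bO7, show (18 : 𝓞 K) = 9 * 2 by norm_num]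
    exact P.mul_mem_left _ h2
  have h := gO3 (K := K) ⟨2,1,-1,-1,-1,0,1⟩
  have h3 : (3 : 𝓞 K) * gO ⟨2,1,-1,-1,-1,0,1⟩ ∈ P := by
    rw [h]; simp only [evO, V.t3]
    push_cast
    have : (6 : 𝓞 K) + 3 * bO + -3 * bO^2 + -3 * bO^3 + -1 * bO^4 + 0 * bO^5 + 1 * bO^6
      = 3 * 2 + (3 + -3 * bO + -3 * bO^2 - bO^3 + bO^5) * bO := by ring
    rw [this]
    exact P.add_mem (P.mul_mem_left _ h2) (P.mul_mem_left _ hb)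
  rcases hP.mem_or_mem h3 with h | h
  · exact absurd ((Ideal.eq_top_iff_one P).mpr (by
      have : (1 : 𝓞 K) = 3 - 2 := by norm_num
      rw [this]; exact P.sub_mem h h2)) hP.ne_top
  · exact h

lemma g3_mem (P : Ideal (𝓞 K)) (hP : P.IsPrime) (h3 : (3 : 𝓞 K) ∈ P) : g3 ∈ P := by
  have hb : (bO : 𝓞 K) ∈ P := by
    apply hP.mem_of_pow_mem 7
    rw [bO7, show (18 : 𝓞 K) = 6 * 3 by norm_num]
    exact P.mul_mem_left _ h3
  have tt : ∀ (c : V) (n : ℤ), ((ev c.t3 : K)/3)^7 = 3 * n → gO c ∈ P := by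
    intro c n h
    apply hP.mem_of_pow_mem 7
    have : (gO c : 𝓞 K)^7 = n * 3 := by
      apply oext
      rw [map_pow, map_mul, coe_gO, h, map_intCast, map_ofNat]; ring
    rw [this]
    exact P.mul_mem_left _ h3
  have hh := hb
  have h := C2.hb (K := K)
  have t4 : gO ⟨0,0,0,0,1,0,0⟩ ∈ P := tt _ 16 (by
    simp only [ev, V.t3]; push_cast
    have : (β^4)^7 = 18^4 := by rw [← pow_mul, mul_comm, pow_mul, h]
    linear_combination (1/3^7) * this)
  have t5 : gO ⟨0,0,0,0,0,1,0⟩ ∈ P := tt _ 288 (by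
    simp only [ev, V.t3]; push_cast
    have : (β^5)^7 = 18^5 := by rw [← pow_mul, mul_comm, pow_mul, h]
    linear_combination (1/3^7) * this)
  have t6 : gO ⟨0,0,0,0,0,0,1⟩ ∈ P := tt _ 5184 (by
    simp only [ev, V.t3]; push_cast
    have : (β^6)^7 = 18^6 := by rw [← pow_mul, mul_comm, pow_mul, h]
    linear_combination (1/3^7) * this)
  have key : (7 : 𝓞 K) * g3 = 49805 * 3 + (98938 + 65436 * bO + 43281 * bO^2) * bO
      + 85981 * gO ⟨0,0,0,0,1,0,0⟩ + 56903 * gO ⟨0,0,0,0,0,1,0⟩ + 37625 * gO ⟨0,0,0,0,0,0,1⟩ := by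
    apply oext
    simp only [map_add, map_mul, map_pow, map_ofNat, coe_bO, coe_gO, g3, coe_hO]
    simp only [ev, V.t3, vg3]; push_cast
    ring
  have h7 : (7 : 𝓞 K) * g3 ∈ P := by
    rw [key]
    exact P.add_mem (P.add_mem (P.add_mem (P.add_mem (P.mul_mem_left _ h3) (P.mul_mem_left _ hb))
      (P.mul_mem_left _ t4)) (P.mul_mem_left _ t5)) (P.mul_mem_left _ t6)
  rcases hP.mem_or_mem h7 with h | h
  · exact absurd ((Ideal.eq_top_iff_one P).mpr (by
      have : (1 : 𝓞 K) = 7 - 2 * 3 := by norm_num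
      rw [this]; exact P.sub_mem h (P.mul_mem_left _ h3))) hP.ne_top
  · exact h

lemma p12_mem (P : Ideal (𝓞 K)) (hP : P.IsPrime) (h7 : (7 : 𝓞 K) ∈ P) : p1 ∈ P ∨ p2 ∈ P := by
  rw [seven_fac] at h7
  rcases hP.mem_or_mem h7 with h | h
  · rcases hP.mem_or_mem h with h | h
    · exfalso
      have hu : IsUnit (wO : 𝓞 K) := by
        rw [NumberField.isUnit_iff_norm, RingOfIntegers.coe_norm, ← Algebra.coe_norm_int, nw]; simp
      exact hP.ne_top (Ideal.eq_top_of_isUnit_mem _ h hu)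
    · left; exact h
  · right; exact hP.mem_of_pow_mem _ h

lemma ex_gamma (P : Ideal (𝓞 K)) (hP : P.IsPrime) (hP0 : P ≠ ⊥) (hn : Ideal.absNorm P < 354) :
    ∃ γ : 𝓞 K, γ ∈ P ∧ γ ≠ 0 ∧ |Algebra.norm ℤ γ| < (Ideal.absNorm P : ℤ)^2 := by
  have hmax : P.IsMaximal := hP.isMaximal hP0
  let _ : Field (𝓞 K ⧸ P) := Ideal.Quotient.field P
  have hfin : Finite (𝓞 K ⧸ P) := Ideal.finiteQuotientOfFreeOfNeBot P hP0
  let _ : Fintype (𝓞 K ⧸ P) := Fintype.ofFinite _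
  obtain ⟨p, hchar, f, hp, hcard⟩ := FiniteField.card' (𝓞 K ⧸ P)
  have hN : Ideal.absNorm P = p ^ (f : ℕ) := by
    rw [← hcard, Ideal.absNorm_apply, Submodule.cardQuot_apply, Nat.card_eq_fintype_card]
  have hpP : (p : 𝓞 K) ∈ P := by
    rw [← Ideal.Quotient.eq_zero_iff_mem, map_natCast]; exact CharP.cast_eq_zero _ p
  have hfp : 1 ≤ (f : ℕ) := f.2
  have hle : p ≤ Ideal.absNorm P := by
    rw [hN]; calc p = p ^ 1 := (pow_one p).symm
      _ ≤ p ^ (f : ℕ) := Nat.pow_le_pow_right hp.pos hfp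
  have hsq : (p : ℤ)^2 ≤ (Ideal.absNorm P : ℤ)^2 := by
    have : (p : ℤ) ≤ (Ideal.absNorm P : ℤ) := by exact_mod_cast hle
    have h0 : (0:ℤ) ≤ p := by positivity
    gcongr
  suffices h : (∃ γ : 𝓞 K, γ ∈ P ∧ γ ≠ 0 ∧ |Algebra.norm ℤ γ| < (p : ℤ)^2) ∨
    ∃ γ : 𝓞 K, γ ∈ P ∧ γ ≠ 0 ∧ |Algebra.norm ℤ γ| < (Ideal.absNorm P : ℤ)^2 by
    rcases h with ⟨γ, h1, h2, h3⟩ | h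
    · exact ⟨γ, h1, h2, h3.trans_le hsq⟩
    · exact h
  by_cases h2 : p = 2
  · left
    subst h2
    have hn2 := ngO (K := K) ⟨2,1,-1,-1,-1,0,1⟩ (3^7*2) (by decide +kernel)
    have hn2 : Algebra.norm ℤ (gO ⟨2,1,-1,-1,-1,0,1⟩ : 𝓞 K) = 2 := by linarith
    exact ⟨_, g2_mem P hP (by exact_mod_cast hpP), nz_of_norm (by rw [hn2]; norm_num), by rw [hn2]; norm_num⟩
  by_cases h3 : p = 3
  · left
    subst h3
    exact ⟨_, g3_mem P hP (by exact_mod_cast hpP), nz_of_norm (by rw [ng3]; norm_num), by rw [ng3]; norm_num⟩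
  by_cases h7 : p = 7
  · left
    subst h7
    rcases p12_mem P hP (by exact_mod_cast hpP) with h | h
    · exact ⟨_, h, nz_of_norm (by rw [np1]; norm_num), by rw [np1]; norm_num⟩
    · exact ⟨_, h, nz_of_norm (by rw [np2]; norm_num), by rw [np2]; norm_num⟩
  set x : 𝓞 K ⧸ P := Ideal.Quotient.mk P bO with hx
  have hx7 : x ^ 7 = 18 := by rw [hx, ← map_pow, bO7, map_ofNat]
  have hq := FiniteField.pow_card x
  rw [hcard] at hq
  have main : (∃ r : ℤ, x = r) → (∃ γ : 𝓞 K, γ ∈ P ∧ γ ≠ 0 ∧ |Algebra.norm ℤ γ| < (p : ℤ)^2) := by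
    rintro ⟨r, hr⟩
    apply tab_use P hP p hp hpP (by omega) h2 h3 h7 r
    rw [← Ideal.Quotient.eq_zero_iff_mem, map_sub, map_intCast, ← hx, hr, sub_self]
  have pw : ∀ m k : ℕ, p ^ (f:ℕ) + k * (p ^ (f:ℕ) - 1) = 7 * m → ∃ r : ℤ, x = r := by
    intro m k hm
    refine ⟨18 ^ m, ?_⟩
    have e : ∀ k : ℕ, x ^ (p ^ (f:ℕ) + k * (p ^ (f:ℕ) - 1)) = x := by
      intro k
      induction k with
      | zero => simpa using hq
      | succ k ih =>
        have h1 : 1 ≤ p ^ (f:ℕ) := Nat.one_le_pow _ _ hp.pos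
        have : p ^ (f:ℕ) + (k+1) * (p ^ (f:ℕ) - 1) = (p ^ (f:ℕ) + k * (p ^ (f:ℕ) - 1)) + (p ^ (f:ℕ) - 1) := by ring
        rw [this, pow_add, ih, ← pow_succ', Nat.sub_add_cancel h1, hq]
    have := e k
    rw [hm, pow_mul, hx7] at this
    rw [← this]; push_cast; rfl
  by_cases hf1 : (f : ℕ) = 1
  · left
    apply main
    rw [hf1, pow_one] at hcard
    have : Fact p.Prime := ⟨hp⟩
    have hbij : Function.Bijective (ZMod.castHom (dvd_refl p) (𝓞 K ⧸ P)) := by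
      rw [Fintype.bijective_iff_injective_and_card]
      exact ⟨RingHom.injective _, by rw [ZMod.card, hcard]⟩
    obtain ⟨y, hy⟩ := hbij.2 x
    refine ⟨(y.val : ℤ), ?_⟩
    rw [← hy]
    rw [ZMod.castHom_apply, ← ZMod.natCast_val]; push_cast; rfl
  have hf2 : 2 ≤ (f : ℕ) := by omega
  rw [hN] at hn
  have hp2 : p ^ 2 < 354 := (Nat.pow_le_pow_right hp.pos hf2).trans_lt hn
  have hp18 : p < 19 := by nlinarith
  by_cases hf3 : 3 ≤ (f : ℕ)
  · have hp3 : p ^ 3 < 354 := (Nat.pow_le_pow_right hp.pos hf3).trans_lt hn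
    have hp8 : p < 8 := by
      by_contra h
      have : 8 ^ 3 ≤ p ^ 3 := Nat.pow_le_pow_left (by omega) 3
      omega
    have hp5 : p = 5 := by interval_cases p <;> first | rfl | omega | (exfalso; revert hp; norm_num; done)
    have hf4 : (f : ℕ) = 3 := by
      by_contra h
      have : p ^ 4 ≤ p ^ (f : ℕ) := Nat.pow_le_pow_right hp.pos (by omega)
      rw [hp5] at this hn; omega
    left; apply main; apply pw 71 3; rw [hp5, hf4]; norm_num
  have hf4 : (f : ℕ) = 2 := by omega
  rw [hf4] at pw hN
  by_cases h13 : p = 13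
  · subst h13
    have c13 : (13 : 𝓞 K ⧸ P) = 0 := by exact_mod_cast CharP.cast_eq_zero (𝓞 K ⧸ P) 13
    have hfac : (x - 8) * ((x^2 - 4*x - 1) * ((x^2+x-1) * (x^2-2*x-1))) = 0 := by
      have : (x - 8) * ((x^2 - 4*x - 1) * ((x^2+x-1) * (x^2-2*x-1))) = x^7 - 18 + 13 * (-x^6 + 3*x^5 + 2*x^4 - 11*x^3 - x^2 + 3 *x + 2) := by
        ring
      rw [this, hx7, c13]; ring
    have fin : ∀ (c : V) (d : ℤ), c.t3.nm = some (3^7*d) → d ≠ 0 → |d| < 13^4 →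
        Ideal.Quotient.mk P (evO c.t3) = 0 →
        ∃ γ : 𝓞 K, γ ∈ P ∧ γ ≠ 0 ∧ |Algebra.norm ℤ γ| < (Ideal.absNorm P : ℤ)^2 := by
      intro c d hd hd0 hdl hc
      have hn := ngO (K := K) c _ hd
      have hn : Algebra.norm ℤ (gO c : 𝓞 K) = d := by linarith
      refine ⟨gO c, ?_, nz_of_norm (by rw [hn]; exact hd0), ?_⟩
      · rw [← gO3, map_mul, mul_eq_zero] at hc
        rcases hc with h | h
        · exfalso
          rw [map_ofNat] at h
          have h1 : (1 : 𝓞 K ⧸ P) = 0 := by linear_combination (1 : 𝓞 K ⧸ P) * c13 - 4 * h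
          exact one_ne_zero h1
        · exact Ideal.Quotient.eq_zero_iff_mem.mp h
      · rw [hn, hN]; norm_num; norm_num at hdl; exact hdl
    rcases mul_eq_zero.mp hfac with h | h
    · left; exact main ⟨8, by push_cast; linear_combination h⟩
    right
    rcases mul_eq_zero.mp h with h | h
    · apply fin ⟨2,0,0,1,2,0,0⟩ 1352 (by decide +kernel) (by norm_num) (by norm_num)
      simp only [evO, V.t3, map_add, map_mul, map_pow, ← hx]
      push_cast
      simp only [map_intCast, map_ofNat, map_zero, map_one, map_neg]
      linear_combination (2 * x^2 + 11 * x+46) * h + (15*x+4) * c13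
    rcases mul_eq_zero.mp h with h | h
    · apply fin ⟨-1,1,1,0,0,0,0⟩ 845 (by decide +kernel) (by norm_num) (by norm_num)
      simp only [evO, V.t3, map_add, map_mul, map_pow, ← hx]
      push_cast
      simp only [map_intCast, map_ofNat, map_zero, map_one, map_neg]
      linear_combination 3 * h
    · apply fin ⟨-1,-2,1,0,0,0,0⟩ (-8281) (by decide +kernel) (by norm_num) (by norm_num)
      simp only [evO, V.t3, map_add, map_mul, map_pow, ← hx]
      push_cast
      simp only [map_intCast, map_ofNat, map_zero, map_one, map_neg]
      linear_combination 3 * h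
  left; apply main
  have : p = 5 ∨ p = 11 ∨ p = 17 := by
    interval_cases p <;> first | omega | (exfalso; revert hp; norm_num; done)
  rcases this with h | h | h
  · apply pw 7 1; rw [h]; norm_num
  · apply pw 103 5; rw [h]; norm_num
  · apply pw 247 5; rw [h]; norm_num

end C2

namespace C2
open Polynomial Module NumberField

variable {K : Type} [Field K] [NumberField K] [KD K]
local notation "β" => (KD.b : K)

set_option maxHeartbeats 1000000 in
lemma princ (n : ℕ) : ∀ I : Ideal (𝓞 K), I ≠ ⊥ → Ideal.absNorm I = n → n < 354 → I.IsPrincipal := by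
  induction n using Nat.strong_induction_on with
  | _ n ih =>
  intro I hI hn hlt
  by_cases htop : I = ⊤
  · rw [htop]; exact ⟨1, by simp⟩
  have hn0 : n ≠ 0 := by rw [← hn]; exact (Ideal.absNorm_ne_zero_iff_mem_nonZeroDivisors.mpr (mem_nonZeroDivisors_of_ne_zero hI))
  obtain ⟨P, hP, hIP⟩ := Ideal.exists_le_maximal I htop
  obtain ⟨J, hJ⟩ := Ideal.dvd_iff_le.mpr hIP
  have hmul : Ideal.absNorm P * Ideal.absNorm J = n := by rw [← map_mul, ← hJ, hn]
  have hJ0 : J ≠ ⊥ := by rintro rfl; apply hI; rw [hJ]; simp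
  have hP0 : P ≠ ⊥ := by rintro rfl; apply hI; rw [hJ]; simp
  have hPn1 : Ideal.absNorm P ≠ 1 := fun h => hP.ne_top (Ideal.absNorm_eq_one_iff.mp h)
  have hPpos : Ideal.absNorm P ≠ 0 := by intro h; apply hn0; rw [← hmul, h, zero_mul]
  have hJpos : Ideal.absNorm J ≠ 0 := by intro h; apply hn0; rw [← hmul, h, mul_zero]
  by_cases hJt : J = ⊤
  · have hIP' : I = P := by rw [hJ, hJt, Ideal.mul_top]
    subst hIP'
    obtain ⟨γ, hγ, hγ0, hγn⟩ := ex_gamma I hP.isPrime hI (hn ▸ hlt)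
    obtain ⟨L, hL⟩ := Ideal.dvd_iff_le.mpr ((Ideal.span_singleton_le_iff_mem I).mpr hγ)
    have hLn : Ideal.absNorm L < n := by
      have h1 : Ideal.absNorm (Ideal.span {γ}) = n * Ideal.absNorm L := by
        rw [hL, map_mul, hn]
      rw [Ideal.absNorm_span_singleton] at h1
      rw [hn] at hγn
      have h2 : (Algebra.norm ℤ γ).natAbs < n ^ 2 := by zify; exact hγn
      rw [h1] at h2
      nlinarith
    have hL0 : L ≠ ⊥ := by
      rintro rfl
      rw [Ideal.mul_bot] at hL
      exact hγ0 (Ideal.span_singleton_eq_bot.mp hL)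
    obtain ⟨j, hj⟩ := (ih _ hLn L hL0 rfl (hLn.trans hlt)).principal
    rw [Ideal.submodule_span_eq] at hj
    have hj0 : j ≠ 0 := by rintro rfl; apply hL0; rw [hj]; simp
    have : γ ∈ Ideal.span {j} := by
      rw [← hj]
      have hm : γ ∈ I * L := by rw [← hL]; exact Ideal.mem_span_singleton_self γ
      have hle : I * L ≤ L := Ideal.mul_le_right
      exact hle hm
    obtain ⟨δ, hδ⟩ := Ideal.mem_span_singleton.mp this
    refine ⟨δ, ?_⟩
    rw [Ideal.submodule_span_eq]
    have h3 : Ideal.span {j} * I = Ideal.span {j} * Ideal.span {δ} := by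
      rw [Ideal.span_singleton_mul_span_singleton, ← hδ, hL, hj, mul_comm]
    exact mul_left_cancel₀ (by rw [← hj]; exact hL0) h3
  · have hJn1 : Ideal.absNorm J ≠ 1 := fun h => hJt (Ideal.absNorm_eq_one_iff.mp h)
    have h1 : Ideal.absNorm P < n := by
      rw [← hmul]; exact lt_mul_of_one_lt_right (by omega) (by omega)
    have h2 : Ideal.absNorm J < n := by
      rw [← hmul]; exact lt_mul_of_one_lt_left (by omega) (by omega)
    obtain ⟨a, ha⟩ := (ih _ h1 P hP0 rfl (h1.trans hlt)).principal
    obtain ⟨b, hb⟩ := (ih _ h2 J hJ0 rfl (h2.trans hlt)).principal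
    refine ⟨a * b, ?_⟩
    rw [hJ, ha, hb]
    simp only [Ideal.submodule_span_eq]
    rw [Ideal.span_singleton_mul_span_singleton]


end C2

namespace C2
open Polynomial Module NumberField

variable {K : Type} [Field K] [NumberField K] [KD K]
local notation "β" => (KD.b : K)

lemma trace_ev (x : V) : Algebra.trace ℚ K (ev x) = 7 * x.a0 := by
  rw [Algebra.trace_eq_matrix_trace (KD.bas (K := K)), Matrix.trace]
  have key : ∀ n : ℕ, (ev x : K) * β ^ n = ev (V.sh^[n] x) := by
    intro n
    induction n with
    | zero => simp
    | succ n ih => rw [pow_succ, ← mul_assoc, ih, Function.iterate_succ_apply', ev_sh]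
  have : ∀ i : Fin 7, (Algebra.leftMulMatrix (KD.bas (K := K)) (ev x)).diag i = x.a0 := by
    intro i
    rw [Matrix.diag_apply, Algebra.leftMulMatrix_eq_repr_mul, KD.hbas, key, repr_ev]
    fin_cases i <;> rfl
  simp only [this]
  simp

lemma trace_pow (n : Fin 13) : Algebra.trace ℚ K (β ^ (n : ℕ)) = if (n : ℕ) = 0 then 7 else if (n:ℕ) = 7 then 126 else 0 := by
  have key : ∀ n : ℕ, (β) ^ n = ev (V.sh^[n] ⟨1,0,0,0,0,0,0⟩) := by
    intro n
    induction n with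
    | zero => simp [ev]
    | succ n ih => rw [pow_succ, ih, Function.iterate_succ_apply', ev_sh]
  rw [key, trace_ev]
  fin_cases n <;> simp [V.sh] <;> norm_num

lemma discr_bas : |Algebra.discr ℚ (KD.bas (K := K))| = 7^7*18^6 := by
  rw [Algebra.discr_def]
  set M := Algebra.traceMatrix ℚ (KD.bas (K := K)) with hM
  have hMe : ∀ i j : Fin 7, M i j = if (i : ℕ) + j = 0 then 7 else if (i:ℕ) + j = 7 then 126 else 0 := by
    intro i j
    rw [hM, Algebra.traceMatrix_apply, Algebra.traceForm_apply, KD.hbas, KD.hbas, ← pow_add]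
    exact trace_pow ⟨i + j, by omega⟩
  let σ : Equiv.Perm (Fin 7) := ⟨fun i => -i, fun i => -i, fun i => by simp, fun i => by simp⟩
  have h1 := Matrix.det_permute σ M
  have h2 : M.submatrix σ id = Matrix.diagonal (fun i : Fin 7 => if i = 0 then (7:ℚ) else 126) := by
    ext i j
    rw [Matrix.submatrix_apply, hMe]
    have hd : ∀ i j : Fin 7, (if ((-i : Fin 7) : ℕ) + (j : ℕ) = 0 then (7 : ℚ) else
      if ((-i : Fin 7) : ℕ) + (j : ℕ) = 7 then 126 else 0) = if i = j then (if i = 0 then 7 else 126) else 0 := by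
      decide +kernel
    rw [Matrix.diagonal_apply, ← hd]; rfl
  rw [h2, Matrix.det_diagonal] at h1
  have h3 := congrArg abs h1
  rw [abs_mul] at h3
  have h4 : |((Equiv.Perm.sign σ : ℤ) : ℚ)| = 1 := by
    rcases Int.units_eq_one_or (Equiv.Perm.sign σ) with h | h <;> simp [h]
  rw [h4, one_mul] at h3
  rw [← h3]
  simp [Fin.prod_univ_succ]
  norm_num

/-- integral family -/
def fam (i : Fin 7) : K := ![1, β, β^2, β^3, β^4/3, β^5/3, ev vu3/21] i

lemma fam_int (i : Fin 7) : IsIntegral ℤ (fam (K := K) i) := by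
  have hb := int_b (K := K)
  fin_cases i
  · exact isIntegral_one
  · exact hb
  · exact hb.pow 2
  · exact hb.pow 3
  · exact int_t4
  · exact int_t5
  · exact (u3 : 𝓞 K).2

def PM : Matrix (Fin 7) (Fin 7) ℚ := !![1,0,0,0,0,0,-15/21;0,1,0,0,0,0,-9/21;0,0,1,0,0,0,3/21;
  0,0,0,1,0,0,6/21;0,0,0,0,1/3,0,-2/21;0,0,0,0,0,1/3,3/21;0,0,0,0,0,0,-1/21]

lemma fam_eq : fam (K := K) = Matrix.vecMul (KD.bas (K := K)) (PM.map (algebraMap ℚ K)) := by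
  ext i
  simp only [Matrix.vecMul, dotProduct, Matrix.map_apply, KD.hbas, Fin.sum_univ_succ]
  fin_cases i <;> simp [fam, PM, ev, vu3] <;> ring

lemma PM_det : PM.det = -1/189 := by
  rw [Matrix.det_of_upperTriangular]
  · simp [Fin.prod_univ_succ, PM]; norm_num
  · intro i j h
    simp only [id] at h
    fin_cases i <;> fin_cases j <;> first | (exfalso; revert h; decide) | simp [PM]

lemma discr_fam : |Algebra.discr ℚ (fam (K := K))| = 7^5*6^6 := by
  rw [fam_eq, Algebra.discr_of_matrix_vecMul, PM_det, abs_mul, discr_bas]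
  norm_num

lemma discr_le : |discr K| ≤ 7^5*6^6 := by
  classical
  have hc : Fintype.card (Free.ChooseBasisIndex ℤ (𝓞 K)) = Fintype.card (Fin 7) := by
    rw [← finrank_eq_card_basis (integralBasis K), finr]; simp
  set B := (integralBasis K).reindex (Fintype.equivOfCardEq hc) with hB
  have hd : Algebra.discr ℚ B = discr K := by
    rw [coe_discr, hB, Basis.coe_reindex, Algebra.discr_reindex]
  have h1 := Basis.toMatrix_map_vecMul B (fam (K := K))
  have h2 := Algebra.discr_of_matrix_vecMul (A := ℚ) B (B.toMatrix (fam (K := K)))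
  rw [h1, hd] at h2
  have h3 : ∃ N : Matrix (Fin 7) (Fin 7) ℤ, B.toMatrix (fam (K := K)) = N.map (algebraMap ℤ ℚ) := by
    have : ∀ i j, ∃ n : ℤ, B.toMatrix (fam (K := K)) i j = n := by
      intro i j
      rw [Basis.toMatrix_apply, hB, Basis.repr_reindex_apply]
      have := integralBasis_repr_apply K ⟨fam j, fam_int j⟩ ((Fintype.equivOfCardEq hc).symm i)
      exact ⟨_, this⟩
    choose N hN using this
    exact ⟨N, by ext i j; rw [hN]; rfl⟩
  obtain ⟨N, hN⟩ := h3
  have h4 := discr_fam (K := K)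
  have h5 : (B.toMatrix (fam (K := K))).det = (N.det : ℚ) := by
    rw [hN]; exact (RingHom.map_det (algebraMap ℤ ℚ) N).symm
  rw [h2, h5] at h4
  have h6 : N.det^2 * |discr K| = 7^5*6^6 := by
    rw [abs_mul, abs_of_nonneg (sq_nonneg _)] at h4; exact_mod_cast h4
  have h7 : N.det ≠ 0 := by intro h; rw [h] at h6; norm_num at h6
  have h8 : 1 ≤ N.det^2 := by have := sq_nonneg N.det; have := pow_ne_zero 2 h7; omega
  nlinarith [abs_nonneg (discr K)]

lemma real_emb (φ ψ : K →+* ℂ) (h1 : ComplexEmbedding.IsReal φ) (h2 : ComplexEmbedding.IsReal ψ) : φ = ψ := by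
  have key : ∀ φ : K →+* ℂ, ComplexEmbedding.IsReal φ → ∃ r : ℝ, φ β = r ∧ r^7 = 18 := by
    intro φ h
    have h3 : (starRingEnd ℂ) (φ β) = φ β := by
      have := congrArg (fun f : K →+* ℂ => f β) h
      simpa [ComplexEmbedding.IsReal] using this
    obtain ⟨r, hr⟩ := Complex.conj_eq_iff_real.mp h3
    refine ⟨r, hr, ?_⟩
    have := congrArg φ (hb (K := K))
    rw [map_pow, hr, map_ofNat] at this
    exact_mod_cast this
  obtain ⟨r, hr, hr7⟩ := key φ h1
  obtain ⟨s, hs, hs7⟩ := key ψ h2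
  have hrs : r = s := (Odd.strictMono_pow (by decide : Odd 7)).injective (by simp [hr7, hs7])
  have e : φ.toRatAlgHom = ψ.toRatAlgHom := by
    apply AlgHom.toLinearMap_injective
    apply (KD.bas (K := K)).ext
    intro i
    rw [KD.hbas]
    simp [hr, hs, hrs]
  have := congrArg (fun f : K →ₐ[ℚ] ℂ => (f : K →+* ℂ)) e
  ext x
  exact congrArg (fun f : K →ₐ[ℚ] ℂ => f x) e

open InfinitePlace in
lemma nr1 : nrRealPlaces K ≤ 1 := by
  classical
  rw [nrRealPlaces, Fintype.card_le_one_iff]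
  rintro ⟨v, hv⟩ ⟨w, hw⟩
  obtain ⟨φ, hφ, rfl⟩ := hv
  obtain ⟨ψ, hψ, rfl⟩ := hw
  apply Subtype.ext
  change InfinitePlace.mk φ = InfinitePlace.mk ψ
  rw [real_emb φ ψ hφ hψ]

open InfinitePlace in
lemma sig : nrRealPlaces K = 1 ∧ nrComplexPlaces K = 3 := by
  have h1 := nr1 (K := K)
  have h2 := card_add_two_mul_card_eq_rank K
  rw [finr] at h2
  omega

lemma pid : IsPrincipalIdealRing (𝓞 K) := by
  apply RingOfIntegers.isPrincipalIdealRing_of_isPrincipal_of_norm_le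
  intro I hI
  apply princ (Ideal.absNorm (I : Ideal (𝓞 K))) _ (nonZeroDivisors.coe_ne_zero I) rfl
  have h1 : √|((discr K : ℤ) : ℝ)| ≤ 28003 := by
    rw [Real.sqrt_le_left (by norm_num)]
    have := discr_le (K := K)
    have h : ((|discr K| : ℤ) : ℝ) ≤ ((7^5*6^6 : ℤ) : ℝ) := by exact_mod_cast this
    push_cast at h
    refine h.trans (by norm_num)
  rw [(sig (K := K)).2, finr] at hI
  have h2 : (4 / Real.pi)^3 ≤ (4/3.1415)^3 := by
    have := Real.pi_gt_d4
    gcongr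
  have h3 : (4 / Real.pi)^3 * ((Nat.factorial 7 : ℝ)/(7:ℕ)^7 * √|((discr K : ℤ) : ℝ)|) ≤ (4/3.1415)^3 * ((Nat.factorial 7 : ℝ)/(7:ℕ)^7 * 28003) := by
    gcongr
  have h4 : (4/3.1415:ℝ)^3 * ((Nat.factorial 7 : ℝ)/(7:ℕ)^7 * 28003) < 354 := by
    norm_num [Nat.factorial]
  have : ((Ideal.absNorm (I : Ideal (𝓞 K)) : ℕ) : ℝ) < (354 : ℕ) := by
    push_cast
    linarith
  exact_mod_cast this

end C2

namespace C2
open Polynomial Module NumberField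

variable {K : Type} [Field K] [NumberField K] [KD K]
local notation "β" => (KD.b : K)

def toV (f : Fin 7 → ℤ) : V := ⟨f 0, f 1, f 2, f 3, f 4, f 5, f 6⟩

lemma mul_co (c : V) (f : Fin 7 → ℤ) (j : Fin 7) :
    (c.mul (toV f)).co j = ∑ i, f i * toM 7 c.rows i j := by
  fin_cases j <;> simp [Fin.sum_univ_succ, toM, V.rows, V.sh, V.li, V.mul, V.co, toV, Fin.succ] <;> ring

lemma det_odd (c : V) (h : Odd c.a0) : Odd (toM 7 c.rows).det := by
  rw [← ZMod.intCast_eq_one_iff_odd] at h ⊢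
  rw [← eq_intCast (Int.castRingHom (ZMod 2)), RingHom.map_det, Matrix.det_of_upperTriangular]
  · apply Finset.prod_eq_one
    intro i _
    fin_cases i <;> simpa [toM, V.rows, V.sh, V.li] using h
  · have h18 : (18 : ZMod 2) = 0 := by decide
    intro i j hij
    simp only [id] at hij
    fin_cases i <;> fin_cases j <;> first | (exfalso; revert hij; decide) | simp [toM, V.rows, V.sh, V.li, h18]

lemma exists_adj (c : V) (h : Odd c.a0) : ∃ d : V, ∃ m : ℤ, Odd m ∧ c.mul d = V.C m := by
  refine ⟨toV (fun i => (toM 7 c.rows).adjugate 0 i), (toM 7 c.rows).det, det_odd c h, ?_⟩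
  have h1 : ∀ j, (c.mul (toV (fun i => (toM 7 c.rows).adjugate 0 i))).co j
      = if (0 : Fin 7) = j then (toM 7 c.rows).det else 0 := by
    intro j
    rw [mul_co]
    have := congrFun (congrFun (Matrix.adjugate_mul (toM 7 c.rows)) 0) j
    rw [Matrix.mul_apply] at this
    rw [this, Matrix.smul_apply, Matrix.one_apply]
    simp
  have h2 := fun j => h1 j
  ext
  · exact h2 0
  · exact h2 1
  · exact h2 2
  · exact h2 3
  · exact h2 4
  · exact h2 5
  · exact h2 6

variable (K) in
/-- local ring at two -/
def R : Subring K where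
  carrier := {a | ∃ n : ℤ, Odd n ∧ ∃ c : V, (n : K) * a = ev c}
  mul_mem' := by
    rintro a b ⟨n, hn, c, hc⟩ ⟨m, hm, d, hd⟩
    refine ⟨n * m, hn.mul hm, c.mul d, ?_⟩
    rw [ev_mul, ← hc, ← hd]; push_cast; ring
  one_mem' := ⟨1, odd_one, V.C 1, by rw [ev_C]; simp⟩
  add_mem' := by
    rintro a b ⟨n, hn, c, hc⟩ ⟨m, hm, d, hd⟩
    refine ⟨n * m, hn.mul hm, (c.smul m).add (d.smul n), ?_⟩
    rw [ev_add, ev_smul, ev_smul, ← hc, ← hd]; push_cast; ring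
  zero_mem' := ⟨1, odd_one, V.C 0, by rw [ev_C]; simp⟩
  neg_mem' := by
    rintro a ⟨n, hn, c, hc⟩
    refine ⟨n, hn, c.smul (-1), ?_⟩
    rw [ev_smul, ← hc]; push_cast; ring

lemma ev_memR (c : V) : (ev c : K) ∈ R K := ⟨1, odd_one, c, by simp⟩
lemma b_memR : β ∈ R K := ⟨1, odd_one, ⟨0,1,0,0,0,0,0⟩, by simp [ev]⟩
lemma odd_ne {n : ℤ} (h : Odd n) : (n : K) ≠ 0 := by
  have : n ≠ 0 := by rintro rfl; exact absurd h (by decide)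
  exact_mod_cast this
lemma inv_memR {n : ℤ} (h : Odd n) : ((n : K))⁻¹ ∈ R K :=
  ⟨n, h, V.C 1, by rw [mul_inv_cancel₀ (odd_ne h), ev_C]; simp⟩

def bR : R K := ⟨β, b_memR⟩
lemma coe_bR : ((bR : R K) : K) = β := rfl
def evR (c : V) : R K := ⟨ev c, ev_memR c⟩
lemma coe_evR (c : V) : ((evR c : R K) : K) = ev c := rfl
lemma evR_def (c : V) : (evR c : R K) = (c.a0 : R K) + (c.a1 : R K) * (bR : R K) + (c.a2 : R K) * (bR : R K)^2 + (c.a3 : R K)*(bR : R K)^3 + (c.a4 : R K)*(bR : R K)^4 + (c.a5 : R K)*(bR : R K)^5 + (c.a6 : R K)*(bR : R K)^6 := by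
  apply Subtype.ext; push_cast; rw [coe_evR, coe_bR, ev]
lemma evR_mul (c d : V) : (evR (c.mul d) : R K) = evR c * evR d := Subtype.ext (ev_mul c d)
lemma evR_add (c d : V) : (evR (c.add d) : R K) = evR c + evR d := Subtype.ext (ev_add c d)
lemma evR_sub (c d : V) : (evR (c.sub d) : R K) = evR c - evR d := Subtype.ext (ev_sub c d)
lemma evR_C (n : ℤ) : (evR (V.C n) : R K) = n := Subtype.ext (by rw [coe_evR, ev_C]; push_cast; rfl)

noncomputable def eta : R K := ⟨(((9 : ℤ) : K))⁻¹, inv_memR (by decide)⟩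
local notation "b" => (bR : R K)
local notation "η" => (eta : R K)

lemma two_eq : (2 : R K) = b^7 * η := by
  apply Subtype.ext
  change (2 : K) = β^7 * _
  rw [hb, eta]
  norm_num
lemma nine_eta : (9 : R K) * η = 1 := by
  apply Subtype.ext
  change (9 : K) * _ = 1
  rw [eta]
  norm_num
lemma bR_ne : b ≠ 0 := by
  intro h; exact b_ne (K := K) (congrArg Subtype.val h)
lemma odd_unit {n : ℤ} (h : Odd n) : IsUnit (n : R K) := by
  refine IsUnit.of_mul_eq_one ⟨((n : K))⁻¹, inv_memR h⟩ ?_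
  apply Subtype.ext
  push_cast
  exact mul_inv_cancel₀ (odd_ne h)
lemma two_dvd : (b ∣ 2) := ⟨b^6*η, by rw [two_eq]; ring⟩

/-- residue field is F2 -/
lemma dich (a : R K) : b ∣ a ∨ b ∣ (a - 1) := by
  obtain ⟨a, n, hn, c, hc⟩ := a
  have hc' : (n : R K) * ⟨a, n, hn, c, hc⟩ = evR c := Subtype.ext (by push_cast; exact hc)
  generalize (⟨a, n, hn, c, hc⟩ : R K) = x at hc' ⊢
  have hu := odd_unit (K := K) hn
  rw [evR_def] at hc'
  rcases Int.even_or_odd c.a0 with ⟨k, hk⟩ | ho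
  · left
    apply (hu.dvd_mul_left).mp
    rw [hc', hk]
    obtain ⟨q, hq⟩ := two_dvd (K := K)
    refine ⟨q * k + c.a1 + c.a2 * b + c.a3*b^2 + c.a4*b^3 + c.a5*b^4 + c.a6*b^5, ?_⟩
    push_cast
    linear_combination (k : R K) * hq
  · right
    apply (hu.dvd_mul_left).mp
    obtain ⟨k, hk⟩ := ho.sub_odd hn
    have hk' : (c.a0 : R K) - n = k + k := by exact_mod_cast hk
    obtain ⟨q, hq⟩ := two_dvd (K := K)
    refine ⟨q * k + c.a1 + c.a2 * b + c.a3*b^2 + c.a4*b^3 + c.a5*b^4 + c.a6*b^5, ?_⟩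
    linear_combination (k : R K) * hq + hc' + hk'

lemma unit_of (a : R K) (h : b ∣ a - 1) : IsUnit a := by
  obtain ⟨q, hq⟩ := h
  obtain ⟨n, hn, c, hc⟩ := q.2
  have hc' : (n : R K) * q = evR c := Subtype.ext (by push_cast; exact hc)
  have h1 : (n : R K) * a = evR ((V.C n).add (c.mul ⟨0,1,0,0,0,0,0⟩)) := by
    rw [evR_add, evR_mul, ← hc', evR_C, evR_def]
    push_cast
    linear_combination (n : R K) * hq
  obtain ⟨d, m, hm, hd⟩ := exists_adj ((V.C n).add (c.mul ⟨0,1,0,0,0,0,0⟩)) (by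
    simp only [V.C, V.add, V.mul]
    obtain ⟨k, hk⟩ := hn
    exact ⟨k + 9 * c.a6, by rw [hk]; ring⟩)
  have h2 := congrArg (evR (K := K)) hd
  rw [evR_mul, ← h1, evR_C] at h2
  have h3 : IsUnit ((n : R K) * a * evR d) := by rw [h2]; exact odd_unit hm
  exact isUnit_of_mul_isUnit_right (isUnit_of_mul_isUnit_left h3)

lemma not_b_dvd_one : ¬ (b ∣ (1 : R K)) := by
  rintro ⟨q, hq⟩
  obtain ⟨n, hn, c, hc⟩ := q.2
  have h1 : (ev (V.C n) : K) = ev (c.mul ⟨0,1,0,0,0,0,0⟩) := by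
    rw [ev_mul, ← hc, ev_C]
    have := congrArg Subtype.val hq
    push_cast at this
    rw [coe_bR] at this
    have e : (ev ⟨0,1,0,0,0,0,0⟩ : K) = β := by simp [ev]
    rw [e]
    linear_combination (n : K) * this
  have h2 := congrArg V.a0 (ev_inj h1)
  simp only [V.C, V.mul] at h2
  obtain ⟨k, hk⟩ := hn
  omega

lemma unit_iff (a : R K) : IsUnit a ↔ ¬ b ∣ a := by
  constructor
  · rintro h hd
    exact not_b_dvd_one (hd.trans h.dvd)
  · intro h
    rcases dich a with h1 | h1
    · exact absurd h1 h
    · exact unit_of a h1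

lemma unit_iff' (a : R K) : IsUnit a ↔ b ∣ a - 1 := by
  refine ⟨fun h => ?_, unit_of a⟩
  rcases dich a with h1 | h1
  · exact absurd h1 ((unit_iff a).mp h)
  · exact h1

lemma b_prime : Prime (b) := by
  refine ⟨bR_ne, fun h => (unit_iff _).mp h (dvd_refl _), fun x y h => ?_⟩
  by_contra hn
  push Not at hn
  exact (unit_iff _).mp (((unit_iff x).mpr hn.1).mul ((unit_iff y).mpr hn.2)) h

lemma ex_two_odd {n : ℤ} (h : n ≠ 0) : ∃ (k : ℕ) (m : ℤ), Odd m ∧ n = 2^k * m := by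
  obtain ⟨k, m, hm, h1⟩ := Nat.exists_eq_two_pow_mul_odd (n := n.natAbs) (by simpa using h)
  have hm' : Odd (m : ℤ) := by exact_mod_cast hm
  have h2 : ((n.natAbs : ℕ) : ℤ) = 2^k * m := by exact_mod_cast h1
  rcases Int.natAbs_eq n with h3 | h3
  · exact ⟨k, m, hm', by rw [← h2]; exact h3⟩
  · exact ⟨k, -m, hm'.neg, by rw [mul_neg, ← h2]; exact h3⟩

lemma two_pow_mem (a : K) : ∃ k : ℕ, β^k * a ∈ R K := by
  obtain ⟨n, hn, c, hc⟩ := exists_ev a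
  obtain ⟨k, m, hm, rfl⟩ := ex_two_odd hn
  refine ⟨7 * k, m, hm, c.smul (9^k), ?_⟩
  rw [ev_smul, ← hc, pow_mul, hb]
  push_cast
  rw [show (18 : K) = 9 * 2 by norm_num, mul_pow]; ring

lemma int_fin (a : R K) (ha : a ≠ 0) : ∃ k : ℕ, ¬ b^k ∣ a := by
  obtain ⟨k, hk⟩ := two_pow_mem (K := K) ((a : K)⁻¹)
  refine ⟨k+1, ?_⟩
  rintro ⟨q, hq⟩
  apply not_b_dvd_one (K := K)
  refine ⟨q * ⟨_, hk⟩, ?_⟩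
  apply Subtype.ext
  have ha' : (a : K) ≠ 0 := by simpa using ha
  have := congrArg Subtype.val hq
  push_cast at this ⊢
  rw [coe_bR] at this ⊢
  field_simp
  linear_combination this

lemma exists_unit (a : R K) (ha : a ≠ 0) : ∃ (k : ℕ) (u : R K), IsUnit u ∧ a = b^k * u := by
  classical
  have h := int_fin a ha
  have hs := Nat.find_spec h
  have hm : Nat.find h ≠ 0 := by intro h0; rw [h0] at hs; simp at hs
  have h1 : b^(Nat.find h - 1) ∣ a := by
    by_contra hc
    have := Nat.find_min' h hc
    omega
  obtain ⟨u, hu⟩ := h1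
  refine ⟨_, u, ?_, hu⟩
  rw [unit_iff]
  rintro ⟨q, hq⟩
  apply hs
  refine ⟨q, ?_⟩
  refine hu.trans ?_
  rw [hq, ← mul_assoc, ← pow_succ]
  congr 2; omega

/-- every nonzero element is a power of β times a unit -/
lemma exists_ord (a : K) (ha : a ≠ 0) : ∃ (N : ℤ) (u : R K), IsUnit u ∧ a = β^N * u := by
  obtain ⟨k, hk⟩ := two_pow_mem a
  have h0 : (⟨_, hk⟩ : R K) ≠ 0 := by
    intro h
    have := congrArg Subtype.val h
    simp [ha, b_ne] at this
  obtain ⟨j, u, hu, h⟩ := exists_unit _ h0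
  refine ⟨j - k, u, hu, ?_⟩
  have := congrArg Subtype.val h
  push_cast at this
  rw [coe_bR] at this
  rw [zpow_sub₀ b_ne]
  have hb' := b_ne (K := K)
  field_simp
  rw [zpow_natCast, zpow_natCast]
  linear_combination this

end C2

namespace C2
open Polynomial Module NumberField

variable {K : Type} [Field K] [NumberField K] [KD K]
local notation "β" => (KD.b : K)
local notation "b" => (bR : R K)
local notation "η" => (eta : R K)

/-- congruence modulo powers of the uniformizer -/
def Cg (n : ℕ) (x y : R K) : Prop := b^n ∣ x - y

lemma Cg.refl (n : ℕ) (x : R K) : Cg n x x := by simp [Cg]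
lemma Cg.symm {n : ℕ} {x y : R K} (h : Cg n x y) : Cg n y x := by
  unfold Cg at *; rw [← neg_sub]; exact h.neg_right
lemma Cg.trans {n : ℕ} {x y z : R K} (h : Cg n x y) (h' : Cg n y z) : Cg n x z := by
  unfold Cg at *; have := dvd_add h h'; simpa using this
lemma Cg.mul {n : ℕ} {x y x' y' : R K} (h : Cg n x y) (h' : Cg n x' y') : Cg n (x*x') (y*y') := by
  obtain ⟨q, hq⟩ := h
  obtain ⟨q', hq'⟩ := h'
  exact ⟨q * x' + y * q', by linear_combination x' * hq + y * hq'⟩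
lemma Cg.add {n : ℕ} {x y x' y' : R K} (h : Cg n x y) (h' : Cg n x' y') : Cg n (x+x') (y+y') := by
  obtain ⟨q, hq⟩ := h
  obtain ⟨q', hq'⟩ := h'
  exact ⟨q + q', by linear_combination hq + hq'⟩
lemma Cg.mono {n m : ℕ} {x y : R K} (h : Cg n x y) (hm : m ≤ n) : Cg m x y :=
  (pow_dvd_pow _ hm).trans h

def V.red (c : V) : V := ⟨c.a0 % 8, c.a1 % 8, c.a2 % 8, c.a3 % 8, c.a4 % 8, c.a5 % 8, c.a6 % 8⟩

lemma eight_dvd (n : ℤ) (h : n % 8 = 0) : b^15 ∣ (n : R K) := by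
  obtain ⟨k, hk⟩ := Int.dvd_of_emod_eq_zero h
  refine ⟨b^6*η^3*k, ?_⟩
  rw [hk]; push_cast
  rw [show (8 : R K) = 2^3 by norm_num, two_eq]; ring

lemma four_dvd (n : ℤ) (h : n % 4 = 0) : b^14 ∣ (n : R K) := by
  obtain ⟨k, hk⟩ := Int.dvd_of_emod_eq_zero h
  refine ⟨η^2*k, ?_⟩
  rw [hk]; push_cast
  rw [show (4 : R K) = 2^2 by norm_num, two_eq]; ring

def c15 (c d : V) : Bool :=
  (c.a0 - d.a0) % 8 == 0 && (c.a1 - d.a1) % 4 == 0 && (c.a2 - d.a2) % 4 == 0 && (c.a3 - d.a3) % 4 == 0 &&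
  (c.a4 - d.a4) % 4 == 0 && (c.a5 - d.a5) % 4 == 0 && (c.a6 - d.a6) % 4 == 0

lemma cg_of_c15 {c d : V} (h : c15 c d = true) : Cg 15 (evR c : R K) (evR d) := by
  simp only [c15, Bool.and_eq_true, beq_iff_eq] at h
  obtain ⟨⟨⟨⟨⟨⟨h0, h1⟩, h2⟩, h3⟩, h4⟩, h5⟩, h6⟩ := h
  obtain ⟨q0, e0⟩ := eight_dvd (K := K) _ h0
  obtain ⟨q1, e1⟩ := four_dvd (K := K) _ h1
  obtain ⟨q2, e2⟩ := four_dvd (K := K) _ h2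
  obtain ⟨q3, e3⟩ := four_dvd (K := K) _ h3
  obtain ⟨q4, e4⟩ := four_dvd (K := K) _ h4
  obtain ⟨q5, e5⟩ := four_dvd (K := K) _ h5
  obtain ⟨q6, e6⟩ := four_dvd (K := K) _ h6
  push_cast at e0 e1 e2 e3 e4 e5 e6
  refine ⟨q0 + q1 + b * q2 + b^2*q3 + b^3*q4 + b^4*q5+b^5*q6, ?_⟩
  rw [evR_def, evR_def]
  linear_combination e0 + b * e1 + b^2*e2+b^3*e3+b^4*e4+b^5*e5+b^6*e6

lemma c15_of_cg {c d : V} (h : Cg 15 (evR c : R K) (evR d)) : c15 c d = true := by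
  obtain ⟨q, hq⟩ := h
  obtain ⟨n, hn, f, hf⟩ := q.2
  have h1 : (ev ((V.C n).mul (c.sub d)) : K) = ev (f.mul ⟨0,324,0,0,0,0,0⟩) := by
    rw [ev_mul, ev_mul, ← hf, ev_C]
    have := congrArg Subtype.val hq
    rw [← evR_sub] at this
    push_cast at this
    rw [coe_bR, coe_evR] at this
    have e : (ev ⟨0,324,0,0,0,0,0⟩ : K) = β^15 := by
      simp [ev]; linear_combination -(β^8+18*β)* hb (K := K)
    rw [e]
    linear_combination (n : K) * this
  have h2 := ev_inj h1
  simp only [V.mul, V.sub, V.add, V.smul, V.C, V.mk.injEq] at h2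
  ring_nf at h2
  obtain ⟨h0, h1, h2, h3, h4, h5, h6⟩ := h2
  have key : ∀ x m : ℤ, (m = 8 ∨ m = 4) → m ∣ n * x → x % m = 0 := by
    intro x m hm hd
    have hc : IsCoprime m n := by
      obtain ⟨k, hk⟩ := hn
      have : IsCoprime (2:ℤ) n := ⟨-k, 1, by rw [hk]; ring⟩
      rcases hm with rfl | rfl
      · exact (this.pow_left (m := 3))
      · exact (this.pow_left (m := 2))
    exact Int.emod_eq_zero_of_dvd (hc.dvd_of_dvd_mul_left hd)
  simp only [c15, Bool.and_eq_true, beq_iff_eq]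
  refine ⟨⟨⟨⟨⟨⟨key _ 8 (by simp) ⟨729*f.a6, ?_⟩, key _ 4 (by simp) ⟨81*f.a0, ?_⟩⟩, key _ 4 (by simp) ⟨81*f.a1, ?_⟩⟩, key _ 4 (by simp) ⟨81*f.a2, ?_⟩⟩, key _ 4 (by simp) ⟨81*f.a3, ?_⟩⟩, key _ 4 (by simp) ⟨81*f.a4, ?_⟩⟩, key _ 4 (by simp) ⟨81*f.a5, ?_⟩⟩ <;> linarith

lemma cg_red (c : V) : Cg 15 (evR c : R K) (evR c.red) := by
  apply cg_of_c15
  simp only [c15, V.red, Bool.and_eq_true, beq_iff_eq]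
  omega

def sV (n : ℕ) : V := ⟨1, (n % 2 : ℕ), (n / 2 % 2 : ℕ), (n / 4 % 2 : ℕ), (n / 8 % 2 : ℕ), (n / 16 % 2 : ℕ), (n / 32 % 2 : ℕ)⟩

lemma bits6 : ∀ f0 f1 f2 f3 f4 f5 : Bool, ∃ n < 64, (n % 2 = f0.toNat) ∧ (n / 2 % 2 = f1.toNat) ∧
  (n / 4 % 2 = f2.toNat) ∧ (n / 8 % 2 = f3.toNat) ∧ (n / 16 % 2 = f4.toNat) ∧ (n / 32 % 2 = f5.toNat) := by
  intro f0 f1 f2 f3 f4 f5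
  refine ⟨f0.toNat + 2 * f1.toNat + 4 * f2.toNat + 8 * f3.toNat + 16 * f4.toNat + 32 * f5.toNat, ?_⟩
  have h0 := f0.toNat_lt; have h1 := f1.toNat_lt; have h2 := f2.toNat_lt
  have h3 := f3.toNat_lt; have h4 := f4.toNat_lt; have h5 := f5.toNat_lt
  omega

lemma parity (n : ℤ) : ∃ (f : Bool) (k : ℤ), n = (f.toNat : ℤ) + 2 * k := by
  rcases Int.even_or_odd n with ⟨k, hk⟩ | ⟨k, hk⟩
  · exact ⟨false, k, by simp; omega⟩
  · exact ⟨true, k, by simp; omega⟩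

/-- residues of units modulo two -/
lemma unit_rep (s : R K) (hs : IsUnit s) : ∃ n < 64, Cg 7 s (evR (sV n)) := by
  obtain ⟨n, hn, c, hc⟩ := s.2
  have hc' : (n : R K) * s = evR c := Subtype.ext (by push_cast; exact hc)
  obtain ⟨f0, k0, h0⟩ := parity c.a0
  obtain ⟨f1, k1, h1⟩ := parity c.a1
  obtain ⟨f2, k2, h2⟩ := parity c.a2
  obtain ⟨f3, k3, h3⟩ := parity c.a3
  obtain ⟨f4, k4, h4⟩ := parity c.a4
  obtain ⟨f5, k5, h5⟩ := parity c.a5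
  obtain ⟨f6, k6, h6⟩ := parity c.a6
  obtain ⟨m, hm, m1, m2, m3, m4, m5, m6⟩ := bits6 f1 f2 f3 f4 f5 f6
  obtain ⟨k, hk⟩ := hn
  have hk' : (n : R K) = 2 * k + 1 := by exact_mod_cast hk
  rw [evR_def, h0, h1, h2, h3, h4, h5, h6] at hc'
  push_cast at hc'
  have t := two_eq (K := K)
  have hf : f0 = true := by
    by_contra hf
    simp only [Bool.not_eq_true] at hf
    rw [unit_iff] at hs
    apply hs
    rw [hf] at hc'
    simp only [Bool.toNat_false, Nat.cast_zero] at hc'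
    refine ⟨((f1.toNat : R K) + f2.toNat * b + f3.toNat * b^2+ f4.toNat * b^3+ f5.toNat * b^4+ f6.toNat * b^5) + b^6*η*(k0+k1*b+k2*b^2+k3*b^3+k4*b^4+k5*b^5+k6*b^6-k*s), ?_⟩
    linear_combination hc' - s*hk' + (k0+k1*b+k2*b^2+k3*b^3+k4*b^4+k5*b^5+k6*b^6-k*s) * t
  refine ⟨m, hm, η*(k0+k1*b+k2*b^2+k3*b^3+k4*b^4+k5*b^5+k6*b^6-k*s), ?_⟩
  rw [evR_def, sV, m1, m2, m3, m4, m5, m6]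
  rw [hf] at hc'
  simp only [Bool.toNat_true] at hc'
  push_cast at hc' ⊢
  linear_combination hc' - s*hk' + (k0+k1*b+k2*b^2+k3*b^3+k4*b^4+k5*b^5+k6*b^6-k*s) * t

lemma eta_one : ∃ q : R K, η = 1 + b * q := by
  refine ⟨-(4*b^6*η*η), ?_⟩
  linear_combination (nine_eta (K := K)) - (4*η)*two_eq (K := K)

lemma sq_cg {s t : R K} (ht : IsUnit t) (h : Cg 7 s t) : Cg 15 (s*s) (t*t) := by
  obtain ⟨a, ha⟩ := h
  obtain ⟨q, hq⟩ := eta_one (K := K)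
  obtain ⟨r, hr⟩ := (unit_iff' t).mp ht
  have h2 := two_eq (K := K)
  have e : s*s - t*t = b^14 * (a*(a+1) + b*(a*(q + r + b*q*r))) := by
    have : s = t + b^7*a := by linear_combination ha
    have ht : t = 1 + b * r := by linear_combination hr
    rw [this]
    linear_combination (t*b^7*a) * h2 + t*b^14*a*hq + b^14*a*(1+b*q)*ht
  have h3 : b ∣ a * (a+1) := by
    rcases dich a with h | h
    · exact h.mul_right _
    · refine Dvd.dvd.mul_left ?_ _
      have := dvd_add h (two_dvd (K := K))
      have e : a - 1 + 2 = a + 1 := by ring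
      rwa [e] at this
  obtain ⟨w, hw⟩ := h3
  exact ⟨w + a*(q + r + b*q*r), by rw [e]; linear_combination b^14*hw⟩

lemma sV_unit (n : ℕ) : IsUnit (evR (sV n) : R K) := by
  rw [unit_iff', evR_def, sV]
  exact ⟨((n % 2 : ℕ) : R K) + (n / 2 % 2 : ℕ)*b + (n / 4 % 2 : ℕ)*b^2 + (n / 8 % 2 : ℕ)*b^3 + (n / 16 % 2 : ℕ)*b^4 + (n / 32 % 2 : ℕ)*b^5, by simp only [Int.cast_natCast, Int.cast_one]; ring⟩

lemma sq_rep (s : R K) (hs : IsUnit s) : ∃ n < 64, Cg 15 (s*s) (evR ((sV n).mul (sV n))) := by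
  obtain ⟨n, hn, h⟩ := unit_rep s hs
  exact ⟨n, hn, by rw [evR_mul]; exact sq_cg (sV_unit n) h⟩

end C2

namespace C2
open Polynomial Module NumberField

variable {K : Type} [Field K] [NumberField K] [KD K]
local notation "β" => (KD.b : K)
local notation "b" => (bR : R K)
local notation "η" => (eta : R K)

lemma mem21 (c : V) : (ev c : K)/21 ∈ R K := ⟨21, by decide, c, by push_cast; field_simp⟩
noncomputable def lR (c : V) : R K := ⟨(ev c : K)/21, mem21 c⟩
lemma coe_lR (c : V) : ((lR c : R K) : K) = ev c/21 := rfl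

lemma lR_cg (c : V) : Cg 15 (lR c : R K) (evR (c.smul 5)) := by
  have h : (21 : R K) * lR c = evR c := by
    apply Subtype.ext
    change (21 : K) * _ = _
    rw [coe_lR, coe_evR]; field_simp
  have h5 : (evR (c.smul 5) : R K) = 5 * evR c := by
    apply Subtype.ext
    change _ = (5 : K) * _
    rw [coe_evR, ev_smul, coe_evR]; push_cast; rfl
  rw [h5, ← h]
  refine ⟨-(13 * b^6*η^3 * lR c), ?_⟩
  have t : (8 : R K) = b^21*η^3 := by
    rw [show (8 : R K) = 2^3 by norm_num, two_eq]; ring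
  linear_combination (-13*lR c) * t

def gv (i : ℕ) : V := match i with
  | 0 => V.C (-1) | 1 => (vu1.smul 5).red | 2 => (vu3.smul 5).red | 3 => (vu4.smul 5).red | 4 => (vp1.smul 5).red | _ => (vp2.smul 5).red
noncomputable def gR (i : ℕ) : R K := match i with
  | 0 => -1 | 1 => lR vu1 | 2 => lR vu3 | 3 => lR vu4 | 4 => lR vp1 | _ => lR vp2
lemma g_cg (i : ℕ) : Cg 15 (gR i : R K) (evR (gv i)) := by
  match i with
  | 0 => 
    have : (gR 0 : R K) = evR (gv 0) := by rw [gv, evR_C, gR]; simp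
    rw [this]; exact Cg.refl _ _
  | 1 => exact (lR_cg _).trans (cg_red _)
  | 2 => exact (lR_cg _).trans (cg_red _)
  | 3 => exact (lR_cg _).trans (cg_red _)
  | 4 => exact (lR_cg _).trans (cg_red _)
  | (n+5) => exact (lR_cg _).trans (cg_red _)

def pwV (c : V) (e : ℕ) : V := if e = 0 then V.C 1 else c
def dV (n : ℕ) : V := (((((((pwV (gv 0) (n%2)).mul (pwV (gv 1) (n/2%2))).mul (pwV (gv 2) (n/4%2))).mul (pwV (gv 3) (n/8%2))).red.mul
  (pwV (gv 4) (n/16%2))).red.mul (pwV (gv 5) (n/32%2)))).red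
noncomputable def dR (n : ℕ) : R K :=
  gR 0^(n%2) * gR 1^(n/2%2)*gR 2^(n/4%2)*gR 3^(n/8%2)*gR 4^(n/16%2)*gR 5^(n/32%2)

lemma pw_cg (i : ℕ) (n : ℕ) : Cg 15 ((gR i : R K)^(n%2)) (evR (pwV (gv i) (n%2))) := by
  rcases Nat.mod_two_eq_zero_or_one n with h | h <;> rw [h, pwV]
  · simp only [pow_zero, if_true]; rw [evR_C]; simp [Cg]
  · simp only [pow_one, one_ne_zero, if_false]; exact g_cg i

lemma d_cg (n : ℕ) : Cg 15 (dR n : R K) (evR (dV n)) := by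
  unfold dR dV
  refine Cg.trans ?_ (cg_red _)
  rw [evR_mul]
  refine Cg.mul (Cg.trans ?_ (cg_red _)) (pw_cg _ _)
  rw [evR_mul]
  refine Cg.mul (Cg.trans ?_ (cg_red _)) (pw_cg _ _)
  rw [evR_mul, evR_mul, evR_mul]
  exact ((((pw_cg _ _).mul (pw_cg _ _)).mul (pw_cg _ _)).mul (pw_cg _ _))

def enc (x : V) : ℕ := (x.a0 % 8).toNat + 65536 * ((x.a1 % 8).toNat + 65536 * ((x.a2 % 8).toNat + 65536 * ((x.a3 % 8).toNat + 65536 *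
  ((x.a4 % 8).toNat + 65536 * ((x.a5 % 8).toNat + 65536 * (x.a6 % 8).toNat)))))
def fq (p : ℕ) : ℕ := p % 5192296858534827628530496329220096 + 18 * (p / 5192296858534827628530496329220096)
def ft (T : V) (q : ℕ) : Bool :=
  Nat.beq (q % 8) (T.a0 % 8).toNat && Nat.beq (q / 65536 % 4) (T.a1 % 4).toNat && Nat.beq (q / 65536 / 65536 % 4) (T.a2 % 4).toNat && Nat.beq (q / 65536 / 65536 / 65536 % 4) (T.a3 % 4).toNat && Nat.beq (q / 65536 / 65536 / 65536 / 65536 % 4) (T.a4 % 4).toNat && Nat.beq (q / 65536 / 65536 / 65536 / 65536 / 65536 % 4) (T.a5 % 4).toNat && Nat.beq (q / 65536 / 65536 / 65536 / 65536 / 65536 / 65536 % 4) (T.a6 % 4).toNat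
def f15 (T x y : V) : Bool := ft T (fq (enc x * enc y))

lemma dig (n : ℤ) : ∃ r : ℕ, (n % 8).toNat = r ∧ r ≤ 7 ∧ n ≡ r [ZMOD 8] :=
  ⟨_, rfl, by omega, by unfold Int.ModEq; omega⟩
lemma bd {r s : ℕ} (h : r ≤ 7) (h' : s ≤ 7) : r*s ≤ 49 := Nat.mul_le_mul h h'

lemma b18 {c d : ℕ} (h : c ≤ 343) (h' : d ≤ 343) : c+18*d < 65536 := by omega

lemma fq_eq {c0 c1 c2 c3 c4 c5 c6 d0 d1 d2 d3 d4 d5 : ℕ} (h : c0 ≤ 343 ∧ c1 ≤ 343 ∧ c2 ≤ 343 ∧ c3 ≤ 343 ∧ c4 ≤ 343 ∧ c5 ≤ 343 ∧ c6 ≤ 343) :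
    fq (c0 + 65536*(c1+65536*(c2+65536*(c3+65536*(c4+65536*(c5+65536*(c6+65536*(d0+65536*(d1+65536*(d2+65536*(d3+65536*(d4+65536*d5)))))))))))) =
    (c0+18*d0) + 65536*((c1+18*d1)+65536*((c2+18*d2)+65536*((c3+18*d3)+65536*((c4+18*d4)+65536*((c5+18*d5)+65536*c6))))) := by
  unfold fq; omega

lemma dstep {e r : ℕ} (h : e < 65536) : (e+65536*r)/65536 = r := by omega
lemma mst8 (e r : ℕ) : (e+65536*r) % 8 = e % 8 := by omega
lemma mst4 (e r : ℕ) : (e+65536*r) % 4 = e % 4 := by omega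
lemma mfin {t A : ℤ} {e : ℕ} (M : A ≡ (e : ℤ) [ZMOD 8]) (h : (t-A) % 4 = 0) : e % 4 = (t % 4).toNat := by
  unfold Int.ModEq at M; omega

lemma ft_of {T : V} {e0 e1 e2 e3 e4 e5 e6 : ℕ} {A0 A1 A2 A3 A4 A5 A6 : ℤ} (b0 : e0 < 65536) (b1 : e1 < 65536) (b2 : e2 < 65536) (b3 : e3 < 65536) (b4 : e4 < 65536) (b5 : e5 < 65536)
    (M0 : A0 ≡ (e0 : ℤ) [ZMOD 8]) (M1 : A1 ≡ (e1 : ℤ) [ZMOD 8]) (M2 : A2 ≡ (e2 : ℤ) [ZMOD 8]) (M3 : A3 ≡ (e3 : ℤ) [ZMOD 8]) (M4 : A4 ≡ (e4 : ℤ) [ZMOD 8]) (M5 : A5 ≡ (e5 : ℤ) [ZMOD 8]) (M6 : A6 ≡ (e6 : ℤ) [ZMOD 8])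
    (h0 : (T.a0 - A0) % 8 = 0) (h1 : (T.a1 - A1) % 4 = 0) (h2 : (T.a2 - A2) % 4 = 0) (h3 : (T.a3 - A3) % 4 = 0) (h4 : (T.a4 - A4) % 4 = 0) (h5 : (T.a5 - A5) % 4 = 0) (h6 : (T.a6 - A6) % 4 = 0) :
    ft T (e0+65536*(e1+65536*(e2+65536*(e3+65536*(e4+65536*(e5+65536*e6)))))) = true := by
  simp only [ft, Bool.and_eq_true, Nat.beq_eq, dstep b0, dstep b1, dstep b2, dstep b3, dstep b4, dstep b5, mst8, mst4]
  exact ⟨⟨⟨⟨⟨⟨by unfold Int.ModEq at M0; omega, mfin M1 h1⟩, mfin M2 h2⟩, mfin M3 h3⟩, mfin M4 h4⟩, mfin M5 h5⟩, mfin M6 h6⟩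

lemma f15_of {T x y : V} (h : c15 T (x.mul y) = true) : f15 T x y = true := by
  simp only [c15, Bool.and_eq_true, beq_iff_eq, V.mul] at h
  obtain ⟨⟨⟨⟨⟨⟨h0, h1⟩, h2⟩, h3⟩, h4⟩, h5⟩, h6⟩ := h
  obtain ⟨x0, e0, l0, E0⟩ := dig x.a0
  obtain ⟨x1, e1, l1, E1⟩ := dig x.a1
  obtain ⟨x2, e2, l2, E2⟩ := dig x.a2
  obtain ⟨x3, e3, l3, E3⟩ := dig x.a3
  obtain ⟨x4, e4, l4, E4⟩ := dig x.a4
  obtain ⟨x5, e5, l5, E5⟩ := dig x.a5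
  obtain ⟨x6, e6, l6, E6⟩ := dig x.a6
  obtain ⟨y0, f0, m0, F0⟩ := dig y.a0
  obtain ⟨y1, f1, m1, F1⟩ := dig y.a1
  obtain ⟨y2, f2, m2, F2⟩ := dig y.a2
  obtain ⟨y3, f3, m3, F3⟩ := dig y.a3
  obtain ⟨y4, f4, m4, F4⟩ := dig y.a4
  obtain ⟨y5, f5, m5, F5⟩ := dig y.a5
  obtain ⟨y6, f6, m6, F6⟩ := dig y.a6
  have Q : enc x * enc y = (x0*y0)+65536*((x0*y1+x1*y0)+65536*((x0*y2+x1*y1+x2*y0)+65536*((x0*y3+x1*y2+x2*y1+x3*y0)+65536*((x0*y4+x1*y3+x2*y2+x3*y1+x4*y0)+65536*((x0*y5+x1*y4+x2*y3+x3*y2+x4*y1+x5*y0)+65536*((x0*y6+x1*y5+x2*y4+x3*y3+x4*y2+x5*y1+x6*y0)+65536*((x1*y6+x2*y5+x3*y4+x4*y3+x5*y2+x6*y1)+65536*((x2*y6+x3*y5+x4*y4+x5*y3+x6*y2)+65536*((x3*y6+x4*y5+x5*y4+x6*y3)+65536*((x4*y6+x5*y5+x6*y4)+65536*((x5*y6+x6*y5)+65536*((x6*y6)))))))))))))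 := by
    unfold enc; rw [e0,e1,e2,e3,e4,e5,e6,f0,f1,f2,f3,f4,f5,f6]; ring
  have M0 : x.a0*y.a0+18*(x.a1*y.a6+x.a2*y.a5+x.a3*y.a4+x.a4*y.a3+x.a5*y.a2+x.a6*y.a1) ≡ ((x0*y0+18*(x1*y6+x2*y5+x3*y4+x4*y3+x5*y2+x6*y1) : ℕ) : ℤ) [ZMOD 8] := by push_cast; exact (E0.mul F0).add (((((((E1.mul F6).add (E2.mul F5)).add (E3.mul F4)).add (E4.mul F3)).add (E5.mul F2)).add (E6.mul F1)).mul_left 18)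
  have M1 : x.a0*y.a1+x.a1*y.a0+18*(x.a2*y.a6+x.a3*y.a5+x.a4*y.a4+x.a5*y.a3+x.a6*y.a2) ≡ ((x0*y1+x1*y0+18*(x2*y6+x3*y5+x4*y4+x5*y3+x6*y2) : ℕ) : ℤ) [ZMOD 8] := by push_cast; exact ((E0.mul F1).add (E1.mul F0)).add ((((((E2.mul F6).add (E3.mul F5)).add (E4.mul F4)).add (E5.mul F3)).add (E6.mul F2)).mul_left 18)
  have M2 : x.a0*y.a2+x.a1*y.a1+x.a2*y.a0+18*(x.a3*y.a6+x.a4*y.a5+x.a5*y.a4+x.a6*y.a3) ≡ ((x0*y2+x1*y1+x2*y0+18*(x3*y6+x4*y5+x5*y4+x6*y3) : ℕ) : ℤ) [ZMOD 8] := by push_cast; exact (((E0.mul F2).add (E1.mul F1)).add (E2.mul F0)).add (((((E3.mul F6).add (E4.mul F5)).add (E5.mul F4)).add (E6.mul F3)).mul_left 18)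
  have M3 : x.a0*y.a3+x.a1*y.a2+x.a2*y.a1+x.a3*y.a0+18*(x.a4*y.a6+x.a5*y.a5+x.a6*y.a4) ≡ ((x0*y3+x1*y2+x2*y1+x3*y0+18*(x4*y6+x5*y5+x6*y4) : ℕ) : ℤ) [ZMOD 8] := by push_cast; exact ((((E0.mul F3).add (E1.mul F2)).add (E2.mul F1)).add (E3.mul F0)).add ((((E4.mul F6).add (E5.mul F5)).add (E6.mul F4)).mul_left 18)
  have M4 : x.a0*y.a4+x.a1*y.a3+x.a2*y.a2+x.a3*y.a1+x.a4*y.a0+18*(x.a5*y.a6+x.a6*y.a5) ≡ ((x0*y4+x1*y3+x2*y2+x3*y1+x4*y0+18*(x5*y6+x6*y5) : ℕ) : ℤ) [ZMOD 8] := by push_cast; exact (((((E0.mul F4).add (E1.mul F3)).add (E2.mul F2)).add (E3.mul F1)).add (E4.mul F0)).add (((E5.mul F6).add (E6.mul F5)).mul_left 18)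
  have M5 : x.a0*y.a5+x.a1*y.a4+x.a2*y.a3+x.a3*y.a2+x.a4*y.a1+x.a5*y.a0+18*(x.a6*y.a6) ≡ ((x0*y5+x1*y4+x2*y3+x3*y2+x4*y1+x5*y0+18*(x6*y6) : ℕ) : ℤ) [ZMOD 8] := by push_cast; exact ((((((E0.mul F5).add (E1.mul F4)).add (E2.mul F3)).add (E3.mul F2)).add (E4.mul F1)).add (E5.mul F0)).add ((E6.mul F6).mul_left 18)
  have M6 : x.a0*y.a6+x.a1*y.a5+x.a2*y.a4+x.a3*y.a3+x.a4*y.a2+x.a5*y.a1+x.a6*y.a0 ≡ ((x0*y6+x1*y5+x2*y4+x3*y3+x4*y2+x5*y1+x6*y0 : ℕ) : ℤ) [ZMOD 8] := by push_cast; exact (((((((E0.mul F6).add (E1.mul F5)).add (E2.mul F4)).add (E3.mul F3)).add (E4.mul F2)).add (E5.mul F1)).add (E6.mul F0))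
  have B0 : x0*y0 ≤ 343 := (bd l0 m0).trans (by norm_num)
  have B1 : x0*y1+x1*y0 ≤ 343 := (Nat.add_le_add (bd l0 m1) (bd l1 m0)).trans (by norm_num)
  have B2 : x0*y2+x1*y1+x2*y0 ≤ 343 := (Nat.add_le_add (Nat.add_le_add (bd l0 m2) (bd l1 m1)) (bd l2 m0)).trans (by norm_num)
  have B3 : x0*y3+x1*y2+x2*y1+x3*y0 ≤ 343 := (Nat.add_le_add (Nat.add_le_add (Nat.add_le_add (bd l0 m3) (bd l1 m2)) (bd l2 m1)) (bd l3 m0)).trans (by norm_num)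
  have B4 : x0*y4+x1*y3+x2*y2+x3*y1+x4*y0 ≤ 343 := (Nat.add_le_add (Nat.add_le_add (Nat.add_le_add (Nat.add_le_add (bd l0 m4) (bd l1 m3)) (bd l2 m2)) (bd l3 m1)) (bd l4 m0)).trans (by norm_num)
  have B5 : x0*y5+x1*y4+x2*y3+x3*y2+x4*y1+x5*y0 ≤ 343 := (Nat.add_le_add (Nat.add_le_add (Nat.add_le_add (Nat.add_le_add (Nat.add_le_add (bd l0 m5) (bd l1 m4)) (bd l2 m3)) (bd l3 m2)) (bd l4 m1)) (bd l5 m0)).trans (by norm_num)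
  have B6 : x0*y6+x1*y5+x2*y4+x3*y3+x4*y2+x5*y1+x6*y0 ≤ 343 := (Nat.add_le_add (Nat.add_le_add (Nat.add_le_add (Nat.add_le_add (Nat.add_le_add (Nat.add_le_add (bd l0 m6) (bd l1 m5)) (bd l2 m4)) (bd l3 m3)) (bd l4 m2)) (bd l5 m1)) (bd l6 m0)).trans (by norm_num)
  have B7 : x1*y6+x2*y5+x3*y4+x4*y3+x5*y2+x6*y1 ≤ 343 := (Nat.add_le_add (Nat.add_le_add (Nat.add_le_add (Nat.add_le_add (Nat.add_le_add (bd l1 m6) (bd l2 m5)) (bd l3 m4)) (bd l4 m3)) (bd l5 m2)) (bd l6 m1)).trans (by norm_num)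
  have B8 : x2*y6+x3*y5+x4*y4+x5*y3+x6*y2 ≤ 343 := (Nat.add_le_add (Nat.add_le_add (Nat.add_le_add (Nat.add_le_add (bd l2 m6) (bd l3 m5)) (bd l4 m4)) (bd l5 m3)) (bd l6 m2)).trans (by norm_num)
  have B9 : x3*y6+x4*y5+x5*y4+x6*y3 ≤ 343 := (Nat.add_le_add (Nat.add_le_add (Nat.add_le_add (bd l3 m6) (bd l4 m5)) (bd l5 m4)) (bd l6 m3)).trans (by norm_num)
  have B10 : x4*y6+x5*y5+x6*y4 ≤ 343 := (Nat.add_le_add (Nat.add_le_add (bd l4 m6) (bd l5 m5)) (bd l6 m4)).trans (by norm_num)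
  have B11 : x5*y6+x6*y5 ≤ 343 := (Nat.add_le_add (bd l5 m6) (bd l6 m5)).trans (by norm_num)
  have B12 : x6*y6 ≤ 343 := (bd l6 m6).trans (by norm_num)
  unfold f15; rw [Q, fq_eq ⟨B0,B1,B2,B3,B4,B5,B6⟩]
  exact ft_of (b18 B0 B7) (b18 B1 B8) (b18 B2 B9) (b18 B3 B10) (b18 B4 B11) (b18 B5 B12) M0 M1 M2 M3 M4 M5 M6 h0 h1 h2 h3 h4 h5 h6

/-- tests whether `T` is `dV n` times a square -/
def hit (T : V) (n : ℕ) : Bool := (List.range 64).any fun m => f15 T (dV n) ((sV m).mul (sV m))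

def bad (T : V) : Bool := (List.range 64).all fun n => !hit T n

lemma dV_odd : (List.range 64).all (fun n => (dV n).a0 % 2 == 1) = true := by decide +kernel

lemma ev_unit {c : V} (h : c.a0 % 2 = 1) : IsUnit (evR c : R K) := by
  rw [unit_iff', evR_def]
  obtain ⟨k, hk⟩ : ∃ k, c.a0 = 2*k+1 := ⟨c.a0/2, by omega⟩
  rw [hk]; push_cast
  exact ⟨b^6*η*k + c.a1+c.a2*b+c.a3*b^2+c.a4*b^3+c.a5*b^4+c.a6*b^5, by linear_combination (k : R K) * two_eq (K := K)⟩

lemma unit_cg {n : ℕ} (hn : n ≠ 0) {x y : R K} (h : Cg n x y) (hy : IsUnit y) : IsUnit x := by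
  rw [unit_iff'] at *
  have := dvd_add ((dvd_pow_self b hn).trans h) hy
  simpa using this

lemma d_unit {n : ℕ} (hn : n < 64) : IsUnit (dR n : R K) := by
  refine unit_cg (by norm_num) (d_cg n) (ev_unit ?_)
  have := List.all_eq_true.mp dV_odd n (by simpa using hn)
  simpa using this

lemma unit_zpow {u v : R K} (hu : IsUnit u) (hv : IsUnit v) {N : ℤ} (h : (u : K) = β^N * v) : N = 0 := by
  rw [unit_iff] at hu hv
  obtain ⟨k, rfl | rfl⟩ := N.eq_nat_or_neg
  · rcases k with _ | k
    · rfl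
    · exfalso; apply hu
      refine ⟨b^k * v, Subtype.ext ?_⟩
      rw [h, zpow_natCast]; push_cast; rw [coe_bR]; ring
  · rcases k with _ | k
    · rfl
    · exfalso; apply hv
      refine ⟨b^k * u, Subtype.ext ?_⟩
      push_cast
      rw [h, zpow_neg, zpow_natCast, coe_bR]
      have := b_ne (K := K)
      field_simp
      ring

lemma localK {x z h : K} {n : ℕ} (hn : n < 64) (hx : x = (dR n : R K) * z^2) {u : R K} {T : V} (hT : T.a0 % 2 = 1)
    (hu : Cg 15 u (evR T)) (hh : h ≠ 0) (hx' : x = h^2 * u) : hit T n = true := by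
  have hU : IsUnit u := unit_cg (by norm_num) hu (ev_unit hT)
  have hu0 : (u : K) ≠ 0 := by
    have := hU.ne_zero
    simpa using this
  have hz : z ≠ 0 := by
    rintro rfl
    rw [hx'] at hx
    simp [hh] at hx
    exact hu0 (by rw [hx]; rfl)
  obtain ⟨N, s, hs, hN⟩ := exists_ord (z/h) (div_ne_zero hz hh)
  have e : (u : K) = β^(2*N) * ((dR n * (s*s) : R K) : K) := by
    push_cast
    have : z = β^N * s * h := by rw [← hN]; field_simp
    rw [hx', this] at hx
    rw [two_mul, zpow_add₀ b_ne]
    have h2 : h^2 ≠ 0 := by positivity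
    apply mul_left_cancel₀ h2
    linear_combination hx
  have h0 := unit_zpow hU ((d_unit hn).mul (hs.mul hs)) e
  rw [h0, zpow_zero, one_mul] at e
  have e' : u = dR n * (s*s) := Subtype.ext e
  obtain ⟨m, hm, hm'⟩ := sq_rep s hs
  have h1 : Cg 15 (evR T : R K) (evR ((dV n).mul ((sV m).mul (sV m)))) := by
    rw [evR_mul]
    refine hu.symm.trans ?_
    rw [e']
    exact (d_cg n).mul hm'
  exact List.any_eq_true.mpr ⟨m, by simpa using hm, f15_of (c15_of_cg h1)⟩

lemma isU {a : 𝓞 K} (h : Algebra.norm ℤ a = 1) : IsUnit a := by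
  rw [NumberField.isUnit_iff_norm, RingOfIntegers.coe_norm, ← Algebra.coe_norm_int, h]; simp

noncomputable def U1 : (𝓞 K)ˣ := (isU nu1).unit
noncomputable def U3 : (𝓞 K)ˣ := (isU nu3).unit
noncomputable def U4 : (𝓞 K)ˣ := (isU nu4).unit
noncomputable def eU (n : ℕ) : (𝓞 K)ˣ := (-1)^(n%2) * U1^(n/2%2)*U3^(n/4%2)*U4^(n/8%2)

lemma coe_eU {n : ℕ} (hn : n < 16) : algebraMap (𝓞 K) K (eU n : (𝓞 K)ˣ) = (dR n : R K) := by
  have h1 : n / 16 % 2 = 0 := by omega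
  have h2 : n / 32 % 2 = 0 := by omega
  unfold eU dR
  rw [h1, h2]
  push_cast
  simp only [pow_zero, mul_one]
  rfl

lemma dist16 : (List.range 16).all (fun n => (List.range 16).all fun m => !(hit (dV n) m) || n == m) = true := by
  decide +kernel

lemma eU_inj {n m : ℕ} (hn : n < 16) (hm : m < 16) (v : (𝓞 K)ˣ) (h : eU n = eU m * v^2) : n = m := by
  have h1 : ((dR n : R K) : K) = (dR m : R K) * (algebraMap (𝓞 K) K v)^2 := by
    rw [← coe_eU hn, ← coe_eU hm, h]; simp
  have hd : (dV n).a0 % 2 = 1 := by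
    have := List.all_eq_true.mp dV_odd n (by simp; omega)
    simpa using this
  have h2 := localK (by omega) h1 hd (d_cg n) one_ne_zero (by simp)
  have := List.all_eq_true.mp (List.all_eq_true.mp dist16 n (by simpa using hn)) m (by simpa using hm)
  simpa [h2] using this

lemma units_rep (x : (𝓞 K)ˣ) : ∃ n < 16, ∃ v, x = eU n * v^2 := by
  classical
  have hr : NumberField.Units.rank K = 3 := by
    have := sig (K := K)
    rw [NumberField.Units.rank, InfinitePlace.card_eq_nrRealPlaces_add_nrComplexPlaces]
    omega
  have ht := fun z : NumberField.Units.torsion K => NumberField.Units.torsion_eq_one_or_neg_one_of_odd_finrank (K := K) (by rw [finr]; decide) z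
  choose ze hze _ using fun x : (𝓞 K)ˣ => NumberField.Units.exist_unique_eq_mul_prod K x
  let F : (𝓞 K)ˣ → Bool × (Fin (NumberField.Units.rank K) → ZMod 2) := fun x => (decide (((ze x).1 : (𝓞 K)ˣ) = 1), fun i => ((ze x).2 i : ZMod 2))
  have hF : ∀ x y, F x = F y → ∃ v, x = y * v^2 := by
    intro x y hxy
    have h1 := congrArg Prod.fst hxy
    have h2 := congrArg Prod.snd hxy
    simp only [F] at h1 h2
    have hz : ((ze x).1 : (𝓞 K)ˣ) = (ze y).1 := by
      rw [decide_eq_decide] at h1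
      rcases ht (ze x).1 with a | a
      · exact a.trans (h1.mp a).symm
      · rcases ht (ze y).1 with c | c
        · exact (h1.mpr c).trans c.symm
        · exact a.trans c.symm
    have hk : ∀ i, ∃ k : ℤ, (ze x).2 i = (ze y).2 i + 2 * k := by
      intro i
      have := congrFun h2 i
      rw [ZMod.intCast_eq_intCast_iff_dvd_sub] at this
      obtain ⟨k, hk⟩ := this
      exact ⟨-k, by push_cast at hk; linarith⟩
    choose k hk using hk
    refine ⟨∏ i, (NumberField.Units.fundSystem K i)^(k i), ?_⟩
    conv_lhs => rw [hze x]
    conv_rhs => rw [hze y]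
    rw [hz, mul_assoc, ← Finset.prod_pow, ← Finset.prod_mul_distrib]
    congr 1
    apply Finset.prod_congr rfl
    intro i _
    rw [hk i, zpow_add, mul_comm 2 (k i), zpow_mul]; rfl
  let G : Fin 16 → Bool × (Fin (NumberField.Units.rank K) → ZMod 2) := fun n => F (eU n)
  have hG : Function.Injective G := by
    intro n m h
    obtain ⟨v, hv⟩ := hF _ _ h
    exact Fin.ext (eU_inj n.2 m.2 v hv)
  have hB : Function.Bijective G := by
    rw [Fintype.bijective_iff_injective_and_card]
    refine ⟨hG, ?_⟩
    simp [hr]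
  obtain ⟨n, hn⟩ := hB.2 (F x)
  exact ⟨n, n.2, hF _ _ hn.symm⟩

end C2

namespace C2
open Polynomial Module NumberField

variable {K : Type} [Field K] [NumberField K] [KD K]
local notation "β" => (KD.b : K)
local notation "b" => (bR : R K)
local notation "η" => (eta : R K)

lemma isU' {a : 𝓞 K} (h : (Algebra.norm ℤ a).natAbs = 1) : IsUnit a := by
  rw [NumberField.isUnit_iff_norm, RingOfIntegers.coe_norm, ← Algebra.coe_norm_int]
  rcases Int.natAbs_eq_iff.mp h with h | h <;> rw [h] <;> simp

lemma irr7 {p : 𝓞 K} (h : Algebra.norm ℤ p = 7) : Irreducible p := by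
  refine ⟨fun hu => ?_, fun {x y} hxy => ?_⟩
  · rw [NumberField.isUnit_iff_norm, RingOfIntegers.coe_norm, ← Algebra.coe_norm_int, h] at hu
    norm_num at hu
  · have h1 := congrArg (fun t => (Algebra.norm ℤ t).natAbs) hxy
    simp only [map_mul, h, Int.natAbs_mul] at h1
    have h7 : Nat.Prime 7 := by norm_num
    have h2 : (Algebra.norm ℤ x).natAbs ∣ 7 := ⟨_, h1⟩
    rcases (Nat.dvd_prime h7).mp h2 with h3 | h3
    · exact Or.inl (isU' h3)
    · right
      apply isU'
      rw [h3] at h1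
      change 7 = _ at h1
      omega

/-- squarefree decomposition -/
lemma sqf [UniqueFactorizationMonoid (𝓞 K)] (a : 𝓞 K) (ha : a ≠ 0) : ∃ q e : 𝓞 K, Squarefree q ∧ a = q * e^2 := by
  induction a using UniqueFactorizationMonoid.induction_on_prime with
  | h₁ => exact absurd rfl ha
  | h₂ x hx => exact ⟨x, 1, hx.squarefree, by ring⟩
  | h₃ a p ha' hp ih =>
    obtain ⟨q, e, hq, rfl⟩ := ih ha'
    by_cases hd : p ∣ q
    · obtain ⟨q', rfl⟩ := hd
      exact ⟨q', p * e, hq.of_mul_right, by ring⟩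
    · refine ⟨p * q, e, ?_, by ring⟩
      rw [squarefree_mul_iff]
      exact ⟨(hp.irreducible.isRelPrime_iff_not_dvd).mpr hd, hp.irreducible.squarefree, hq⟩

lemma dR_add {n l m : ℕ} (hn : n < 16) (hl : l < 2) (hm : m < 2) :
    (dR (n + 16*l + 32*m) : R K) = dR n * lR vp1^l * lR vp2^m := by
  have e1 : (n + 16*l+32*m) % 2 = n % 2 := by omega
  have e2 : (n + 16*l+32*m) / 2 % 2 = n / 2 % 2 := by omega
  have e3 : (n + 16*l+32*m) / 4 % 2 = n / 4 % 2 := by omega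
  have e4 : (n + 16*l+32*m) / 8 % 2 = n / 8 % 2 := by omega
  have e5 : (n + 16*l+32*m) / 16 % 2 = l := by omega
  have e6 : (n + 16*l+32*m) / 32 % 2 = m := by omega
  have e7 : n / 16 % 2 = 0 := by omega
  have e8 : n / 32 % 2 = 0 := by omega
  unfold dR
  rw [e1, e2, e3, e4, e5, e6, e7, e8]
  simp only [pow_zero, mul_one]
  rfl

lemma dvd7 [IsPrincipalIdealRing (𝓞 K)] {π : 𝓞 K} (hp : Prime π) (h : π ∣ 7) : Associated π p1 ∨ Associated π p2 := by
  have h1 : (Ideal.span {π}).IsPrime := (Ideal.span_singleton_prime hp.ne_zero).mpr hp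
  rcases p12_mem _ h1 (Ideal.mem_span_singleton.mpr h) with h2 | h2
  · left; exact hp.irreducible.associated_of_dvd (irr7 np1) (Ideal.mem_span_singleton.mp h2)
  · right; exact hp.irreducible.associated_of_dvd (irr7 np2) (Ideal.mem_span_singleton.mp h2)

lemma pull [UniqueFactorizationMonoid (𝓞 K)] {p q : 𝓞 K} (hp : ¬ IsUnit p) (hq : Squarefree q) : ∃ l < 2, ∃ q', q = p^l*q' ∧ ¬ p ∣ q' := by
  by_cases h : p ∣ q
  · obtain ⟨q', rfl⟩ := h
    refine ⟨1, by norm_num, q', by ring, ?_⟩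
    rintro ⟨r, rfl⟩
    exact hp (hq p ⟨r, by ring⟩)
  · exact ⟨0, by norm_num, q, by ring, h⟩

lemma core {A : Type} [CommRing A] [IsDomain A] {q e f y π : A} {a1 a2 a4 : A} (ha : a4 = 7 ∨ a4 = -7) (hq : Squarefree q)
    (hef : IsRelPrime e f) (hπ : Prime π) (hd : π ∣ q)
    (h : y^2 + a1*q*e*f*y = q*(q^2*e^4+a2*q*e^2*f^2+a4*f^4)) : π ∣ 7 := by
  obtain ⟨q, rfl⟩ := hd
  have hq' : ¬ π ∣ q := by
    rintro ⟨r, rfl⟩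
    exact hπ.not_unit (hq π ⟨r, by ring⟩)
  have hπ0 := hπ.ne_zero
  have h1 : π ∣ y := by
    apply hπ.dvd_of_dvd_pow (n := 2)
    exact ⟨q*((π*q)^2*e^4+a2*(π*q)*e^2*f^2+a4*f^4) - a1*q*e*f*y, by linear_combination h⟩
  obtain ⟨y, rfl⟩ := h1
  have h2 : π*(y^2 + a1*q*e*f*y) = q*((π*q)^2*e^4+a2*(π*q)*e^2*f^2+a4*f^4) := by
    apply mul_left_cancel₀ hπ0
    linear_combination h
  have h3 : π ∣ a4*f^4 := by
    have : π ∣ q * ((π*q)^2*e^4+a2*(π*q)*e^2*f^2+a4*f^4) := ⟨_, h2.symm⟩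
    have := (hπ.dvd_or_dvd this).resolve_left hq'
    obtain ⟨c, hc⟩ := this
    exact ⟨c - π*q^2*e^4 - a2*q*e^2*f^2, by linear_combination hc⟩
  rcases hπ.dvd_or_dvd h3 with h4 | h4
  · rcases ha with rfl | rfl
    · exact h4
    · exact (dvd_neg.mp h4)
  exfalso
  have h5 := hπ.dvd_of_dvd_pow h4
  have he : ¬ π ∣ e := fun he => hπ.not_unit (hef he h5)
  obtain ⟨f, rfl⟩ := h5
  have h6 : π ∣ y := by
    apply hπ.dvd_of_dvd_pow (n := 2)
    refine ⟨q*(q^2*e^4+a2*π*q*e^2*f^2+a4*π^2*f^4) - a1*q*e*f*y, ?_⟩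
    apply mul_left_cancel₀ hπ0
    linear_combination h2
  obtain ⟨y, rfl⟩ := h6
  have h7 : π ∣ q^3*e^4 := by
    refine ⟨y^2+a1*q*e*f*y - q*(a2*q*e^2*f^2+a4*π*f^4), ?_⟩
    apply mul_left_cancel₀ hπ0
    apply mul_left_cancel₀ hπ0
    linear_combination -h2
  rcases hπ.dvd_or_dvd h7 with h8 | h8
  · exact hq' (hπ.dvd_of_dvd_pow h8)
  · exact he (hπ.dvd_of_dvd_pow h8)

lemma selmer {x y : K} {a1 a2 a4 : ℤ} (ha : a4 = 7 ∨ a4 = -7) (hx : x ≠ 0)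
    (h : y^2 + a1*x*y = x*(x^2+a2*x+a4)) : ∃ n < 64, ∃ z : K, x = (dR n : R K) * z^2 := by
  have : IsPrincipalIdealRing (𝓞 K) := pid
  obtain ⟨N, D, hD, rfl⟩ := IsFractionRing.div_surjective (A := 𝓞 K) x
  have hD0 : algebraMap (𝓞 K) K D ≠ 0 := by
    simpa using nonZeroDivisors.ne_zero hD
  have hN0 : algebraMap (𝓞 K) K N ≠ 0 := fun h => hx (by rw [h, zero_div])
  have hND : N * D ≠ 0 := by
    intro h0
    have := congrArg (algebraMap (𝓞 K) K) h0
    rw [map_mul, map_zero] at this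
    exact mul_ne_zero hN0 hD0 this
  obtain ⟨q, e0, hq, hqe⟩ := sqf (N*D) hND
  have hs0 : algebraMap (𝓞 K) K e0 / algebraMap (𝓞 K) K D ≠ 0 := by
    refine div_ne_zero (fun h0 => ?_) hD0
    have h1 : e0 = 0 := by simpa using h0
    rw [h1] at hqe
    exact hND (by rw [hqe]; ring)
  obtain ⟨e, f, hef, hs⟩ := IsFractionRing.exists_reduced_fraction (A := 𝓞 K) (algebraMap (𝓞 K) K e0 / algebraMap (𝓞 K) K D)
  rw [IsFractionRing.mk'_eq_div] at hs
  have hf0 : algebraMap (𝓞 K) K f ≠ 0 := by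
    simpa using nonZeroDivisors.ne_zero f.2
  obtain ⟨f, hf⟩ := f
  simp only at hs hf0 hef
  have hxq : algebraMap (𝓞 K) K N / algebraMap (𝓞 K) K D = algebraMap (𝓞 K) K q * (algebraMap (𝓞 K) K e / algebraMap (𝓞 K) K f)^2 := by
    rw [hs]
    have := congrArg (algebraMap (𝓞 K) K) hqe
    rw [map_mul, map_mul, map_pow] at this
    field_simp
    linear_combination this
  have he0 : algebraMap (𝓞 K) K e ≠ 0 := by
    intro h0
    rw [← hs, h0, zero_div] at hs0
    exact hs0 rfl
  rw [hxq] at h ⊢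
  set q' := algebraMap (𝓞 K) K q with hq'
  set e' := algebraMap (𝓞 K) K e with he'
  set f' := algebraMap (𝓞 K) K f with hf'
  obtain ⟨w, hw⟩ : ∃ w, y = e' / f'^3 * w := ⟨y / (e'/f'^3), by field_simp⟩
  have hw2 : w^2 + a1*q'*e'*f'*w = q'*(q'^2*e'^4+a2*q'*e'^2*f'^2+a4*f'^4) := by
    rw [hw] at h
    have : e'^2 ≠ 0 := by positivity
    field_simp at h
    linear_combination h
  have hwi : IsIntegral (𝓞 K) w := by
    refine ⟨X^2 + C ((a1 : 𝓞 K)*q*e*f) * X - C (q*(q^2*e^4+a2*q*e^2*f^2+a4*f^4)), by monicity!, ?_⟩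
    simp only [eval₂_add, eval₂_sub, eval₂_mul, eval₂_pow, eval₂_X, eval₂_C]
    simp only [map_mul, map_add, map_pow, map_intCast]
    linear_combination hw2
  obtain ⟨w0, hw0⟩ := IsIntegrallyClosed.isIntegral_iff.mp hwi
  have hw3 : w0^2 + a1*q*e*f*w0 = q*(q^2*e^4+a2*q*e^2*f^2+a4*f^4) := by
    apply oext
    simp only [map_mul, map_add, map_pow, map_intCast]
    rw [hw0]
    exact hw2
  have hall : ∀ π : 𝓞 K, Prime π → π ∣ q → Associated π p1 ∨ Associated π p2 := by
    intro π hπ hd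
    apply dvd7 hπ
    refine core (a4 := (a4 : 𝓞 K)) ?_ hq hef hπ hd hw3
    rcases ha with rfl | rfl
    · left; norm_num
    · right; norm_num
  obtain ⟨l, hl, q1, hq1, hp1⟩ := pull (irr7 np1).not_isUnit hq
  have hq1s : Squarefree q1 := by rw [hq1] at hq; exact hq.of_mul_right
  obtain ⟨m, hm, q2, hq2, hp2⟩ := pull (irr7 np2).not_isUnit hq1s
  have hqu : IsUnit q2 := by
    by_contra hu
    have hq20 : q2 ≠ 0 := by rintro rfl; exact hp2 (dvd_zero _)
    obtain ⟨π, hπ, hd⟩ := WfDvdMonoid.exists_irreducible_factor hu hq20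
    rcases hall π hπ.prime (hd.trans ⟨p1^l*p2^m, by rw [hq1, hq2]; ring⟩) with h1 | h1
    · exact hp1 (h1.symm.dvd.trans (hd.trans ⟨p2^m, by rw [hq2]; ring⟩))
    · exact hp2 (h1.symm.dvd.trans hd)
  obtain ⟨n, hn, v, hv⟩ := units_rep hqu.unit
  refine ⟨n + 16*l+32*m, by omega, algebraMap (𝓞 K) K v * (e'/f'), ?_⟩
  rw [dR_add hn hl hm]
  push_cast
  rw [← coe_eU hn]
  have h1 : q2 = (eU n : (𝓞 K)ˣ) * (v : 𝓞 K)^2 := by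
    have := congrArg Units.val hv
    simpa using this
  have h2 : q' = algebraMap (𝓞 K) K (eU n : (𝓞 K)ˣ) * (algebraMap (𝓞 K) K v)^2 * (algebraMap (𝓞 K) K p1)^l * (algebraMap (𝓞 K) K p2)^m := by
    rw [hq', hq1, hq2, h1]
    simp only [map_mul, map_pow]
    ring
  rw [h2]
  have e1 : algebraMap (𝓞 K) K p1 = (lR vp1 : R K) := rfl
  have e2 : algebraMap (𝓞 K) K p2 = (lR vp2 : R K) := rfl
  rw [e1, e2]
  ring

end C2

namespace C2
open Polynomial Module NumberField

variable {K : Type} [Field K] [NumberField K] [KD K]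
local notation "β" => (KD.b : K)
local notation "b" => (bR : R K)
local notation "η" => (eta : R K)

lemma exists_real : Nonempty (K →+* ℝ) := by
  have h := (sig (K := K)).1
  rw [InfinitePlace.nrRealPlaces] at h
  obtain ⟨w, hw⟩ : Nonempty {w : InfinitePlace K // w.IsReal} := by
    by_contra hn
    rw [not_nonempty_iff] at hn
    exact absurd h (by classical rw [Fintype.card_eq_zero]; norm_num)
  exact ⟨InfinitePlace.embedding_of_isReal hw⟩

lemma hit1 : (List.range 64).all (fun n => !(hit (V.C 1) n) || n == 0 || n == 31) = true := by decide +kernel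

lemma hit1' {n : ℕ} (hn : n < 64) (h : hit (V.C 1) n = true) : n = 0 ∨ n = 31 := by
  have := List.all_eq_true.mp hit1 n (by simpa using hn)
  simpa [h] using this

lemma neg7 : ∃ z : K, (-7 : K) = (dR 31 : R K) * z^2 := by
  obtain ⟨n, hn, v, hv⟩ := units_rep (K := K) (-(isU nw).unit)
  have h0 : -(wO : 𝓞 K) = (eU n : (𝓞 K)ˣ) * (v : 𝓞 K)^2 := by
    have := congrArg Units.val hv
    simpa using this
  have h1 : (-7 : K) = (dR (n+16) : R K) * (algebraMap (𝓞 K) K ((v : 𝓞 K) * p2^3))^2 := by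
    have := dR_add (K := K) hn (l := 1) (m := 0) (by norm_num) (by norm_num)
    simp only [mul_one, mul_zero, add_zero, pow_zero, pow_one] at this
    rw [this]
    push_cast
    rw [← coe_eU hn]
    have e1 : ((lR vp1 : R K) : K) = algebraMap (𝓞 K) K p1 := rfl
    have e2 : (-7 : K) = algebraMap (𝓞 K) K (-7) := by rw [map_neg, map_ofNat]
    rw [e1, e2, ← map_mul, ← map_pow, ← map_mul]
    have h5 : (-7 : 𝓞 K) = ((eU n : (𝓞 K)ˣ) : 𝓞 K) * (p1 : 𝓞 K) * ((v : 𝓞 K) * (p2 : 𝓞 K)^3)^2 := by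
      rw [seven_fac]
      linear_combination ((p1 : 𝓞 K) * (p2 : 𝓞 K)^6) * h0
    exact congrArg (algebraMap (𝓞 K) K) h5
  have h2 := localK (u := -7) (T := V.C 1) (by omega) h1 rfl (by
    rw [evR_C]
    exact ⟨-(b^6*η^3), by
      have h2 := two_eq (K := K)
      have h8 : (8 : R K) = b^21*η^3 := by
        rw [show (8 : R K) = 2^3 by norm_num, h2]; ring
      push_cast
      linear_combination -h8⟩) one_ne_zero (by push_cast; rw [one_pow, one_mul]; rfl)
  rcases hit1' (by omega) h2 with h3 | h3
  · omega
  · rw [h3] at h1; exact ⟨_, h1⟩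

lemma dR31 : (dR 31 : R K) = -(lR vu1 * lR vu3 * lR vu4 * lR vp1) := by
  simp [dR, gR]

lemma sel_one {x z h : K} {n : ℕ} (hn : n < 64) (hx : x = (dR n : R K) * z^2) {u : R K}
    (hu : Cg 15 u 1) (hh : h ≠ 0) (hx' : x = h^2 * u) : ∃ w, x = w^2 ∨ x = -7 * w^2 := by
  have h1 := localK hn hx (T := V.C 1) rfl (by rw [evR_C]; simpa using hu) hh hx'
  rcases hit1' hn h1 with rfl | rfl
  · refine ⟨z, Or.inl ?_⟩
    rw [hx]; simp [dR]
  · obtain ⟨z0, hz0⟩ := neg7 (K := K)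
    have : z0 ≠ 0 := by rintro rfl; norm_num at hz0
    refine ⟨z / z0, Or.inr ?_⟩
    rw [hz0, hx]; field_simp

lemma selE {x y : K} (hx : x ≠ 0) (h : y^2 = x^3+21*x^2+112*x) : ∃ n < 64, ∃ z : K, x = (dR n : R K) * z^2 := by
  obtain ⟨n, hn, z, hz⟩ := selmer (K := K) (x := x/4) (y := (y-5*x)/8) (a1 := 5) (a2 := -1) (a4 := 7) (Or.inl rfl) (div_ne_zero hx (by norm_num))
    (by push_cast; linear_combination h/64)
  exact ⟨n, hn, 2*z, by linear_combination 4*hz⟩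

lemma K1 {x y h : K} {u : R K} {T : V} (hT : T.a0 % 2 = 1) (hb : bad T = true) (hh : h ≠ 0) (hy : y^2 = x^3+21*x^2+112*x)
    (hx : x = h^2 * u) (hu : Cg 15 u (evR T)) : False := by
  have hU : IsUnit u := unit_cg (by norm_num) hu (ev_unit hT)
  have hx0 : x ≠ 0 := by
    rw [hx]
    have := hU.ne_zero
    have : (u : K) ≠ 0 := by simpa using this
    positivity
  obtain ⟨n, hn, z, hz⟩ := selE hx0 hy
  have h1 := localK hn hz hT hu hh hx
  have h2 := List.all_eq_true.mp hb n (by simpa using hn)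
  simp [h1] at h2

lemma K1' {x y h : K} {u : R K} {T : V} (hT : T.a0 % 2 = 1) (hb : bad T = true) (hh : h ≠ 0) (hy : y^2 = x^3-42*x^2-7*x)
    (hx : x = h^2 * u) (hu : Cg 15 u (evR T)) : False := by
  have hU : IsUnit u := unit_cg (by norm_num) hu (ev_unit hT)
  have hx0 : x ≠ 0 := by
    rw [hx]
    have := hU.ne_zero
    have : (u : K) ≠ 0 := by simpa using this
    positivity
  obtain ⟨n, hn, z, hz⟩ := selmer (K := K) (x := x) (y := y) (a1 := 0) (a2 := -42) (a4 := -7) (Or.inr rfl) hx0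
    (by push_cast; linear_combination hy)
  have h1 := localK hn hz hT hu hh hx
  have h2 := List.all_eq_true.mp hb n (by simpa using hn)
  simp [h1] at h2

lemma K2 {x y h : K} {u : R K} (hx0 : x ≠ 0) (hh : h ≠ 0) (hy : y^2 = x^3+21*x^2+112*x)
    (hx : x = h^2 * u) (hu : Cg 15 u 1) : ∃ z, x = z^2 := by
  obtain ⟨n, hn, z, hz⟩ := selE hx0 hy
  obtain ⟨w, hw | hw⟩ := sel_one hn hz hu hh hx
  · exact ⟨w, hw⟩
  · exfalso
    obtain ⟨σ⟩ := exists_real (K := K)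
    have hw0 : w ≠ 0 := by rintro rfl; simp [hw] at hx0
    have hs : σ w ≠ 0 := by simpa using hw0
    have h1 := congrArg σ hy
    have h2 := congrArg σ hw
    simp only [map_pow, map_add, map_mul, map_ofNat, map_neg] at h1 h2
    have h3 : σ x < 0 := by rw [h2]; have : 0 < (σ w)^2 := by positivity
                            linarith
    nlinarith [sq_nonneg (σ y), mul_pos_of_neg_of_neg h3 h3, sq_nonneg (σ x + 21/2), mul_nonneg (neg_nonneg.mpr h3.le) (sq_nonneg (σ x + 21/2))]

lemma K3 {x y h : K} {u : R K} (hx0 : x ≠ 0) (hh : h ≠ 0) (hy : y^2 = x^3-42*x^2-7*x)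
    (hx : x = h^2 * u) (hu : Cg 15 u 1) : ∃ w, x = w^2 ∨ x = -7 * w^2 := by
  obtain ⟨n, hn, z, hz⟩ := selmer (K := K) (x := x) (y := y) (a1 := 0) (a2 := -42) (a4 := -7) (Or.inr rfl) hx0
    (by push_cast; linear_combination hy)
  exact sel_one hn hz hu hh hx

lemma bad5 : bad (V.C 5) = true := by decide +kernel
lemma bad3 : bad (V.C 3) = true := by decide +kernel

end C2

namespace C2
open Polynomial Module NumberField

variable {K : Type} [Field K] [NumberField K] [KD K]
local notation "β" => (KD.b : K)
local notation "b" => (bR : R K)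
local notation "η" => (eta : R K)

lemma memR_or {a : K} (ha : a ≠ 0) : (∃ q : R K, a = q) ∨ ∃ q : R K, a⁻¹ = ((b * q : R K) : K) := by
  obtain ⟨N, u, hu, h⟩ := exists_ord a ha
  have hb0 := b_ne (K := K)
  obtain ⟨v, hv⟩ := hu.exists_right_inv
  have hv' : (u : K) * v = 1 := by exact_mod_cast congrArg Subtype.val hv
  obtain ⟨k, rfl | rfl⟩ := N.eq_nat_or_neg
  · left
    exact ⟨b^k * u, by rw [h, zpow_natCast]; push_cast; rw [coe_bR]⟩
  · rcases k with _ | k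
    · left; exact ⟨u, by rw [h]; simp⟩
    · right
      refine ⟨b^k * v, ?_⟩
      push_cast
      rw [coe_bR, h]
      rw [zpow_neg, zpow_natCast]
      have hu0 : (u : K) ≠ 0 := left_ne_zero_of_mul_eq_one hv'
      field_simp
      linear_combination (-(β^(k+1))) * hv'

lemma coe_inj {x y : R K} (h : (x : K) = y) : x = y := Subtype.ext h
lemma coe_ne {x : R K} (h : x ≠ 0) : (x : K) ≠ 0 := by simpa using h

lemma sq_mem {a : K} {v : R K} (h : a^2 = v) : ∃ q : R K, a = q := by
  by_cases ha : a = 0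
  · exact ⟨0, by rw [ha]; rfl⟩
  rcases memR_or ha with h1 | ⟨q, hq⟩
  · exact h1
  · exfalso
    apply not_b_dvd_one (K := K)
    refine ⟨b*q^2*v, coe_inj ?_⟩
    push_cast at hq ⊢
    have e : (1 : K) = (a⁻¹)^2 * a^2 := by field_simp
    rw [hq, h] at e
    linear_combination e

lemma b_pow_dvd_cancel {m n : ℕ} {u : R K} (hu : IsUnit u) (h : b^m ∣ b^n * u) : m ≤ n := by
  by_contra hc
  have h1 : b^(n+1) ∣ b^n*u := (pow_dvd_pow _ (by omega)).trans h
  rw [pow_succ] at h1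
  have := (mul_dvd_mul_iff_left (pow_ne_zero n (bR_ne (K := K)))).mp h1
  exact (unit_iff _).mp hu this

lemma sq_one {r : R K} (h : b^14 ∣ r^2 - 1) : b^7 ∣ r - 1 := by
  by_cases h0 : r - 1 = 0
  · rw [h0]; exact dvd_zero _
  obtain ⟨a, u, hu, e⟩ := exists_unit _ h0
  by_cases ha : 7 ≤ a
  · rw [e]; exact (pow_dvd_pow _ ha).mul_right _
  exfalso
  obtain ⟨c, hc⟩ : ∃ c, 7 = a + (c+1) := ⟨6 - a, by omega⟩
  have h2 := two_eq (K := K)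
  have hu2 : IsUnit (u * (u + b^(c+1)*η)) := by
    apply hu.mul
    rw [unit_iff] at hu ⊢
    intro hd
    apply hu
    have : b ∣ b^(c+1)*η := ⟨b^c*η, by ring⟩
    have := dvd_sub hd this
    simpa using this
  have e2 : r^2 - 1 = b^(a+a) * (u * (u + b^(c+1)*η)) := by
    have h3 : r + 1 = b^a * u + b^a * b^(c+1) * η := by
      have : b^a*b^(c+1) = b^7 := by rw [← pow_add]; congr 1; omega
      rw [this]; linear_combination e + h2
    rw [pow_add]
    calc r^2 - 1 = (r-1)*(r+1) := by ring
      _ = _ := by rw [e, h3]; ring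
  rw [e2] at h
  have := b_pow_dvd_cancel hu2 h
  omega

lemma four_eq : (4 : R K) = b^14*η^2 := by
  rw [show (4 : R K) = 2^2 by norm_num, two_eq]; ring
lemma eight_eq : (8 : R K) = b^21*η^3 := by
  rw [show (8 : R K) = 2^3 by norm_num, two_eq]; ring
lemma sixteen_eq : (16 : R K) = b^28*η^4 := by
  rw [show (16 : R K) = 2^4 by norm_num, two_eq]; ring
lemma s4_eq : (64 : R K) = b^42*η^6 := by
  rw [show (64 : R K) = 2^6 by norm_num, two_eq]; ring
lemma cg_int {m n : ℤ} (h : (m - n) % 8 = 0) : Cg 15 (m : R K) n := by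
  have := eight_dvd (K := K) _ h
  push_cast at this
  exact this

/-- local analysis on the isogenous curve -/
lemma half_local {s X : K} (hs : s ≠ 0) (h : (X-21)^2 - 448 = 4*s^2*X) : ∃ w, X = w^2 ∨ X = -7*w^2 := by
  have hX : X ≠ 0 := by
    rintro rfl
    norm_num at h
  have hE : (2*s*X)^2 = X^3-42*X^2-7*X := by linear_combination (-X)*h
  have h21 : ∀ q : R K, X = ((21 + b^15 * q : R K) : K) → False := by
    intro q hq
    refine K1' (T := V.C 5) (h := 1) rfl bad5 one_ne_zero hE (u := 21 + b^15*q) (by rw [one_pow, one_mul]; exact hq) ?_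
    rw [evR_C]
    refine Cg.trans (y := ((21 : ℤ) : R K)) ⟨q, by push_cast; ring⟩ (cg_int (by norm_num))
  by_cases hD : X - 21 = 0
  · exfalso
    apply h21 0
    push_cast
    change X = 21 + _
    linear_combination hD
  obtain ⟨N, d, hd, e⟩ := exists_ord _ hD
  have hb0 := b_ne (K := K)
  obtain ⟨c, hc⟩ := hd.exists_right_inv
  by_cases hN : N ≤ 13
  · have hd0 := coe_ne hd.ne_zero
    have h2s : 2*s ≠ 0 := mul_ne_zero two_ne_zero hs
    obtain ⟨k, hk⟩ : ∃ k : ℕ, (13 : ℤ) - N = k := ⟨(13 - N).toNat, by omega⟩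
    refine K3 hX (h := (X-21)/(2*s)) (div_ne_zero hD h2s) hE (u := 1 - 7*b^16*η^6*(b^k*c)^2) ?_ ⟨- 7*b*η^6*(b^k*c)^2, by ring⟩
    have hc' : (c : K) = (d : K)⁻¹ := by
      have : (d : K) * c = 1 := by exact_mod_cast congrArg Subtype.val hc
      field_simp; linear_combination this
    have h448 : (64 : K) = β^42 * (η : K)^6 := by
      have := congrArg Subtype.val (s4_eq (K := K))
      push_cast at this
      rw [coe_bR] at this
      exact this
    have hβ : β^k = β^13 * (β^N)⁻¹ := by
      rw [← zpow_natCast, ← hk, zpow_sub₀ hb0, div_eq_mul_inv]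
      have : β^(13:ℤ) = β^13 := by norm_cast
      rw [this]
    push_cast
    rw [coe_bR, hc', hβ]
    have hbN : β^N ≠ 0 := zpow_ne_zero _ hb0
    change X = _ * (1 - 7 * _ * _ * _)
    have e3 : (1 - 7 * β^16 * (η:K)^6 * (β^13 * (β^N)⁻¹ * (d:K)⁻¹)^2 : K) * (X-21)^2 = (X-21)^2 - 448 := by
      rw [e]
      field_simp
      linear_combination (7:K)*h448
    rw [div_pow, div_mul_eq_mul_div, eq_div_iff (pow_ne_zero 2 h2s)]
    linear_combination -h - e3
  · obtain ⟨k, hk⟩ : ∃ k : ℕ, N = 14 + (k : ℤ) := ⟨(N - 14).toNat, by omega⟩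
    have e2 : X = ((21 + b^14 * (b^k*d) : R K) : K) := by
      push_cast
      rw [coe_bR]
      change X = 21 + _
      rw [hk, zpow_add₀ hb0, zpow_natCast] at e
      have : β^(14:ℤ) = β^14 := by norm_cast
      rw [this] at e
      linear_combination e
    rcases k with _ | k
    · refine K3 hX one_ne_zero hE (u := 21 + b^14 * (b^0*d)) (by rw [one_pow, one_mul]; exact e2) ?_
      obtain ⟨q, hq⟩ := (unit_iff' d).mp hd
      obtain ⟨p, hp⟩ := eta_one (K := K)
      refine Cg.trans (y := ((25 : ℤ) : R K)) ⟨q - p*(2+b*p), ?_⟩ (by simpa using cg_int (K := K) (m := 25) (n := 1) (by norm_num))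
      push_cast
      have h4 := four_eq (K := K)
      rw [hp] at h4
      linear_combination b^14 * hq - h4
    · exfalso
      apply h21 (b^k*d)
      rw [e2]
      congr 1
      ring

lemma not_sq5 {r c : R K} (h : r^2 = 21 + b^15*c) : False := by
  have h4 := four_eq (K := K)
  have h2 := two_eq (K := K)
  obtain ⟨q, hq⟩ := sq_one (r := r) ⟨5*η^2 + b*c, by linear_combination h + 5*h4⟩
  obtain ⟨p, hp⟩ := eta_one (K := K)
  have hqq : b ∣ q*(q+η) := by
    rcases dich q with h | h
    · exact h.mul_right _
    · obtain ⟨m, hm⟩ := h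
      apply Dvd.dvd.mul_left
      refine ⟨m + b^6*η + p, ?_⟩
      linear_combination hm + hp + h2
  obtain ⟨m, hm⟩ := hqq
  have e : b^14 * (b*m) = b^14 * (5*η^2 + b*c) := by
    rw [← hm]
    have : r = 1 + b^7*q := by linear_combination hq
    rw [this] at h
    linear_combination h + 5*h4 - b^7*q*h2
  have e2 := mul_left_cancel₀ (pow_ne_zero 14 (bR_ne (K := K))) e
  apply not_b_dvd_one (K := K)
  refine ⟨m - c - 5*p*(2+b*p) - 2*b^6*η, ?_⟩
  rw [hp] at e2 ⊢
  rw [hp] at h2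
  linear_combination - e2 - 2*h2

lemma halfA {s r x x' : K} (hs : x * x' = 112) (h2 : x + x' = r^2 - 21) (h3 : x - x' = 2*s*r) {q : R K} (hq : x' = q * x) (hb : b ∣ q) :
    ∃ μ r : K, μ ≠ 0 ∧ r^2*μ = 1+21*μ+112*μ^2 ∧ 1-112*μ^2 = 2*s*r*μ ∧ ∃ q : R K, 112*μ^2 = ((b*q : R K) : K) := by
  have hx : x ≠ 0 := by rintro rfl; norm_num at hs
  obtain ⟨m, hm⟩ := hb
  refine ⟨x⁻¹, r, inv_ne_zero hx, ?_, ?_, m, ?_⟩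
  · field_simp; linear_combination (-x)*h2+hs
  · field_simp; linear_combination x*h3+hs
  · rw [← hm]; field_simp; linear_combination x*hq-hs

lemma half {s w : K} (hs : s ≠ 0) (h : s^4+21*s^2+112=w^2) :
    ∃ μ r : K, μ ≠ 0 ∧ r^2*μ = 1+21*μ+112*μ^2 ∧ 1-112*μ^2 = 2*s*r*μ ∧ ∃ q : R K, 112*μ^2 = ((b*q : R K) : K) := by
  obtain ⟨r, w', hr, hw⟩ : ∃ r w' : K, 21+2*s^2+2*w' = r^2 ∧ s^4+21*s^2+112=w'^2 := by
    obtain ⟨r, hr | hr⟩ := half_local hs (X := 21+2*s^2+2*w) (by linear_combination -4*h)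
    · exact ⟨r, w, hr, h⟩
    · have hr0 : r ≠ 0 := by
        rintro rfl
        have : (7 : K) = 0 := by linear_combination -(21+2*s^2-2*w)*hr + 4*h
        norm_num at this
      refine ⟨1/r, -w, ?_, by rw [h]; ring⟩
      field_simp
      have : (7 : K) * (r^2*(21+2*s^2+2*(-w))) = 7*1 := by linear_combination (21+2*s^2-2*w)*hr - 4*h
      have := mul_left_cancel₀ (by norm_num) this
      linear_combination this
  set x := (r^2-21+2*s*r)/2 with hx
  set x' := (r^2-21-2*s*r)/2 with hx'
  have e1 : x * x' = 112 := by rw [hx, hx']; linear_combination -(r^2+21+2*s^2+2*w' - 42-4*s^2)/4*hr - hw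
  have e2 : x + x' = r^2 - 21 := by rw [hx, hx']; ring
  have e3 : x - x' = 2*s*r := by rw [hx, hx']; ring
  clear_value x x'
  have hx0 : x ≠ 0 := by rintro rfl; norm_num at e1
  have hx0' : x' ≠ 0 := by rintro rfl; norm_num at e1
  rcases memR_or (div_ne_zero hx0' hx0) with ⟨q, hq⟩ | ⟨q, hq⟩
  · rw [div_eq_iff hx0] at hq
    rcases dich q with hd | hd
    · exact halfA e1 e2 e3 hq hd
    · exfalso
      obtain ⟨v, hv⟩ := ((unit_iff' q).mpr hd).exists_right_inv
      have hv' : (q : K) * v = 1 := by exact_mod_cast congrArg Subtype.val hv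
      obtain ⟨a, ha⟩ := sq_mem (a := x/4) (v := 7*v) (by
        push_cast
        change _ = 7 * _
        rw [hq] at e1
        linear_combination (v:K)/16*e1 - x^2/16*hv')
      have ex : x = 4*a := by linear_combination 4*ha
      have e5 : r^2 = ((21 + 4*a*(1+q) : R K) : K) := by
        push_cast
        change _ = 21 + 4*_*_
        rw [hq, ex] at e2
        linear_combination -e2
      obtain ⟨r', hr'⟩ := sq_mem e5
      rw [hr'] at e5
      have e6 : r'^2 = 21 + 4*a*(1+q) := coe_inj (by rw [← e5]; push_cast; rfl)
      obtain ⟨m, hm⟩ := hd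
      refine not_sq5 (r := r') (c := η^2*a*(b^6*η+m)) ?_
      rw [e6]
      have h4 := four_eq (K := K)
      have h2 := two_eq (K := K)
      linear_combination a*(1+q)*h4 + b^14*η^2*a*(hm + h2)
  · have hq' : x = ((b*q : R K):K) * x' := by
      rw [← hq]; field_simp
    exact halfA (s := s) (r := -r) (by rw [mul_comm]; exact e1) (by rw [add_comm, e2]; ring) (by linear_combination -e3) hq' ⟨q, rfl⟩

end C2

namespace C2
open Polynomial Module NumberField

variable {K : Type} [Field K] [NumberField K] [KD K]
local notation "β" => (KD.b : K)
local notation "b" => (bR : R K)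
local notation "η" => (eta : R K)

lemma even_dvd {c : V} (h : c.a0 % 2 = 0) : b ∣ evR c := by
  obtain ⟨k, hk⟩ := Int.dvd_of_emod_eq_zero h
  rw [evR_def, hk]
  push_cast
  rw [two_eq (K := K)]
  exact ⟨b^6*η*k + c.a1 + c.a2*b+c.a3*b^2+c.a4*b^3+c.a5*b^4+c.a6*b^5, by ring⟩

def mA (M : V) : V := (V.C 1).add ((V.C 21).mul M)
def mB (M : V) : V := (V.C (-21)).add ((V.C (-441)).mul M)
/-- certificate for the key lemma -/
def cert (k M : V) : Bool :=
  k.a0 % 2 == 0 && M.a0 % 2 == 0 && c15 (M.add ((V.C 21).mul (M.mul M))) (k.mul k) && bad (mA M) && bad (mB M)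

lemma mu_mem {s r μ : K} {κ : R K} {j : ℕ} (hs : s * ((2^(j+1) * κ : R K) : K) = 1) (h0 : μ ≠ 0)
    (h1 : r^2*μ = 1+21*μ+112*μ^2) (h2 : 1-112*μ^2 = 2*s*r*μ) (h3 : ∃ q : R K, 112*μ^2 = ((b*q : R K) : K)) :
    ∃ m : R K, μ = m ∧ 4^j*κ^2*(1-112*m^2)^2 = m*(1+21*m+112*m^2) := by
  have h4 : (4 : K)^j*κ^2*(1-112*μ^2)^2 = μ*(1+21*μ+112*μ^2) := by
    push_cast at hs
    have hs : s*(2^(j+1)*(κ : K)) = 1 := hs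
    have e : (4 : K)^j = (2^j)^2 := by rw [← pow_mul, mul_comm, pow_mul]; norm_num
    rw [h2, e, ← h1]
    rw [pow_succ] at hs
    linear_combination r^2*μ^2*(s*(2^j*2*(κ : K)) + 1)*hs
  rcases memR_or h0 with ⟨m, hm⟩ | ⟨q, hq⟩
  · refine ⟨m, hm, coe_inj ?_⟩
    rw [hm] at h4
    push_cast
    exact h4
  · exfalso
    obtain ⟨p, hp⟩ := h3
    apply not_b_dvd_one (K := K)
    have e : (4 : R K)^j*κ^2*(1-b*p)^2*(b*q)^2 = b*q + 21 + b*p*(b*q) := by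
      apply coe_inj
      push_cast at hp hq ⊢
      change (4 : K)^j * _ * (1 - _)^2 * _ = _ + 21 + _
      rw [← hp, ← hq, h4]
      field_simp
    exact ⟨4^j*κ^2*(1-b*p)^2*(b*q^2) - q - p*(b*q) - 10*b^6*η, by linear_combination -e - 10*two_eq (K := K)⟩

lemma S_zero {s w : K} {κ : R K} {k M : V} (hc : cert k M = true) (hs : s * ((2^(0+1) * κ : R K) : K) = 1)
    (hw : s^4+21*s^2+112=w^2) (hk : Cg 8 κ (evR k)) : False := by
  have hs0 : s ≠ 0 := left_ne_zero_of_mul_eq_one hs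
  obtain ⟨μ, r, h0, h1, h2, h3⟩ := half hs0 hw
  obtain ⟨m, rfl, e⟩ := mu_mem hs h0 h1 h2 h3
  simp only [cert, Bool.and_eq_true, beq_iff_eq] at hc
  obtain ⟨⟨⟨⟨hk0, hM0⟩, hcc⟩, hA⟩, hB⟩ := hc
  have hkd := even_dvd (K := K) hk0
  have hMd := even_dvd (K := K) hM0
  have hE : ((r : K)/m)^2 = ((m : K)⁻¹)^3 + 21*((m : K)⁻¹)^2 + 112*(m : K)⁻¹ := by
    field_simp; linear_combination h1
  have h112 : (112 : R K) = b^28*(7*η^4) := by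
    rw [show (112 : R K) = 7*16 by norm_num, sixteen_eq]; ring
  have e1 : Cg 15 (m + 21*m^2) (evR M + 21*evR M^2) := by
    have a1 : Cg 15 (m+21*m^2) (κ^2) := by
      refine ⟨b^13*(7*η^4)*(κ^2*(-2*m^2+112*m^4) - m^3), ?_⟩
      linear_combination -e + (κ^2*(-2*m^2+112*m^4) - m^3)*h112
    have a2 : Cg 15 (κ^2) (evR k^2) := by
      obtain ⟨q, hq⟩ := hk
      obtain ⟨p, hp⟩ := hkd
      refine ⟨b*q^2 + b*η*q*p, ?_⟩
      have : κ = evR k + b^8*q := by linear_combination hq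
      rw [this, hp]
      have h2 := two_eq (K := K)
      linear_combination (b^9*q*p)*h2
    have a3 := (cg_of_c15 (K := K) hcc).symm
    rw [evR_add, evR_mul, evR_mul, evR_mul, evR_C] at a3
    push_cast at a3
    refine a1.trans (a2.trans ?_)
    rw [pow_two, pow_two]
    exact a3
  obtain ⟨q, hq⟩ := e1
  have hfac : (m - evR M)*(1+21*m+21*evR M) = b^15*q := by linear_combination hq
  rcases dich m with hd | hd
  · have hU : IsUnit (1+21*m+21*evR M) := by
      apply unit_of
      have := dvd_add (hd.mul_left 21) (hMd.mul_left 21)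
      convert this using 1; ring
    obtain ⟨v, hv⟩ := hU.exists_right_inv
    have hm : m - evR M = b^15*(q*v) := by linear_combination v*hfac - (m - evR M)*hv
    set U : R K := 1+21*m+112*m^2 with hUd
    have hUu : IsUnit U := by
      apply unit_of
      have := dvd_add (hd.mul_left 21) (hd.mul_left (112*m))
      convert this using 1; rw [hUd]; ring
    have hU0 := coe_ne hUu.ne_zero
    have hUe : (U : K) = r^2*m := by rw [h1, hUd]; push_cast; rfl
    have hr : r ≠ 0 := by rintro rfl; apply hU0; rw [hUe]; ring
    refine K1 (T := mA M) (h := r/U) (u := U) ?_ hA (div_ne_zero hr hU0) hE ?_ ?_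
    · simp [mA, V.add, V.mul, V.C]; omega
    · rw [hUe]; field_simp
    · rw [mA, evR_add, evR_mul, evR_C, evR_C, hUd]
      push_cast
      refine ⟨21*(q*v) + b^13*(7*η^4)*m^2, ?_⟩
      linear_combination 21*hm + m^2*h112
  · have hU : IsUnit (m - evR M) := by
      apply unit_of
      have := dvd_sub hd hMd
      convert this using 1; ring
    obtain ⟨v, hv⟩ := hU.exists_right_inv
    have hm : 1+21*m+21*evR M = b^15*(q*v) := by linear_combination v*hfac - (1+21*m+21*evR M)*hv
    refine K1 (T := mB M) (h := 1/(21*(m:K))) (u := 441*m) ?_ hB (by simpa using h0) hE ?_ ?_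
    · simp [mB, V.add, V.mul, V.C]; omega
    · push_cast
      change _ = _ * (441 * _)
      field_simp; norm_num
    · rw [mB, evR_add, evR_mul, evR_C, evR_C]
      push_cast
      exact ⟨21*(q*v), by linear_combination 21*hm⟩

lemma S_all (j : ℕ) : ∀ {s w : K} {κ : R K} {k M : V} (_ : cert k M = true) (_ : s * ((2^(j+1) * κ : R K) : K) = 1)
    (_ : s^4+21*s^2+112=w^2) (_ : Cg 8 κ (evR k)), False := by
  induction j with
  | zero => intro s w κ k M hc hs hw hk; exact S_zero hc hs hw hk
  | succ j ih =>
  intro s w κ k M hc hs hw hk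
  have hs0 : s ≠ 0 := left_ne_zero_of_mul_eq_one hs
  obtain ⟨μ, r, h0, h1, h2, h3⟩ := half hs0 hw
  obtain ⟨m, rfl, e⟩ := mu_mem hs h0 h1 h2 h3
  have hκ0 : (κ : K) ≠ 0 := by
    intro h
    push_cast at hs
    rw [h] at hs
    simp at hs
  have hE : ((r : K)/m)^2 = ((m : K)⁻¹)^3 + 21*((m : K)⁻¹)^2 + 112*(m : K)⁻¹ := by
    field_simp; linear_combination h1
  have h112 : (112 : R K) = b^28*(7*η^4) := by
    rw [show (112 : R K) = 7*16 by norm_num, sixteen_eq]; ring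
  have h4 := four_eq (K := K)
  have hκ : b ∣ κ := by
    simp only [cert, Bool.and_eq_true, beq_iff_eq] at hc
    have := even_dvd (K := K) hc.1.1.1.1
    have h8 : b ∣ κ - evR k := (dvd_pow_self _ (by norm_num)).trans hk
    simpa using dvd_add h8 this
  obtain ⟨κ1, hκ1⟩ := hκ
  have e' : m*(1+21*m+112*m^2) = b^16*(4^j*η^2*κ1^2*(1-112*m^2)^2) := by
    rw [← e, hκ1, pow_succ]; linear_combination 4^j*(b*κ1)^2*(1-112*m^2)^2*h4
  rcases dich m with hd | hd
  · set U : R K := 1+21*m+112*m^2 with hUd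
    have hUu : IsUnit U := by
      apply unit_of
      have := dvd_add (hd.mul_left 21) (hd.mul_left (112*m))
      convert this using 1; rw [hUd]; ring
    have hU0 := coe_ne hUu.ne_zero
    have hUe : (U : K) = r^2*m := by rw [h1, hUd]; push_cast; rfl
    have hr : r ≠ 0 := by rintro rfl; apply hU0; rw [hUe]; ring
    obtain ⟨v, hv⟩ := hUu.exists_right_inv
    obtain ⟨m1, hm1⟩ : b^16 ∣ m := ⟨4^j*η^2*κ1^2*(1-112*m^2)^2*v, by linear_combination v*e' - m*hv⟩
    obtain ⟨s', hs'⟩ := K2 (h := r/U) (u := U) (inv_ne_zero h0) (div_ne_zero hr hU0) hE (by rw [hUe]; field_simp)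
      ⟨21*b*m1+112*m*b*m1, by rw [hUd]; linear_combination (21+112*m)*hm1⟩
    have hs'0 : s' ≠ 0 := by rintro rfl; simp [h0] at hs'
    have hv' : (U : K) * v = 1 := by exact_mod_cast congrArg Subtype.val hv
    have e4 : (4 : K)^(j+1)*(κ : K)^2*(1-112*(m : K)^2)^2 = m*U := by
      have := congrArg Subtype.val e
      push_cast at this
      exact this
    have hm2 : (m : K)*s'^2 = 1 := by rw [← hs']; field_simp
    have e4' : (4 : K)^(j+1) = (2^(j+1))^2 := by rw [← pow_mul, mul_comm, pow_mul]; norm_num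
    obtain ⟨ρ, hρ⟩ := sq_mem (a := 1/(2^(j+1)*s'*κ)) (v := (1-112*m^2)^2*v) (by
      push_cast
      change _ = (1-112*_)^2*_
      have h2j : (2 : K)^(j+1) ≠ 0 := pow_ne_zero _ two_ne_zero
      rw [e4'] at e4
      field_simp
      linear_combination (-(v : K)*s'^2)*e4 - ((v:K)*U)*hm2 - hv')
    have hρ2 : ρ^2 = (1-112*m^2)^2*v := by
      apply coe_inj
      push_cast
      change _ = (1-112*_)^2*_
      rw [← hρ]
      have h2j : (2 : K)^(j+1) ≠ 0 := pow_ne_zero _ two_ne_zero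
      rw [e4'] at e4
      field_simp
      linear_combination (-(v : K)*s'^2)*e4 - ((v:K)*U)*hm2 - hv'
    obtain ⟨p, hp⟩ := sq_one (r := ρ) ⟨b^2*m1*v*((-224+112^2*m^2)*m - 21 - 112*m), by
      have : (1-112*m^2)^2 - U = m * ((-224+112^2*m^2)*m - 21 - 112*m) := by rw [hUd]; ring
      rw [hρ2]
      linear_combination v*this + hv + v*((-224+112^2*m^2)*m - 21 - 112*m)*hm1⟩
    refine ih (s := s') (w := r*s') (κ := κ*ρ) hc ?_ ?_ (Cg.trans (y := κ) ⟨κ1*p, ?_⟩ hk)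
    · push_cast
      rw [← hρ]
      change s' * (2^(j+1)*_) = 1
      have h2j : (2 : K)^(j+1) ≠ 0 := pow_ne_zero _ two_ne_zero
      field_simp
    · rw [mul_pow, ← hs', show s'^4 = (s'^2)^2 by ring, ← hs']
      field_simp; linear_combination -h1
    · rw [hκ1]; linear_combination b*κ1*hp
  · obtain ⟨v, hv⟩ := ((unit_iff' m).mpr hd).exists_right_inv
    set Q := 4^j*η^2*κ1^2*(1-112*m^2)^2 
    obtain ⟨w21, hw21⟩ := (odd_unit (K := K) (n := 21) (by decide)).exists_right_inv
    push_cast at hw21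
    refine K1 (T := V.C 3) (h := 1/(m:K)) (u := m) rfl bad3 (by simpa using h0) hE (by field_simp) ?_
    rw [evR_C]
    push_cast
    refine ⟨w21*(b*Q*v - b^13*(7*η^4)*m^2 - b^27*η^6), ?_⟩
    linear_combination (3 - m)*hw21 + w21*v*e' - w21*(1+21*m+112*m^2)*hv - w21*m^2*h112 - w21*s4_eq (K := K)

end C2

namespace C2
open Polynomial Module NumberField

variable {K : Type} [Field K] [NumberField K] [KD K]
local notation "β" => (KD.b : K)
local notation "b" => (bR : R K)
local notation "η" => (eta : R K)

lemma SX {x y : K} {u κ : R K} {j : ℕ} {k M : V} (hc : cert k M = true) (hy : y^2 = x^3+21*x^2+112*x)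
    (hx : x * ((2^(j+1)*κ : R K) : K)^2 = u) (hu : Cg 15 u 1) (hk : Cg 8 κ (evR k)) : False := by
  have hU : IsUnit u := unit_cg (by norm_num) hu isUnit_one
  have hU0 := coe_ne hU.ne_zero
  have hx0 : x ≠ 0 := by rintro rfl; rw [zero_mul] at hx; exact hU0 hx.symm
  have hθ0 : ((2^(j+1)*κ : R K) : K) ≠ 0 := by intro h; rw [h] at hx; apply hU0; rw [← hx]; ring
  obtain ⟨s, hs⟩ := K2 (h := ((2^(j+1)*κ : R K) : K)⁻¹) (u := u) hx0 (inv_ne_zero hθ0) hy (by rw [← hx]; field_simp) hu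
  have hs0 : s ≠ 0 := by rintro rfl; simp [hx0] at hs
  obtain ⟨v, hv⟩ := hU.exists_right_inv
  have hv' : (u : K) * v = 1 := by exact_mod_cast congrArg Subtype.val hv
  have hρ0 : ((s * ((2^(j+1)*κ : R K) : K))⁻¹)^2 = v := by
    have : (s * ((2^(j+1)*κ : R K) : K))^2 = u := by rw [mul_pow, ← hs, hx]
    rw [inv_pow, this]
    field_simp; linear_combination -hv'
  obtain ⟨ρ, hρ⟩ := sq_mem hρ0
  rw [hρ] at hρ0
  have hρ2 : ρ^2 = v := coe_inj (by rw [← hρ0]; push_cast; rfl)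
  obtain ⟨q, hq⟩ := hu
  obtain ⟨p, hp⟩ := sq_one (r := ρ) ⟨-(b*q*v), by rw [hρ2]; linear_combination -v*hq + hv⟩
  have hκ : b ∣ κ := by
    have hc' := hc
    simp only [cert, Bool.and_eq_true, beq_iff_eq] at hc'
    have := even_dvd (K := K) hc'.1.1.1.1
    have h8 : b ∣ κ - evR k := (dvd_pow_self _ (by norm_num)).trans hk
    simpa using dvd_add h8 this
  obtain ⟨κ1, hκ1⟩ := hκ
  refine S_all j (s := s) (w := y/s) (κ := κ*ρ) hc ?_ ?_ (Cg.trans (y := κ) ⟨κ1*p, ?_⟩ hk)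
  · have e : ((2^(j+1)*(κ*ρ) : R K) : K) = ((2^(j+1)*κ : R K) : K) * ρ := by push_cast; ring
    rw [e, ← hρ, ← mul_assoc, mul_inv_cancel₀ (mul_ne_zero hs0 hθ0)]
  · rw [div_pow, hy, hs]; field_simp
  · rw [hκ1]; linear_combination b*κ1*hp

lemma V_two (k : V) : ((V.C 2).mul k).a0 = 2*k.a0 := by simp [V.C, V.mul]

/-- disc classification in terms of the parameters `t = e₂/e₁²`, `g = e₃/e₁³` -/
lemma tg_E {t g : K} (ht : t ≠ 0) (hg : g ≠ 0) (h : t^4 + g*(1-5*t+t^2+7*g) = 0) :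
    ((5-2/t)*(-4*t^2/g))^2 = (-4*t^2/g)^3+21*(-4*t^2/g)^2+112*(-4*t^2/g) := by
  field_simp
  linear_combination 16*h

lemma tgR {X Y Z v : R K} (h : X^3*Y+Y^3*Z+Z^3*X = 0) (hv : (X+Y+Z)*v = 1) :
    ((X*Y+Y*Z+Z*X)*v^2)^4 + (X*Y*Z*v^3)*(1 - 5*((X*Y+Y*Z+Z*X)*v^2)+((X*Y+Y*Z+Z*X)*v^2)^2+7*(X*Y*Z*v^3)) = 0 := by
  set e1 := X+Y+Z with h1
  set e2 := X*Y+Y*Z+Z*X with h2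
  set e3 := X*Y*Z with h3
  have hr : e2^4+e1^5*e3-5*e1^3*e2*e3+e1*e2^2*e3+7*e1^2*e3^2 = 0 := by
    rw [h1, h2, h3]
    linear_combination (X*Y^3+Y*Z^3+Z*X^3)*h
  have i2 : (e1*v)^2 = 1 := by rw [hv]; ring
  have i3 : (e1*v)^3 = 1 := by rw [hv]; ring
  have i5 : (e1*v)^5 = 1 := by rw [hv]; ring
  clear_value e1 e2 e3
  linear_combination v^8*hr - e3*v^3*i5+5*e2*e3*v^5*i3-e2^2*e3*v^7*hv-7*e3^2*v^6*i2

/-- direct test -/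
lemma disc_direct {t g : R K} {T : V} (hg0 : g ≠ 0) (h : t^4 + g*(1-5*t+t^2+7*g) = 0)
    (ht : b^4 ∣ t) (hg : b ∣ g) (hT : Cg 15 (1-5*t+t^2) (evR T)) (hT0 : T.a0 % 2 = 1) (hb : bad T = true) : False := by
  have hU : IsUnit (1-5*t+t^2+7*g) := by
    apply unit_of
    have h1 : b ∣ t := (dvd_pow_self _ (by norm_num)).trans ht
    have := dvd_add (h1.mul_right (t-5)) (hg.mul_left 7)
    convert this using 1; ring
  have hg15 : b^15 ∣ g := by
    obtain ⟨v, hv⟩ := hU.exists_right_inv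
    obtain ⟨t1, ht1⟩ := ht
    refine ⟨-(b*t1^4*v), ?_⟩
    rw [ht1] at hv h
    linear_combination v*h - g*hv
  have ht0 : t ≠ 0 := by
    rintro rfl
    have : g*(1-5*0+0^2+7*g) = 0 := by linear_combination h
    rcases mul_eq_zero.mp this with h1 | h1
    · exact hg0 h1
    · exact hU.ne_zero h1
  have ht' := coe_ne ht0
  have hg' := coe_ne hg0
  have h' : (t : K)^4 + g*(1-5*t+(t : K)^2+7*g) = 0 := by
    have := congrArg Subtype.val h
    push_cast at this
    exact this
  refine K1 (T := T) (h := 2/(t : K)) (u := 1-5*t+t^2+7*g) hT0 hb (div_ne_zero two_ne_zero ht') (tg_E ht' hg' h') ?_ ?_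
  · push_cast
    change _ = _ * (1 - 5*_ + _ + 7*_)
    field_simp
    linear_combination -4*h'
  · refine Cg.trans (y := 1-5*t+t^2) ?_ hT
    obtain ⟨q, hq⟩ := hg15
    exact ⟨7*q, by linear_combination 7*hq⟩

lemma disc_S {t g κ : R K} {j : ℕ} {k M : V} (hg0 : g ≠ 0) (h : t^4 + g*(1-5*t+t^2+7*g) = 0)
    (ht : t = 2^(j+2)*κ) (hg : b ∣ g) (hk : Cg 8 κ (evR k)) (hc : cert k M = true) : False := by
  have hκ : b ∣ κ := by
    have hc' := hc
    simp only [cert, Bool.and_eq_true, beq_iff_eq] at hc'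
    have := even_dvd (K := K) hc'.1.1.1.1
    have h8 : b ∣ κ - evR k := (dvd_pow_self _ (by norm_num)).trans hk
    simpa using dvd_add h8 this
  obtain ⟨κ1, hκ1⟩ := hκ
  have ht15 : t = b^15*(2^j*η^2*κ1) := by
    rw [ht, hκ1, pow_add]
    linear_combination (2^j*b*κ1)*four_eq (K := K)
  have hU : IsUnit (1-5*t+t^2+7*g) := by
    apply unit_of
    have h1 : b ∣ t := ⟨b^14*(2^j*η^2*κ1), by rw [ht15]; ring⟩
    have := dvd_add (h1.mul_right (t-5)) (hg.mul_left 7)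
    convert this using 1; ring
  have hg15 : b^15 ∣ g := by
    obtain ⟨v, hv⟩ := hU.exists_right_inv
    refine ⟨-(b^45*(2^j*η^2*κ1)^4*v), ?_⟩
    rw [ht15] at hv h
    linear_combination v*h - g*hv
  have ht0 : t ≠ 0 := by
    rintro rfl
    have : g*(1-5*0+0^2+7*g) = 0 := by linear_combination h
    rcases mul_eq_zero.mp this with h1 | h1
    · exact hg0 h1
    · exact hU.ne_zero h1
  have ht' := coe_ne ht0
  have hg' := coe_ne hg0
  have h' : (t : K)^4 + g*(1-5*t+(t : K)^2+7*g) = 0 := by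
    have := congrArg Subtype.val h
    push_cast at this
    exact this
  refine SX (u := 1-5*t+t^2+7*g) (κ := κ) (j := j) hc (tg_E ht' hg' h') ?_ ?_ hk
  · have e : (t : K) = 2 * ((2^(j+1)*κ : R K) : K) := by
      rw [ht]; push_cast
      change 2^(j+2) * _ = 2*(2^(j+1)*_)
      ring
    have e' : ((2^(j+1)*κ : R K) : K) = t/2 := by rw [e]; field_simp
    rw [e']
    push_cast
    change _ = (1 - 5*_ + _ + 7*_)
    field_simp
    linear_combination -4*h'
  · obtain ⟨q, hq⟩ := hg15
    refine ⟨(2^j*η^2*κ1)*(t-5)+7*q, ?_⟩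
    linear_combination 7*hq+(t-5)*ht15

lemma cusp {X Y Z w : R K} {n : ℕ} {k M : V} (h : X^3*Y+Y^3*Z+Z^3*X = 0) (h1 : b^7 ∣ X+Y+Z-1)
    (h2 : X*Y+Y*Z+Z*X = 2^(n+1)*w) (hw : Cg 8 w (evR k)) (h3 : b ∣ X*Y*Z) (h0 : X*Y*Z ≠ 0)
    (hb : bad ((V.C 1).add ((V.C (-10)).mul k)) = true) (hc : cert k M = true) : False := by
  have hU : IsUnit (X+Y+Z) := unit_of _ ((dvd_pow_self _ (by norm_num)).trans h1)
  obtain ⟨v, hv⟩ := hU.exists_right_inv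
  have hvu : IsUnit v := IsUnit.of_mul_eq_one (X+Y+Z) (by rw [mul_comm]; exact hv)
  have hr := tgR h hv
  rw [h2] at hr
  have hk0 : k.a0 % 2 = 0 := by
    have hc' := hc
    simp only [cert, Bool.and_eq_true, beq_iff_eq] at hc'
    exact hc'.1.1.1.1
  have hke := even_dvd (K := K) hk0
  obtain ⟨q, hq⟩ := hw
  obtain ⟨k1, hk1⟩ := hke
  obtain ⟨p, hp⟩ := h1
  have hv1 : v - 1 = b^7*(-p*v) := by linear_combination -v*hp+hv
  have hκ : Cg 8 (w*v^2) (evR k) := by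
    refine ⟨q*v^2 + k1*(-p*v)*(v+1), ?_⟩
    linear_combination v^2*hq+(evR k)*(v+1)*hv1 + b^7*(-p*v)*(v+1)*hk1
  have hg0 : X*Y*Z*v^3 ≠ 0 := mul_ne_zero h0 (pow_ne_zero 3 hvu.ne_zero)
  rcases n with _ | n
  · obtain ⟨q', hq'⟩ := hκ
    have h2' := two_eq (K := K)
    refine disc_direct hg0 hr ⟨b^4*η*(b^7*q' + k1), ?_⟩ (h3.mul_right _) (T := (V.C 1).add ((V.C (-10)).mul k)) ?_ ?_ hb
    · linear_combination 2*hq' + 2*hk1 + (b^8*q'+b*k1)*h2'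
    · rw [evR_add, evR_mul, evR_C, evR_C]
      push_cast
      refine ⟨-5*η*q'+ b*η^2*(b^7*q' + k1)^2, ?_⟩
      have e : w*v^2 = evR k + b^8*q' := by linear_combination hq'
      have e2 : (2^(0+1)*w*v^2)^2 = b^16*η^2*(b^7*q'+k1)^2 := by
        have : 2^(0+1)*w*v^2 = b^8*η*(b^7*q'+k1) := by
          linear_combination 2*e + 2*hk1 + (b^8*q'+b*k1)*h2'
        rw [this]; ring
      linear_combination -10*e - 5*b^8*q'*h2' + e2
    · simp [V.add, V.mul, V.C]; omega
  · exact disc_S (κ := w*v^2) (j := n) hg0 hr (by ring) (h3.mul_right _) hκ hc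

end C2

namespace C2
open Polynomial Module NumberField

variable {K : Type} [Field K] [NumberField K] [KD K]
local notation "β" => (KD.b : K)
local notation "b" => (bR : R K)
local notation "η" => (eta : R K)

def k100 : V := ⟨0,1,0,0,0,0,0⟩
def k010 : V := ⟨0,0,1,0,0,0,0⟩
def k001 : V := ⟨0,0,0,0,1,0,0⟩
def k110 : V := ⟨0,1,1,0,0,0,0⟩
def k101 : V := ⟨0,1,0,0,1,0,0⟩
def k011 : V := ⟨0,0,1,0,1,0,0⟩
lemma c100 : cert k100 ⟨0, 6, 5, 4, 3, 4, 2⟩ = true := by decide +kernel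
lemma c010 : cert k010 ⟨0, 6, 4, 0, 1, 4, 0⟩ = true := by decide +kernel
lemma c001 : cert k001 ⟨0, 2, 4, 0, 0, 0, 0⟩ = true := by decide +kernel
lemma c110 : cert k110 ⟨0, 0, 1, 2, 4, 4, 4⟩ = true := by decide +kernel
lemma c101 : cert k101 ⟨0, 0, 1, 0, 3, 2, 2⟩ = true := by decide +kernel
lemma c011 : cert k011 ⟨0, 0, 0, 0, 1, 0, 2⟩ = true := by decide +kernel
lemma d100 : bad ((V.C 1).add ((V.C (-10)).mul k100)) = true := by decide +kernel
lemma d010 : bad ((V.C 1).add ((V.C (-10)).mul k010)) = true := by decide +kernel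
lemma d001 : bad ((V.C 1).add ((V.C (-10)).mul k001)) = true := by decide +kernel

end C2

namespace C2
open Polynomial Module NumberField

variable {K : Type} [Field K] [NumberField K] [KD K]
local notation "β" => (KD.b : K)
local notation "b" => (bR : R K)
local notation "η" => (eta : R K)

lemma int_ne {n : ℤ} (h : n ≠ 0) : (n : R K) ≠ 0 := by
  intro h0
  have := congrArg Subtype.val h0
  push_cast at this
  exact h (by exact_mod_cast this)

lemma b7 : b^7 = 18 := by
  apply coe_inj
  push_cast
  rw [coe_bR]
  exact hb

lemma odd_dvd {n k : ℕ} {z A B : ℤ} (hA : A % 2 = 1) (h : z * A = 2^k * B) : ∃ d, z = 2^k * d := by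
  have h1 : IsCoprime ((2:ℤ)^k) A := by
    apply IsCoprime.pow_left
    rw [Int.isCoprime_iff_gcd_eq_one]
    have : ¬ (2:ℤ) ∣ A := by omega
    exact (Int.prime_two.coprime_iff_not_dvd.mpr this) |> Int.isCoprime_iff_gcd_eq_one.mp
  exact h1.dvd_of_dvd_mul_right ⟨B, h⟩

lemma odd_pow3 {y w : ℤ} (hy : y % 2 = 1) (hw : w % 2 = 0) : (y^3 + w) % 2 = 1 := by
  have : Odd (y^3) := (Int.odd_iff.mpr hy).pow
  have := Int.odd_iff.mp this
  omega

lemma two_cast {x a : ℤ} (h : x = 2 * a) : (x : R K) = b^7*η*a := by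
  rw [h]; push_cast; rw [two_eq (K := K)]

lemma caseY {x y z : ℤ} (h : 3*x^3*y+y^3*z+2*z^3*x = 0) (hx : x % 2 = 0) (hy : y % 2 = 1) (hz : z ≠ 0) (hx0 : x ≠ 0)
    (_hK : β ≠ 0) : False := by
  obtain ⟨n', c, hc, e⟩ := ex_two_odd hx0
  obtain ⟨n, rfl⟩ : ∃ n, n' = n+1 := by
    rcases n' with _ | n
    · rw [pow_zero, one_mul] at e
      have := Int.odd_iff.mp hc
      omega
    · exact ⟨n, rfl⟩
  obtain ⟨d, hd⟩ := odd_dvd (n := 0) (z := z) (A := y^3 + 2*(z^2*x)) (k := 3*n+3) (B := -3*c^3*y) (odd_pow3 hy (by omega)) (by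
    have : x^3 = 2^(3*n+3)*c^3 := by rw [e]; ring
    linear_combination h - 3*y*this)
  have hcy : (9*c*y-1) % 2 = 0 := by
    have : Odd (9*c*y) := ((show Odd (9:ℤ) by decide).mul hc).mul (Int.odd_iff.mpr hy)
    have := Int.odd_iff.mp this
    omega
  obtain ⟨a, ha⟩ := Int.dvd_of_emod_eq_zero hcy
  obtain ⟨a', ha'⟩ : ∃ a', 3*y-1 = 2*a' := ⟨(3*y-1)/2, by omega⟩
  obtain ⟨x', hx'⟩ : ∃ x', x = 2*x' := ⟨2^n*c, by rw [e]; ring⟩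
  obtain ⟨z', hz'⟩ : ∃ z', z = 2*z' := ⟨2^(3*n+2)*d, by rw [hd]; ring⟩
  obtain ⟨z1, hz1⟩ : ∃ z1, z = 2^(n+1)*(2*z1) := ⟨2^(2*n+1)*d, by rw [hd]; ring⟩
  have hy0 : y ≠ 0 := by omega
  have A1 := two_cast (K := K) ha
  have A2 := two_cast (K := K) ha'
  have A3 := two_cast (K := K) hx'
  have A4 := two_cast (K := K) hz'
  have A5 := congrArg (Int.cast : ℤ → R K) e
  have A6 := congrArg (Int.cast : ℤ → R K) hz1
  have A7 := congrArg (Int.cast : ℤ → R K) h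
  push_cast at A1 A2 A5 A6 A7
  have h2 := two_eq (K := K)
  refine cusp (K := K) (X := 3*b*(x:R K)) (Y := 3*(y:R K)) (Z := b^3*(z:R K)) (n := n) (w := 9*b*(c:R K)*(y:R K) + 3*(y:R K)*b^3*(2*(z1:R K))+3*b^4*(z:R K)*(c:R K)) ?_ ⟨η*(a'+3*b*x'+b^3*z'), ?_⟩ ?_ ⟨η*(a+3*y*b^2*z1+3*b^3*z'*c), ?_⟩ ?_ ?_ d100 c100
  · linear_combination 27*b^3*A7 + 3*b^3*(z:R K)^3*x*b7 (K := K)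
  · linear_combination A2 + 3*b*A3+b^3*A4
  · linear_combination (9*b*y+3*b^4*z)*A5 + 3*y*b^3*A6
  · have : (evR k100 : R K) = b := by rw [evR_def]; simp [k100]
    rw [this]
    linear_combination b*A1 + 3*y*b^3*z1*h2+3*b^4*c*A4
  · exact ⟨9*x*y*b^3*z, by ring⟩
  · have b0 := bR_ne (K := K)
    have t0 : (3 : R K) ≠ 0 := by have := int_ne (K := K) (n := 3) (by norm_num); simpa using this
    exact mul_ne_zero (mul_ne_zero (mul_ne_zero (mul_ne_zero t0 b0) (int_ne hx0)) (mul_ne_zero t0 (int_ne hy0))) (mul_ne_zero (pow_ne_zero 3 b0) (int_ne hz))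

lemma caseX {x y z : ℤ} (h : 3*x^3*y+y^3*z+2*z^3*x = 0) (hx : x % 2 = 1) (hzz : z % 2 = 0) (hy0 : y ≠ 0) (hz : z ≠ 0)
    (_hK : β ≠ 0) : False := by
  obtain ⟨n', c, hc, e⟩ := ex_two_odd hz
  obtain ⟨n, rfl⟩ : ∃ n, n' = n+1 := by
    rcases n' with _ | n
    · rw [pow_zero, one_mul] at e
      have := Int.odd_iff.mp hc
      omega
    · exact ⟨n, rfl⟩
  have hx0 : x ≠ 0 := by omega
  obtain ⟨d, hd⟩ := odd_dvd (n := 0) (z := y) (A := 3*x^3 + y^2*z) (k := 3*n+4) (B := -c^3*x) (by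
      obtain ⟨q, hq⟩ := Int.dvd_of_emod_eq_zero hzz
      have : Odd (3*x^3) := (show Odd (3:ℤ) by decide).mul (Int.odd_iff.mpr hx).pow
      have := Int.odd_iff.mp this
      rw [hq, show 3*x^3+y^2*(2*q) = 3*x^3 + 2*(y^2*q) by ring]
      omega) (by
    have : z^3 = 2^(3*n+3)*c^3 := by rw [e]; ring
    rw [show 3*n+4 = 3*n+3+1 by ring, pow_succ]
    linear_combination h - 2*x*this)
  have hcx : (27*x*c-1) % 2 = 0 := by
    have : Odd (27*x*c) := ((show Odd (27:ℤ) by decide).mul (Int.odd_iff.mpr hx)).mul hc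
    have := Int.odd_iff.mp this
    omega
  obtain ⟨a, ha⟩ := Int.dvd_of_emod_eq_zero hcx
  obtain ⟨a', ha'⟩ : ∃ a', 9*x-1 = 2*a' := ⟨(9*x-1)/2, by omega⟩
  obtain ⟨z', hz'⟩ : ∃ z', z = 2*z' := ⟨2^n*c, by rw [e]; ring⟩
  obtain ⟨y1, hy1, y2, hy2⟩ : ∃ y1, y = 2*y1 ∧ ∃ y2, y1 = 2^(n+1)*(2*y2) := ⟨2^(3*n+3)*d, by rw [hd]; ring, 2^(2*n+1)*d, by ring⟩
  have hy10 : y1 ≠ 0 := by omega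
  obtain ⟨y', hy'⟩ : ∃ y', y1 = 2*y' := ⟨2^(n+1)*y2, by rw [hy2]; ring⟩
  subst hy1
  have A1 := two_cast (K := K) ha
  have A2 := two_cast (K := K) ha'
  have A3 := two_cast (K := K) hz'
  have A4 := two_cast (K := K) hy'
  have A5 := congrArg (Int.cast : ℤ → R K) e
  have A6 := congrArg (Int.cast : ℤ → R K) hy2
  have hh : 243*(3*x^3*y1+4*y1^3*z+z^3*x) = 0 := by linarith
  have A7 := congrArg (Int.cast : ℤ → R K) hh
  push_cast at A1 A2 A5 A6 A7
  have h2 := two_eq (K := K)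
  refine cusp (K := K) (X := 9*(x:R K)) (Y := b^6*(y1:R K)) (Z := 3*b^2*(z:R K)) (n := n) (w := 27*b^2*(x:R K)*(c:R K) + 9*(x:R K)*b^6*(2*(y2:R K))+3*b^8*(y1:R K)*(c:R K)) ?_ ⟨η*(a'+b^6*y'+3*b^2*z'), ?_⟩ ?_ ⟨b*η*(a) + 9*x*b^5*y2*η+3*y1*c, ?_⟩ ?_ ?_ d010 c010
  · linear_combination b^6*A7 + 3*b^6*(y1:R K)^3*z*(b^7+18)*b7 (K := K)
  · linear_combination A2 + b^6*A4+3*b^2*A3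
  · linear_combination (27*b^2*x+3*b^8*y1)*A5 + 9*x*b^6*A6
  · have : (evR k010 : R K) = b^2 := by rw [evR_def]; simp [k010]
    rw [this]
    linear_combination b^2*A1 + 9*x*b^6*y2*h2
  · exact ⟨9*x*b^5*y1*3*b^2*z, by ring⟩
  · have b0 := bR_ne (K := K)
    have t0 : (3 : R K) ≠ 0 := by have := int_ne (K := K) (n := 3) (by norm_num); simpa using this
    have t1 : (9 : R K) ≠ 0 := by have := int_ne (K := K) (n := 9) (by norm_num); simpa using this
    exact mul_ne_zero (mul_ne_zero (mul_ne_zero t1 (int_ne hx0)) (mul_ne_zero (pow_ne_zero 6 b0) (int_ne hy10))) (mul_ne_zero (mul_ne_zero t0 (pow_ne_zero 2 b0)) (int_ne hz))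

/-- the target for the last direct disc -/
def TZ (e : Bool) : V := ⟨1,2,0,0,if e then -1 else 1,0,0⟩
lemma bZ1 : bad (TZ true) = true := by decide +kernel
lemma bZ2 : bad (TZ false) = true := by decide +kernel
end C2

namespace C2
open Polynomial Module NumberField

variable {K : Type} [Field K] [NumberField K] [KD K]
local notation "β" => (KD.b : K)
local notation "b" => (bR : R K)
local notation "η" => (eta : R K)

def E1Z (z c d : ℤ) : V := ⟨3*z,0,0,0,c,2*d,0⟩
def E2Z (z c d : ℤ) : V := ⟨0,0,36*(d*c),0,3*(c*z),6*(z*d),0⟩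
def p4 (E : V) : V := (E.mul E).mul (E.mul E)
/-- polynomial e₁⁴-5e₁²e₂+e₂² -/
def pZ (E1 E2 : V) : V := (p4 E1).add (((V.C (-5)).mul ((E1.mul E1).mul E2)).add (E2.mul E2))
def ckZ (z c : ℤ) : Bool := c15 (pZ (E1Z z c 1) (E2Z z c 1)) ((TZ ((c*3*z) % 4 == 1)).mul (p4 (E1Z z c 1)))
lemma chkZ : ∀ z ∈ [1,3,5,7], ∀ c ∈ [1,3], ckZ z c = true := by decide +kernel

lemma direct_chk {X Y Z : R K} {E1 E2 T : V} (h : X^3*Y+Y^3*Z+Z^3*X = 0) (h1 : Cg 15 (X+Y+Z) (evR E1))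
    (h2 : Cg 15 (X*Y+Y*Z+Z*X) (evR E2)) (hE : E1.a0 % 2 = 1) (h4 : b^4 ∣ X*Y+Y*Z+Z*X) (h3 : b ∣ X*Y*Z) (h0 : X*Y*Z ≠ 0)
    (hT : T.a0 % 2 = 1) (hb : bad T = true) (hc : c15 (pZ E1 E2) (T.mul (p4 E1)) = true) : False := by
  have hU : IsUnit (X+Y+Z) := unit_cg (by norm_num) h1 (ev_unit hE)
  obtain ⟨v, hv⟩ := hU.exists_right_inv
  have hvu : IsUnit v := IsUnit.of_mul_eq_one (X+Y+Z) (by rw [mul_comm]; exact hv)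
  have hr := tgR h hv
  have hg0 : X*Y*Z*v^3 ≠ 0 := mul_ne_zero h0 (pow_ne_zero 3 hvu.ne_zero)
  refine disc_direct hg0 hr (h4.mul_right _) (h3.mul_right _) (T := T) ?_ hT hb
  have c1 := cg_of_c15 (K := K) hc
  rw [pZ, p4, evR_add, evR_add, evR_mul, evR_mul, evR_mul, evR_mul, evR_mul, evR_mul, evR_mul, evR_mul, evR_mul, evR_C] at c1
  set e1 := X+Y+Z
  set e2 := X*Y+Y*Z+Z*X
  have d1 := (h1.mul h1).mul (h1.mul h1)
  have d2 := (Cg.refl 15 (((-5 : ℤ) : R K))).mul ((h1.mul h1).mul h2)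
  have d3 := d1.add (d2.add (h2.mul h2))
  have d4 := d3.trans (c1.trans ((Cg.refl 15 (evR T : R K)).mul d1.symm))
  obtain ⟨q, hq⟩ := d4
  push_cast at hq
  have i2 : (e1*v)^2 = 1 := by rw [hv]; ring
  have i4 : (e1*v)^4 = 1 := by rw [hv]; ring
  exact ⟨q*v^4, by linear_combination v^4*hq - (1-evR T)*i4 +5*e2*v^2*i2⟩

lemma caseZ {x y z : ℤ} (h : 3*x^3*y+y^3*z+2*z^3*x = 0) (hx : x % 2 = 0) (hyy : y % 2 = 0) (hz : z % 2 = 1) (hx0 : x ≠ 0) (hy0 : y ≠ 0)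
    (_hK : β ≠ 0) : False := by
  obtain ⟨x1, rfl⟩ := Int.dvd_of_emod_eq_zero hx
  obtain ⟨y1, rfl⟩ := Int.dvd_of_emod_eq_zero hyy
  have hx1 : x1 ≠ 0 := by omega
  have hy1 : y1 ≠ 0 := by omega
  have hz0 : z ≠ 0 := by omega
  obtain ⟨n', c, hc, e⟩ := ex_two_odd hy1
  have h27 : 27*(12*x1^3*y1+2*y1^3*z+z^3*x1) = 0 := by linarith
  have h1 : 12*x1^3*y1+2*y1^3*z+z^3*x1 = 0 := by linarith
  obtain ⟨d, hd⟩ := odd_dvd (n := 0) (z := x1) (A := z^3 + 2*(6*x1^2*y1)) (k := 3*n'+1) (B := -c^3*z) (odd_pow3 hz (by omega)) (by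
    have : y1^3 = 2^(3*n')*c^3 := by rw [e]; ring
    rw [pow_succ]
    linear_combination h1 - 2*z*this)
  have A7 := congrArg (Int.cast : ℤ → R K) h27
  push_cast at A7
  have hKl : (b^5*(x1:R K))^3*(b^4*(y1:R K)) + (b^4*(y1:R K))^3*(3*(z:R K)) + (3*(z:R K))^3*(b^5*(x1:R K)) = 0 := by
    linear_combination b^5*A7 + b^5*(x1:R K)^3*y1*(b^7+18)*b7 (K := K) + 3*b^5*(y1:R K)^3*z*b7 (K := K)
  have b0 := bR_ne (K := K)
  have t0 : (3 : R K) ≠ 0 := by have := int_ne (K := K) (n := 3) (by norm_num); simpa using this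
  have hne : (b^5*(x1:R K))*(b^4*(y1:R K))*(3*(z:R K)) ≠ 0 :=
    mul_ne_zero (mul_ne_zero (mul_ne_zero (pow_ne_zero 5 b0) (int_ne hx1)) (mul_ne_zero (pow_ne_zero 4 b0) (int_ne hy1))) (mul_ne_zero t0 (int_ne hz0))
  have hdv : b ∣ (b^5*(x1:R K))*(b^4*(y1:R K))*(3*(z:R K)) := ⟨b^4*x1*b^4*y1*(3*z), by ring⟩
  have h2 := two_eq (K := K)
  rcases n' with _ | n
  · rw [pow_zero, one_mul] at e
    subst e
    have hd : x1 = 2*d := by rw [hd]; ring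
    have hd2 : Odd d := by
      by_contra hne
      rw [Int.not_odd_iff_even] at hne
      obtain ⟨d', hd'⟩ := hne
      have e3 : Odd (y1^3*z) := (hc.pow).mul (Int.odd_iff.mpr hz)
      have : 12*(2*d)^3*y1+2*(y1^3*z)+z^3*(2*d) = 0 := by rw [hd] at h1; linarith
      have e4 := Int.odd_iff.mp e3
      have : y1^3*z = 2*(-24*d^3*y1 - z^3*d') := by rw [hd'] at this ⊢; linarith
      omega
    obtain ⟨d', hd'⟩ := hd2
    have hc1 := Int.odd_iff.mp hc
    have zmem : z % 8 ∈ [1,3,5,7] := by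
      have : z % 8 = 1 ∨ z % 8 = 3 ∨ z % 8 = 5 ∨ z % 8 = 7 := by omega
      rcases this with h | h | h | h <;> rw [h] <;> decide
    have cmem : y1 % 4 ∈ [1,3] := by
      have : y1 % 4 = 1 ∨ y1 % 4 = 3 := by omega
      rcases this with h | h <;> rw [h] <;> decide
    have hck := chkZ _ zmem _ cmem
    obtain ⟨z0, hz0d⟩ : ∃ z0, z0 = z % 8 := ⟨_, rfl⟩
    obtain ⟨c0, hc0d⟩ : ∃ c0, c0 = y1 % 4 := ⟨_, rfl⟩
    rw [← hz0d, ← hc0d] at hck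
    obtain ⟨z2, hz2⟩ : ∃ z2, z = 8*z2+z0 := ⟨z/8, by omega⟩
    obtain ⟨c2, hc2⟩ : ∃ c2, y1 = 4*c2+c0 := ⟨y1/4, by omega⟩
    have hz0' : z0 % 2 = 1 := by omega
    have A1 := congrArg (Int.cast : ℤ → R K) hd
    push_cast at A1
    rw [ckZ] at hck
    refine direct_chk (T := TZ ((c0*3*z0) % 4 == 1)) (E1 := E1Z z0 c0 1) (E2 := E2Z z0 c0 1) hKl ?_ ?_ ?_ ⟨b^5*(x1:R K)*y1 + y1*(3*z)+3*z*(b*(x1:R K)), by ring⟩ hdv hne (by rfl) ?_ hck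
    · refine Cg.trans (y := evR (E1Z z y1 d)) ?_ (cg_of_c15 ?_)
      · have : (b^5*(x1:R K))+(b^4*(y1:R K))+(3*(z:R K)) = evR (E1Z z y1 d) := by
          rw [evR_def]; simp only [E1Z]; push_cast; linear_combination b^5*A1
        rw [this]; exact Cg.refl _ _
      · simp only [c15, E1Z, Bool.and_eq_true, beq_iff_eq]
        refine ⟨⟨⟨⟨⟨⟨?_, ?_⟩, ?_⟩, ?_⟩, ?_⟩, ?_⟩, ?_⟩ <;> omega
    · refine Cg.trans (y := evR (E2Z z y1 d)) ?_ (cg_of_c15 ?_)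
      · have : (b^5*(x1:R K))*(b^4*(y1:R K))+(b^4*(y1:R K))*(3*(z:R K))+(3*(z:R K))*(b^5*(x1:R K)) = evR (E2Z z y1 d) := by
          rw [evR_def]; simp only [E2Z]; push_cast
          linear_combination (b^9*y1+3*z*b^5)*A1 + 2*b^2*(d:R K)*y1*b7 (K := K)
        rw [this]; exact Cg.refl _ _
      · have e1 : 36*(d*y1) - 36*(1*c0) = 4*(9*(d*y1-c0)) := by ring
        have e2 : 3*(y1*z) - 3*(c0*z0) = 4*(3*(c2*z + 2*c0*z2)) := by rw [hz2, hc2]; ring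
        have e3 : 6*(z*d) - 6*(z0*1) = 4*(3*(z*d' + 4*z2)) := by rw [hd', hz2]; ring
        simp only [c15, E2Z, Bool.and_eq_true, beq_iff_eq]
        refine ⟨⟨⟨⟨⟨⟨?_, ?_⟩, ?_⟩, ?_⟩, ?_⟩, ?_⟩, ?_⟩ <;> omega
    · simp only [E1Z]; omega
    · rcases ((c0*3*z0) % 4 == 1) with _ | _
      · exact bZ2
      · exact bZ1
  · have hcy : (9*c*z-1) % 2 = 0 := by
      have : Odd (9*c*z) := ((show Odd (9:ℤ) by decide).mul hc).mul (Int.odd_iff.mpr hz)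
      have := Int.odd_iff.mp this
      omega
    have hcz : (3*c*z-1) % 2 = 0 := by
      have : Odd (3*c*z) := ((show Odd (3:ℤ) by decide).mul hc).mul (Int.odd_iff.mpr hz)
      have := Int.odd_iff.mp this
      omega
    obtain ⟨a, ha⟩ := Int.dvd_of_emod_eq_zero hcz
    obtain ⟨a', ha'⟩ : ∃ a', 3*z-1 = 2*a' := ⟨(3*z-1)/2, by omega⟩
    obtain ⟨x', hx'⟩ : ∃ x', x1 = 2*x' := ⟨2^(3*n+3)*d, by rw [hd]; ring⟩
    obtain ⟨y', hy'⟩ : ∃ y', y1 = 2*y' := ⟨2^n*c, by rw [e]; ring⟩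
    obtain ⟨x2, hx2⟩ : ∃ x2, x1 = 2^(n+1)*(2*x2) := ⟨2^(2*n+2)*d, by rw [hd]; ring⟩
    have A1 := two_cast (K := K) ha
    have A2 := two_cast (K := K) ha'
    have A3 := two_cast (K := K) hx'
    have A4 := two_cast (K := K) hy'
    have A5 := congrArg (Int.cast : ℤ → R K) e
    have A6 := congrArg (Int.cast : ℤ → R K) hx2
    push_cast at A1 A2 A5 A6
    refine cusp (n := n) (w := 3*b^4*(c:R K)*(z:R K) + b^9*(x1:R K)*(c:R K)+3*b^5*(z:R K)*(2*(x2:R K))) hKl ⟨η*(a'+b^5*x'+b^4*y'), ?_⟩ ?_ ⟨b^3*η*(a) + b*x1*c+3*b^4*η*z*x2, ?_⟩ hdv hne d001 c001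
    · linear_combination A2 + b^5*A3+b^4*A4
    · linear_combination (3*b^4*z+b^9*x1)*A5 + 3*z*b^5*A6
    · have : (evR k001 : R K) = b^4 := by rw [evR_def]; simp [k001]
      rw [this]
      linear_combination b^4*A1 + 3*b^5*z*x2*h2

end C2

namespace C2
open Polynomial Module NumberField

lemma q2ring {A : Type} [CommRing A] (b η σ ρ E1 E2 f1 f2 f3 n D e1 ε3 m: A) (h8 : b^8=0) (h7 : b^7=2) (h4 : (4:A)=0) (h2b : 2*b=0)
  (h9 : 9*η=1)
  (hρ : ρ = -1-2*σ) (hE1 : E1 = 9-b^6-3*b^2) (hE2 : E2 = -27-9*b^4+3*b^6) (hf1 : f1 = b^6*ρ+3*b^2)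
  (hf2 : f2 = 27+9*b^4*ρ+3*b^6*f3) (hf3 : f3 = -(1+ρ)+2*σ*ρ)
  (hn : n = 2*E1*f2*(E2+σ*f2) - E2^2*(E1*f3+f1+2*σ*f1*f3)) (he1 : e1 = E1+2*σ*f1) (hε : ε3 = 1+2*σ*f3)
  (hm : m = E2*f1+E1*f2+2*σ*f1*f2+E2*E1*f3)
  (hD : D = 5*(E2^2*e1*ε3+σ*n) - b^5*η*e1*E1*(E2*E1+σ*m)) :
    n = 2+2*σ+b^2+b^6 ∧ b^2*D = b^2+b^4*(1+σ)+b^7*(1+σ) := by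
  have c3 : f3 = 0 := by rw [hf3, hρ]; linear_combination -σ^2*h4
  have c1 : f1 = b^2+b^6 := by rw [hf1, hρ]; linear_combination (b-b^5-σ*b^5)*h2b
  have cE2 : E2 = 1+b^4+b^6 := by rw [hE2]; linear_combination -7*h4+(-5*b^3+b^5)*h2b
  have cE1 : E1 = 1+b^2+b^6 := by rw [hE1]; linear_combination 2*h4+(-2*b-b^5)*h2b
  have c2 : f2 = 3+b^4 := by rw [hf2, c3, hρ]; linear_combination 6*h4 + (-5*b^3-9*σ*b^3)*h2b
  have cη : η = 1 := by linear_combination h9 - 2*η*h4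
  have d1 : 2*E1 = 2 := by rw [cE1]; linear_combination (b+b^5)*h2b
  have d2 : 2*f2 = 2 := by rw [c2]; linear_combination h4+b^3*h2b
  have dE2 : 2*E2 = 2 := by rw [cE2]; linear_combination (b^3+b^5)*h2b
  have sE2 : E2^2 = 1 := by rw [cE2]; linear_combination (b^3+b^5+b^9)*h2b+(1+b^4)*h8
  have cn : n = 2+2*σ+b^2+b^6 := by
    rw [hn, c3]
    linear_combination f2*(E2+σ*f2)*d1+(E2+σ*f2)*d2+dE2+σ*d2-f1*sE2-c1-(b+b^5)*h2b
  refine ⟨cn, ?_⟩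
  have ce : e1 = E1 := by rw [he1, c1]; linear_combination σ*(b+b^5)*h2b
  have cε : ε3 = 1 := by rw [hε, c3]; ring
  have g1 : b^7*E1 = b^7 := by rw [cE1]; linear_combination (b+b^5)*h8
  have g2 : b^7*E2 = b^7 := by rw [cE2]; linear_combination (b^3+b^5)*h8
  have g3 : b^7*m = b^7 := by
    rw [hm, c3, c1, c2]
    linear_combination (b+b^5)*E2*h8+(3+b^4)*g1+b^3*h8+b^6*h2b+2*σ*(b+b^5)*(3+b^4)*h8
  have g4 : b^2*E1 = b^2+b^4 := by rw [cE1]; linear_combination h8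
  have g5 : b^2*n = b^4 := by rw [cn]; linear_combination (b+σ*b)*h2b+h8
  rw [hD, ce, cε, cη]
  linear_combination 5*b^2*E1*sE2+5*g4+5*σ*g5+(2*b+2*b^3+2*σ*b^3)*h2b - E1*(E2*E1+σ*m)*g1 - (E2*E1+σ*m)*g1-E1*g2-g1-σ*g3-(1+σ)*b^6*h2b

variable {K : Type} [Field K] [NumberField K] [KD K]
local notation "β" => (KD.b : K)
local notation "b" => (bR : R K)
local notation "η" => (eta : R K)

lemma chord {F : Type} [Field F] {x1 y1 x2 y2 θ : F} (h1 : y1^2 = x1^3+21*x1^2+112*x1) (h2 : y2^2 = x2^3+21*x2^2+112*x2)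
    (hθ : θ*(y1+y2) = x1-x2) (h0 : θ ≠ 0) (hy : y1+y2 ≠ 0) :
    ∃ x y : F, y^2 = x^3+21*x^2+112*x ∧ x*θ^2 = 1-θ^2*(21+x1+x2) := by
  have hx : x1 - x2 ≠ 0 := by rw [← hθ]; exact mul_ne_zero h0 hy
  obtain ⟨l, hl⟩ : ∃ l, θ*l = 1 := ⟨θ⁻¹, mul_inv_cancel₀ h0⟩
  have e2 : y2 = l*(x1-x2) - y1 := by linear_combination -(y1+y2)*hl + l*hθ
  refine ⟨l^2-21-x1-x2, l*(l^2-21-x1-x2-x1)+y1, ?_, ?_⟩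
  · apply mul_left_cancel₀ hx
    rw [e2] at h2
    linear_combination (l^2-21-x1-x2-x2)*h1 - (l^2-21-x1-x2-x1)*h2
  · linear_combination (θ*l+1)*hl

lemma pointR {e1 ε2 ε3 w v x y : R K}
    (hr : ε2^4+27*e1^5*ε3-135*b^2*e1^3*ε2*ε3+27*b^4*e1*ε2^2*ε3+5103*e1^2*b^8*ε3^2=0)
    (hw : 27*e1*ε3*w = 1) (hv : ε2*v = 1) (hx : x = -b^10*η^2*ε2^2*w) (hy : y = (5-b^5*η*e1^2*v)*x) :
    y^2 = x^3+21*x^2+112*x := by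
  have key : b^4*ε2^2*w-5*b^2*e1^2*ε2*w+e1^4*w+ε2^4*w^2+7*b^8 = 0 := by
    linear_combination w^2*hr - (b^4*ε2^2-5*b^2*e1^2*ε2+e1^4)*w*hw - 7*b^8*(27*e1*ε3*w+1)*hw
  have G : 4*x - 10*b^5*η*e1^2*v*x + b^10*η^2*e1^4*v^2*x - x^2 - 112 = 0 := by
    linear_combination -b^20*η^4*key + x*four_eq (K := K) + (b^14*η^2 - 10*b^5*η*e1^2*v + b^10*η^2*e1^4*v^2 - x + b^10*η^2*ε2^2*w)*hx
      + 10*b^15*η^3*e1^2*ε2*w*hv + 5*b^15*η^3*e1^2*ε2*w*two_eq (K := K) - b^20*η^4*e1^4*w*(ε2*v+1)*hv - 7*sixteen_eq (K := K)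
  rw [hy]
  linear_combination x*G

lemma hrR {y z : R K} (h : 3*y+4*y^3*z+z^3 = 0) {e1 ε2 ε3 : R K} (h1 : e1 = 9+b^6*y+3*b^2*z)
    (h2 : ε2 = 9*b^4*y+27*z+3*b^6*y*z) (h3 : ε3 = y*z) :
    ε2^4+27*e1^5*ε3-135*b^2*e1^3*ε2*ε3+27*b^4*e1*ε2^2*ε3+5103*e1^2*b^8*ε3^2=0 := by
  have hK : (9 : R K)^3*(b^6*y)+(b^6*y)^3*(3*b^2*z)+(3*b^2*z)^3*9 = 0 := by
    linear_combination 243*b^6*h + 3*b^6*y^3*z*(b^7+18)*b7 (K := K)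
  have b0 := bR_ne (K := K)
  apply mul_left_cancel₀ (pow_ne_zero 8 b0)
  rw [h1, h2, h3]
  linear_combination (9*(b^6*y)^3+(b^6*y)*(3*b^2*z)^3+(3*b^2*z)*9^3)*hK

lemma ex_quot (n : ℕ) : ∃ (A : Type) (_ : CommRing A) (φ : R K →+* A), ∀ x y : R K, Cg n x y ↔ φ x = φ y := by
  refine ⟨R K ⧸ Ideal.span {b^n}, inferInstance, Ideal.Quotient.mk _, ?_⟩
  intro x y
  rw [Ideal.Quotient.eq, Ideal.mem_span_singleton]; rfl

lemma q2cg {σ ρ E1 E2 f1 f2 f3 n D e1 ε3 m : R K} (hρ : Cg 8 ρ (-1-2*σ)) (hE1 : E1 = 9-b^6-3*b^2) (hE2 : E2 = -27-9*b^4+3*b^6) (hf1 : f1 = b^6*ρ+3*b^2)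
  (hf2 : f2 = 27+9*b^4*ρ+3*b^6*f3) (hf3 : f3 = -(1+ρ)+2*σ*ρ)
  (hn : n = 2*E1*f2*(E2+σ*f2) - E2^2*(E1*f3+f1+2*σ*f1*f3)) (he1 : e1 = E1+2*σ*f1) (hε : ε3 = 1+2*σ*f3)
  (hm : m = E2*f1+E1*f2+2*σ*f1*f2+E2*E1*f3)
  (hD : D = 5*(E2^2*e1*ε3+σ*n) - b^5*η*e1*E1*(E2*E1+σ*m)) :
    Cg 8 n (2+2*σ+b^2+b^6) ∧ Cg 8 (b^2*D) (b^2+b^4*(1+σ)+b^7*(1+σ)) := by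
  obtain ⟨A, _, φ, hφ⟩ := ex_quot (K := K) 8
  have h2 := two_eq (K := K)
  obtain ⟨q, hq⟩ := eta_one (K := K)
  have k8 : φ b^8 = 0 := by
    rw [← map_pow, ← map_zero φ, ← hφ]; exact ⟨1, by ring⟩
  have k7 : φ b^7 = 2 := by
    rw [← map_pow, ← map_ofNat φ, ← hφ]; exact ⟨-q, by linear_combination -h2 -b^7*hq⟩
  have k4 : (4 : A) = 0 := by
    rw [← map_ofNat φ, ← map_zero φ, ← hφ]; exact ⟨b^6*η^2, by linear_combination four_eq (K := K)⟩
  have k2 : 2*φ b = 0 := by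
    rw [← map_ofNat φ, ← map_mul, ← map_zero φ, ← hφ]; exact ⟨η, by linear_combination b*h2⟩
  have m2 : φ 2 = 2 := map_ofNat φ 2
  have m3 : φ 3 = 3 := map_ofNat φ 3
  have m5 : φ 5 = 5 := map_ofNat φ 5
  have m9 : φ 9 = 9 := map_ofNat φ 9
  have m27 : φ 27 = 27 := map_ofNat φ 27
  have k9 : 9*φ η = 1 := by
    have := congrArg φ (nine_eta (K := K))
    simpa [m2,m3,m5,m9,m27] using this
  have R := q2ring (φ b) (φ η) (φ σ) (φ ρ) (φ E1) (φ E2) (φ f1) (φ f2) (φ f3) (φ n) (φ D) (φ e1) (φ ε3) (φ m) k8 k7 k4 k2 k9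
    (by have := (hφ _ _).mp hρ; simpa [m2,m3,m5,m9,m27] using this) (by rw [hE1]; simp [m2,m3,m5,m9,m27]) (by rw [hE2]; simp [m2,m3,m5,m9,m27]) (by rw [hf1]; simp [m2,m3,m5,m9,m27]) (by rw [hf2]; simp [m2,m3,m5,m9,m27])
    (by rw [hf3]; simp [m2,m3,m5,m9,m27]) (by rw [hn]; simp [m2,m3,m5,m9,m27]) (by rw [he1]; simp [m2,m3,m5,m9,m27]) (by rw [hε]; simp [m2,m3,m5,m9,m27]) (by rw [hm]; simp [m2,m3,m5,m9,m27]) (by rw [hD]; simp [m2,m3,m5,m9,m27])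
  rw [hφ, hφ]
  simpa [m2,m3,m5,m9,m27] using R

lemma bQ2 : bad ⟨1,0,0,0,3,2,0⟩ = true := by decide +kernel
end C2

namespace C2
open Polynomial Module NumberField

variable {K : Type} [Field K] [NumberField K] [KD K]
local notation "β" => (KD.b : K)
local notation "b" => (bR : R K)
local notation "η" => (eta : R K)

lemma sum_even {x y : R K} (hx : IsUnit x) (hy : IsUnit y) : b ∣ x + y := by
  rw [unit_iff'] at hx hy
  have h2 : b ∣ (2 : R K) := ⟨b^6*η, by rw [two_eq]; ring⟩
  have := dvd_add (dvd_add hx hy) h2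
  convert this using 1; ring

/-- the two points have θ = σ n / D; integral data -/
lemma q2pts {σ ρ : R K} (hσ0 : σ ≠ 0)
    (hW : ρ*(9-24*σ*ρ+16*σ^2*ρ^2-8*σ*(4*σ^2*ρ^2-6*σ*ρ+3)) = -(1+6*σ-4*σ^2)) :
    ∃ n d s : R K, Cg 8 n (2+2*σ+b^2+b^6) ∧ IsUnit d ∧ (∃ D, D*d = 1 ∧ Cg 8 (b^2*D) (b^2+b^4*(1+σ)+b^7*(1+σ))) ∧ b^11 ∣ s ∧
      (n ≠ 0 → ∃ x y : K, y^2 = x^3+21*x^2+112*x ∧ x*((σ*n*d : R K) : K)^2 = ((1 - (σ*n*d)^2*(21+s) : R K) : K)) := by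
  obtain ⟨E1, hE1⟩ : ∃ E1, E1 = 9-b^6-3*b^2 := ⟨_, rfl⟩
  obtain ⟨E2, hE2⟩ : ∃ E2, E2 = -27-9*b^4+3*b^6 := ⟨_, rfl⟩
  obtain ⟨f3, hf3⟩ : ∃ f3, f3 = -(1+ρ)+2*σ*ρ := ⟨_, rfl⟩
  obtain ⟨f1, hf1⟩ : ∃ f1, f1 = b^6*ρ+3*b^2 := ⟨_, rfl⟩
  obtain ⟨f2, hf2⟩ : ∃ f2, f2 = 27+9*b^4*ρ+3*b^6*f3 := ⟨_, rfl⟩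
  obtain ⟨n, hn⟩ : ∃ n, n = 2*E1*f2*(E2+σ*f2) - E2^2*(E1*f3+f1+2*σ*f1*f3) := ⟨_, rfl⟩
  obtain ⟨e1, he1⟩ : ∃ e1, e1 = E1+2*σ*f1 := ⟨_, rfl⟩
  obtain ⟨ε3, hε3⟩ : ∃ ε3, ε3 = 1+2*σ*f3 := ⟨_, rfl⟩
  obtain ⟨ε2, hε2⟩ : ∃ ε2, ε2 = E2+2*σ*f2 := ⟨_, rfl⟩
  obtain ⟨m, hm⟩ : ∃ m, m = E2*f1+E1*f2+2*σ*f1*f2+E2*E1*f3 := ⟨_, rfl⟩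
  obtain ⟨D, hD⟩ : ∃ D, D = 5*(E2^2*e1*ε3+σ*n) - b^5*η*e1*E1*(E2*E1+σ*m) := ⟨_, rfl⟩
  have h2 := two_eq (K := K)
  have h4 := four_eq (K := K)
  have hρ : Cg 8 ρ (-1-2*σ) := by
    refine ⟨b^6*η^2*(-2*ρ-σ+σ^2+ρ*(6*σ*ρ-4*σ^2*ρ^2+2*σ*(4*σ^2*ρ^2-6*σ*ρ+3))), ?_⟩
    linear_combination hW+(-2*ρ-σ+σ^2+ρ*(6*σ*ρ-4*σ^2*ρ^2+2*σ*(4*σ^2*ρ^2-6*σ*ρ+3)))*h4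
  obtain ⟨cn, cD⟩ := q2cg hρ hE1 hE2 hf1 hf2 hf3 hn he1 hε3 hm hD
  have uE1 : IsUnit E1 := unit_of _ ⟨b^6*η*4-b^5-3*b, by rw [hE1]; linear_combination 4*h2⟩
  have uE2 : IsUnit E2 := unit_of _ ⟨-b^6*η*14-9*b^3+3*b^5, by rw [hE2]; linear_combination -14*h2⟩
  have ue1 : IsUnit e1 := by
    rw [unit_iff'] at uE1 ⊢
    obtain ⟨q, hq⟩ := uE1
    exact ⟨q+b^6*η*σ*f1, by rw [he1]; linear_combination hq+σ*f1*h2⟩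
  have uε2 : IsUnit ε2 := by
    rw [unit_iff'] at uE2 ⊢
    obtain ⟨q, hq⟩ := uE2
    exact ⟨q+b^6*η*σ*f2, by rw [hε2]; linear_combination hq+σ*f2*h2⟩
  have uε3 : IsUnit ε3 := unit_of _ ⟨b^6*η*σ*f3, by rw [hε3]; linear_combination σ*f3*h2⟩
  have u27 : IsUnit (27 : R K) := unit_of _ ⟨b^6*η*13, by linear_combination 13*h2⟩
  have uD : IsUnit D := by
    obtain ⟨q, hq⟩ := cD
    apply unit_of
    refine ⟨b*(1+σ)+b^4*(1+σ)+b^5*q, ?_⟩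
    apply mul_left_cancel₀ (pow_ne_zero 2 (bR_ne (K := K)))
    linear_combination hq
  obtain ⟨d, hd⟩ := uD.exists_right_inv
  obtain ⟨v1, hv1⟩ := uε2.exists_right_inv
  obtain ⟨v2, hv2⟩ := uE2.exists_right_inv
  have uA := (u27.mul ue1).mul uε3
  have uB := u27.mul uE1
  obtain ⟨w1, hw1⟩ := uA.exists_right_inv
  obtain ⟨w2, hw2⟩ := uB.exists_right_inv
  have uw1 : IsUnit w1 := IsUnit.of_mul_eq_one (27*e1*ε3) (by rw [mul_comm]; exact hw1)
  have uw2 : IsUnit w2 := IsUnit.of_mul_eq_one (27*E1) (by rw [mul_comm]; exact hw2)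
  have hC : 3*(-1+2*σ*ρ)+4*(-1+2*σ*ρ)^3*(-1+2*σ)+(-1+2*σ)^3 = 0 := by
    linear_combination -2*σ*hW
  have r1 := hrR hC (e1 := e1) (ε2 := ε2) (ε3 := ε3) (by rw [he1, hE1, hf1]; ring) (by rw [hε2, hE2, hf2, hf3]; ring) (by rw [hε3, hf3]; ring)
  have r2 := hrR (K := K) (y := -1) (z := -1) (by norm_num) (e1 := E1) (ε2 := E2) (ε3 := 1) (by rw [hE1]; ring) (by rw [hE2]; ring) (by ring)
  obtain ⟨x1, hx1⟩ : ∃ x1, x1 = -b^10*η^2*ε2^2*w1 := ⟨_, rfl⟩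
  obtain ⟨y1, hy1⟩ : ∃ y1, y1 = (5-b^5*η*e1^2*v1)*x1 := ⟨_, rfl⟩
  obtain ⟨x2, hx2⟩ : ∃ x2, x2 = -b^10*η^2*E2^2*w2 := ⟨_, rfl⟩
  obtain ⟨y2, hy2⟩ : ∃ y2, y2 = (5-b^5*η*E1^2*v2)*x2 := ⟨_, rfl⟩
  have p1 := pointR r1 hw1 hv1 hx1 hy1
  have p2 := pointR r2 (by rw [mul_one]; exact hw2) hv2 hx2 hy2
  have n2 : ε2^2*E1 - E2^2*e1*ε3 = 2*(σ*n) := by rw [hε2, hε3, he1, hn]; ring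
  have n3 : 5*(ε2^2*E1+E2^2*e1*ε3) - b^5*η*e1*E1*(e1*ε2+E1*E2*ε3) = 2*D := by
    have n4 : e1*ε2+E1*E2*ε3 = 2*(E2*E1+σ*m) := by rw [hε2, hε3, he1, hm]; ring
    rw [n4, hD]; linear_combination 5*n2
  have dx : x1 - x2 = -b^10*η^2*w1*w2*54*(σ*n) := by
    rw [hx1, hx2]
    linear_combination -b^10*η^2*27*w1*w2*n2 + b^10*η^2*ε2^2*w1*hw2 - b^10*η^2*E2^2*w2*hw1
  have sy : y1 + y2 = -b^10*η^2*w1*w2*54*D := by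
    rw [hy1, hy2, hx1, hx2]
    linear_combination -b^10*η^2*27*w1*w2*n3 +5*b^10*η^2*(ε2^2*w1*hw2+E2^2*w2*hw1) - b^15*η^3*(e1^2*ε2*w1*hw2+E1^2*E2*w2*hw1) + b^15*η^3*(e1^2*ε2*w1*hv1 + E1^2*E2*w2*hv2)
  have b0 := bR_ne (K := K)
  have uη : IsUnit η := IsUnit.of_mul_eq_one 9 (by rw [mul_comm]; exact nine_eta)
  have n54 : (54 : R K) ≠ 0 := by have := int_ne (K := K) (n := 54) (by norm_num); simpa using this
  have sy0 : y1 + y2 ≠ 0 := by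
    rw [sy]
    have := mul_ne_zero (mul_ne_zero (mul_ne_zero (mul_ne_zero (mul_ne_zero (pow_ne_zero 10 b0) (pow_ne_zero 2 uη.ne_zero)) uw1.ne_zero) uw2.ne_zero) n54) uD.ne_zero
    intro h; apply this; linear_combination -h
  refine ⟨n, d, x1+x2, cn, IsUnit.of_mul_eq_one D (by rw [mul_comm]; exact hd), ⟨D, hd, cD⟩, ?_, ?_⟩
  · obtain ⟨q, hq⟩ := sum_even ((uε2.pow 2).mul uw1) ((uE2.pow 2).mul uw2)
    exact ⟨-η^2*q, by rw [hx1, hx2]; linear_combination -b^10*η^2*hq⟩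
  · intro hn0
    have hud : d ≠ 0 := by rintro rfl; simp at hd
    have hθ0 : σ*n*d ≠ 0 := mul_ne_zero (mul_ne_zero hσ0 hn0) hud
    have hθ : (σ*n*d)*(y1+y2) = x1 - x2 := by
      rw [sy, dx]; linear_combination -b^10*η^2*w1*w2*54*(σ*n)*hd
    have q1 := congrArg Subtype.val p1
    have q2 := congrArg Subtype.val p2
    have q3 := congrArg Subtype.val hθ
    push_cast at q1 q2 q3
    obtain ⟨x, y, hxy, hx⟩ := chord (x1 := (x1 : K)) (y1 := y1) (x2 := x2) (y2 := y2) (θ := ((σ*n*d : R K) : K)) q1 q2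
      (by push_cast; exact q3) (coe_ne hθ0) (by have := coe_ne sy0; push_cast at this; exact this)
    refine ⟨x, y, hxy, ?_⟩
    rw [hx]; push_cast
    change _ = 1 - _ * (21 + _)
    ring

end C2

namespace C2
open Polynomial Module NumberField

variable {K : Type} [Field K] [NumberField K] [KD K]
local notation "β" => (KD.b : K)
local notation "b" => (bR : R K)
local notation "η" => (eta : R K)

lemma ne_of_b2 {n r : R K} (h : n = b^2*(1+b*r)) : n ≠ 0 := by
  rw [h]
  exact mul_ne_zero (pow_ne_zero 2 bR_ne) (unit_of (1+b*r) ⟨r, by ring⟩).ne_zero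

lemma nearQ2a {σ ρ o : R K} {j : ℕ} (hσ : σ = 2^(j+1)*o) (ho : b^7 ∣ o - 1) (hσ0 : σ ≠ 0)
    (hW : ρ*(9-24*σ*ρ+16*σ^2*ρ^2-8*σ*(4*σ^2*ρ^2-6*σ*ρ+3)) = -(1+6*σ-4*σ^2)) (_hK : β ≠ 0) : False := by
  obtain ⟨n, d, s, ⟨q, hn⟩, hd, ⟨D, hDd, q', hD⟩, ⟨s', hs⟩, H⟩ := q2pts hσ0 hW
  have h2 := two_eq (K := K)
  have h4 := four_eq (K := K)
  obtain ⟨e, he⟩ := eta_one (K := K)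
  obtain ⟨o', ho'⟩ := ho
  have hσ2 : σ = b^7*(η*2^j*o) := by rw [hσ, pow_succ]; linear_combination 2^j*o*h2
  have n1 : n = b^2*(1+b*(b^4*η*(1+σ)+b^3+b^5*q)) := by linear_combination hn+(1+σ)*h2
  obtain ⟨x, y, hxy, hx⟩ := H (ne_of_b2 n1)
  have hnd : Cg 8 (n*d) (b^2+b^4) := by
    obtain ⟨r, hr⟩ : b^8 ∣ n - (b^2+b^4)*D := by
      refine ⟨q - (1+b^2)*q' + e - b^3*η - b + b^6*η*(η*2^j*o) - (1+b^2)*(b^3+b^6)*(η*2^j*o), ?_⟩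
      linear_combination hn - (1+b^2)*hD + (2-(1+b^2)*(b^4+b^7))*hσ2 + (1-b^4+b^7*(η*2^j*o))*h2 + b^7*he
    exact ⟨r*d, by linear_combination d*hr + (b^2+b^4)*hDd⟩
  obtain ⟨r, hr⟩ := hnd
  obtain ⟨κ1, hκ1⟩ : ∃ κ1, o*(n*d) = b*κ1 := ⟨o*(b*(1+b*(b^4*η*(1+σ)+b^3+b^5*q)))*d, by rw [n1]; ring⟩
  refine SX (x := x) (y := y) (u := 1 - (σ*n*d)^2*(21+s)) (κ := o*(n*d)) (j := j) c011 hxy ?_ ?_ ?_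
  · have e : 2^(j+1)*(o*(n*d)) = σ*n*d := by rw [hσ]; ring
    rw [e]; exact hx
  · have : σ*n*d = b^8*(η*2^j*κ1) := by
      have : σ*n*d = 2^(j+1)*(o*(n*d)) := by rw [hσ]; ring
      rw [this, hκ1, pow_succ]; linear_combination 2^j*b*κ1*h2
    rw [this]
    exact ⟨-b*(η*2^j*κ1)^2*(21+s), by ring⟩
  · refine ⟨r + o'*(b*(1+b*(b^4*η*(1+σ)+b^3+b^5*q)))*d, ?_⟩
    rw [evR_def]; simp only [k011]; push_cast
    linear_combination hr + n*d*ho' + b^7*o'*d*n1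

lemma nearQ2b {σ ρ : R K} (hσ : b^7 ∣ σ - 1)
    (hW : ρ*(9-24*σ*ρ+16*σ^2*ρ^2-8*σ*(4*σ^2*ρ^2-6*σ*ρ+3)) = -(1+6*σ-4*σ^2)) (_hK : β ≠ 0) : False := by
  obtain ⟨t, ht⟩ := hσ
  have hσu : IsUnit σ := unit_of _ ⟨b^6*t, by rw [ht]; ring⟩
  obtain ⟨n, d, s, ⟨q, hn⟩, hd, ⟨D, hDd, q', hD⟩, ⟨s', hs⟩, H⟩ := q2pts hσu.ne_zero hW
  have h2 := two_eq (K := K)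
  have h4 := four_eq (K := K)
  have b0 := bR_ne (K := K)
  have n1 : n = b^2*(1+b*(b^4*η*(1+σ)+b^3+b^5*q)) := by linear_combination hn+(1+σ)*h2
  have hn0 := ne_of_b2 n1
  obtain ⟨x, y, hxy, hx⟩ := H hn0
  have e1 : σ = 1+b^7*t := by linear_combination ht
  have n2 : n = b^2+b^6+b^8*(b^6*η*(η+t)+q) := by
    linear_combination hn + 2*e1 + h4 + b^7*t*h2
  obtain ⟨p, hp⟩ : ∃ p, D = 1 + b^6*p := by
    refine ⟨b^3*η+b^3*t+b^6*η + b^6*t+q' , ?_⟩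
    apply mul_left_cancel₀ (pow_ne_zero 2 b0)
    linear_combination hD + (b^4+b^7)*e1 + (b^4+b^7)*h2
  obtain ⟨r, hr⟩ : ∃ r, σ*n*d = b^2+b^6+b^8*r := by
    refine ⟨(b^6*η*(η+t)+q)-p*d*(1+b^4+b^6*(b^6*η*(η+t)+q)) + b*t*(1+b*(b^4*η*(1+σ)+b^3+b^5*q))*d, ?_⟩
    have hd1 : d = 1 - b^6*p*d := by linear_combination hDd - d*hp
    have : n*d = b^2+b^6+b^8*((b^6*η*(η+t)+q)-p*d*(1+b^4+b^6*(b^6*η*(η+t)+q))) := by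
      linear_combination n*hd1 + (1-b^6*p*d)*n2
    linear_combination this + n*d*e1 + b^7*t*d*n1
  have hθ0 : ((σ*n*d : R K) : K) ≠ 0 := coe_ne (mul_ne_zero (mul_ne_zero hσu.ne_zero hn0) hd.ne_zero)
  refine K1 (T := ⟨1,0,0,0,3,2,0⟩) (x := x) (y := y) (h := ((σ*n*d : R K) : K)⁻¹) (u := 1 - (σ*n*d)^2*(21+s)) rfl bQ2 (inv_ne_zero hθ0) hxy ?_ ?_
  · rw [← hx]; field_simp
  · rw [hr, hs, evR_def]; push_cast
    refine ⟨-(1+b^4+b^6*r)^2*s' - 21*η-21*b*r^2-21*b^2*η*r*(1+b^4) - 6*b^3*η^2 - 95*b^4*η^2, ?_⟩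
    linear_combination (-21*b^8-21*b^10*r*(1+b^4))*h2 - 21*b^5*b7 (K := K) - (6*b^4+95*b^5)*h4

lemma caseQ2 {x y z : ℤ} (h : 3*x^3*y+y^3*z+2*z^3*x = 0) (hx : x % 2 = 1) (hy : y % 2 = 0) (hz : z % 2 = 1)
    (hne : z + x ≠ 0) (_hK : β ≠ 0) : False := by
  obtain ⟨y1, rfl⟩ := Int.dvd_of_emod_eq_zero hy
  obtain ⟨m, hm⟩ : ∃ m, z + x = 2*m := ⟨(z+x)/2, by omega⟩
  have hm0 : m ≠ 0 := by omega
  have h1 : 3*x^3*y1+4*y1^3*z+z^3*x = 0 := by linarith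
  have hxu : IsUnit (x : R K) := odd_unit (Int.odd_iff.mpr hx)
  obtain ⟨i, hi⟩ := hxu.exists_right_inv
  have A := congrArg (Int.cast : ℤ → R K) h1
  have Am := congrArg (Int.cast : ℤ → R K) hm
  push_cast at A Am
  obtain ⟨σ, hσ⟩ : ∃ σ : R K, σ = m*i := ⟨_, rfl⟩
  obtain ⟨τ, hτ⟩ : ∃ τ : R K, τ = 1 + y1*i := ⟨_, rfl⟩
  have hz' : (z:R K)*i = -1+2*σ := by rw [hσ]; linear_combination i*Am - hi
  have hy' : (y1:R K)*i = -1+τ := by rw [hτ]; ring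
  have B : 3*(-1+τ)+4*(-1+τ)^3*(-1+2*σ)+(-1+2*σ)^3 = 0 := by
    rw [← hz', ← hy']
    have i3 : ((x:R K)*i)^3 = 1 := by rw [hi]; ring
    linear_combination i^4*A - 3*(y1:R K)*i*i3 - (z:R K)^3*i^3*hi
  have h2 := two_eq (K := K)
  have hU : IsUnit (9-12*τ+4*τ^2-8*σ*(τ^2-3*τ+3)) := by
    apply unit_of
    exact ⟨b^6*η*(4-6*τ+2*τ^2-4*σ*(τ^2-3*τ+3)), by linear_combination (4-6*τ+2*τ^2-4*σ*(τ^2-3*τ+3))*h2⟩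
  obtain ⟨u, hu⟩ := hU.exists_right_inv
  obtain ⟨ρ, hρ⟩ : ∃ ρ : R K, ρ = -(1+6*σ-4*σ^2)*u := ⟨_, rfl⟩
  have hτρ : τ = 2*σ*ρ := by
    rw [hρ]
    linear_combination -u*B - τ*hu
  have hσ0 : σ ≠ 0 := by
    rw [hσ]; exact mul_ne_zero (int_ne hm0) (by rintro rfl; simp at hi)
  have hW : ρ*(9-24*σ*ρ+16*σ^2*ρ^2-8*σ*(4*σ^2*ρ^2-6*σ*ρ+3)) = -(1+6*σ-4*σ^2) := by
    have : ρ*(9-12*τ+4*τ^2-8*σ*(τ^2-3*τ+3)) = -(1+6*σ-4*σ^2) := by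
      rw [hρ]; linear_combination -(1+6*σ-4*σ^2)*hu
    rw [hτρ] at this
    linear_combination this
  obtain ⟨k, c, hc, e⟩ := ex_two_odd hm0
  have hci : b^7 ∣ (c:R K)*i - 1 := by
    obtain ⟨c', hc'⟩ : ∃ c', c - x = 2*c' := ⟨(c-x)/2, by have := Int.odd_iff.mp hc; omega⟩
    have := congrArg (Int.cast : ℤ → R K) hc'
    push_cast at this
    exact ⟨η*c'*i, by linear_combination i*this + hi + c'*i*h2⟩
  rcases k with _ | j
  · refine nearQ2b (K := K) (σ := σ) (ρ := ρ) ?_ hW _hK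
    rw [hσ, e]; push_cast; simpa using hci
  · refine nearQ2a (K := K) (σ := σ) (ρ := ρ) (o := c*i) (j := j) ?_ hci hσ0 hW _hK
    rw [hσ, e]; push_cast; ring
end C2

namespace C2
open Polynomial Module NumberField

variable {K : Type} [Field K] [NumberField K] [KD K]
local notation "β" => (KD.b : K)
local notation "b" => (bR : R K)
local notation "η" => (eta : R K)

def V.rd (c : V) : V := ⟨c.a0 % 16, c.a1 % 8, c.a2 % 8, c.a3 % 8, c.a4 % 8, c.a5 % 8, c.a6 % 8⟩
def c22 (c d : V) : Bool := decide (c.rd = d.rd)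
def Rp (x : R K) (X : V) : Prop := Cg 22 x (evR X)

lemma eight_dvd' (n : ℤ) (h : n % 8 = 0) : ∃ q : R K, (n : R K) = b^21*q := by
  obtain ⟨m, rfl⟩ := Int.dvd_of_emod_eq_zero h
  exact ⟨η^3*m, by push_cast; linear_combination (m : R K)*eight_eq (K := K)⟩
lemma sixteen_dvd' (n : ℤ) (h : n % 16 = 0) : ∃ q : R K, (n : R K) = b^22*q := by
  obtain ⟨m, rfl⟩ := Int.dvd_of_emod_eq_zero h
  exact ⟨b^6*η^4*m, by push_cast; linear_combination (m : R K)*sixteen_eq (K := K)⟩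

lemma cg_of_c22 {c d : V} (h : c22 c d = true) : Cg 22 (evR c : R K) (evR d) := by
  simp only [c22, decide_eq_true_eq, V.rd, V.mk.injEq] at h
  obtain ⟨h0, h1, h2, h3, h4, h5, h6⟩ := h
  obtain ⟨q0, e0⟩ := sixteen_dvd' (K := K) (c.a0 - d.a0) (by omega)
  obtain ⟨q1, e1⟩ := eight_dvd' (K := K) (c.a1-d.a1) (by omega)
  obtain ⟨q2, e2⟩ := eight_dvd' (K := K) (c.a2-d.a2) (by omega)
  obtain ⟨q3, e3⟩ := eight_dvd' (K := K) (c.a3-d.a3) (by omega)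
  obtain ⟨q4, e4⟩ := eight_dvd' (K := K) (c.a4-d.a4) (by omega)
  obtain ⟨q5, e5⟩ := eight_dvd' (K := K) (c.a5-d.a5) (by omega)
  obtain ⟨q6, e6⟩ := eight_dvd' (K := K) (c.a6-d.a6) (by omega)
  push_cast at e0 e1 e2 e3 e4 e5 e6
  refine ⟨q0 + q1 + b * q2 + b^2*q3 + b^3*q4 + b^4*q5+b^5*q6, ?_⟩
  rw [evR_def, evR_def]
  linear_combination e0 + b * e1 + b^2*e2+b^3*e3+b^4*e4+b^5*e5+b^6*e6

lemma c22_rd (c : V) : c22 c c.rd = true := by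
  simp only [c22, decide_eq_true_eq, V.rd, V.mk.injEq]; omega

lemma Rp.to {x : R K} {X Y : V} (h : Rp x X) (hc : c22 X Y = true) : Rp x Y := Cg.trans h (cg_of_c22 hc)
lemma Rp.rd {x : R K} {X : V} (h : Rp x X) : Rp x X.rd := h.to (c22_rd X)
def V.pw (X : V) : ℕ → V
  | 0 => V.C 1
  | n+1 => ((V.pw X n).mul X).rd

lemma Rp.mul {x y : R K} {X Y : V} (h : Rp x X) (h' : Rp y Y) : Rp (x*y) (X.mul Y).rd := by
  apply Rp.rd; unfold Rp; rw [evR_mul]; exact Cg.mul h h'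
lemma Rp.add {x y : R K} {X Y : V} (h : Rp x X) (h' : Rp y Y) : Rp (x+y) (X.add Y).rd := by
  apply Rp.rd; unfold Rp; rw [evR_add]; exact Cg.add h h'
lemma Rp.sub {x y : R K} {X Y : V} (h : Rp x X) (h' : Rp y Y) : Rp (x-y) (X.sub Y).rd := by
  apply Rp.rd; unfold Rp; rw [evR_sub]
  have := dvd_sub h h'
  unfold Cg
  convert this using 1; ring
lemma Rp.int (n : ℤ) : Rp (n : R K) (V.C n) := by
  unfold Rp; rw [evR_C]; exact Cg.refl _ _
lemma Rp.num (n : ℕ) [n.AtLeastTwo] : Rp (OfNat.ofNat n : R K) (V.C (OfNat.ofNat n)) := by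
  have := Rp.int (K := K) (OfNat.ofNat n)
  push_cast at this; exact this
lemma Rp.one : Rp (1 : R K) (V.C 1) := by
  have := Rp.int (K := K) 1
  push_cast at this; exact this
lemma Rp.neg {x : R K} {X : V} (h : Rp x X) : Rp (-x) ((V.C (-1)).mul X).rd := by
  have := (Rp.int (-1)).mul h
  convert this using 1; push_cast; ring
lemma Rp.pow {x : R K} {X : V} (h : Rp x X) (n : ℕ) : Rp (x^n) (X.pw n) := by
  induction n with
  | zero => rw [pow_zero]; exact Rp.one
  | succ n ih => rw [pow_succ]; exact ih.mul h
lemma Rp.b : Rp (b) ⟨0,1,0,0,0,0,0⟩ := by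
  unfold Rp; rw [evR_def]; push_cast; exact ⟨0, by ring⟩
lemma Rp.inv {x y : R K} {X Y : V} (h : Rp x X) (h' : x*y = 1) (hc : c22 (X.mul Y) (V.C 1) = true) : Rp y Y := by
  obtain ⟨q, hq⟩ := h
  obtain ⟨r, hr⟩ := cg_of_c22 (K := K) hc
  rw [evR_mul, evR_C] at hr
  push_cast at hr
  exact ⟨-y*(r + q*evR Y), by linear_combination (-y*evR Y)*hq -y*hr + evR Y*h'⟩
lemma Rp.div {x y e : R K} {X Y E : V} (h : Rp x X) (h' : Rp y Y) {d : R K} (hd : y*d = 1) (he : e = x*d)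
    (hc : c22 X (E.mul Y) = true) : Rp e E := by
  obtain ⟨q, hq⟩ := h
  obtain ⟨p, hp⟩ := h'
  obtain ⟨r, hr⟩ := cg_of_c22 (K := K) hc
  rw [evR_mul] at hr
  exact ⟨d*(q+r-evR E*p), by rw [he]; linear_combination d*hq+d*hr-d*evR E*hp + evR E*hd⟩
lemma Rp.eta : Rp η (V.C 57) := (Rp.num 9).inv nine_eta (by decide +kernel)
lemma Rp.unit {x : R K} {X : V} (h : Rp x X) (hX : X.a0 % 2 = 1) : IsUnit x := unit_cg (by norm_num) h (ev_unit hX)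

end C2

namespace C2
open Polynomial Module NumberField

variable {K : Type} [Field K] [NumberField K] [KD K]
local notation "β" => (KD.b : K)
local notation "b" => (bR : R K)
local notation "η" => (eta : R K)

lemma hrR1 {x z : R K} (h : 3*x^3+z+2*z^3*x = 0) {e1 ε2 ε3 : R K} (h1 : e1 = 3+3*b*x+b^3*z)
    (h2 : ε2 = 9*x+3*b^2*z+3*b^3*(x*z)) (h3 : ε3 = x*z) :
    ε2^4+9*e1^5*ε3-45*b*e1^3*ε2*ε3+9*b^2*e1*ε2^2*ε3+567*b^4*e1^2*ε3^2=0 := by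
  have hK : (3*b*x)^3*3+3^3*(b^3*z)+(b^3*z)^3*(3*b*x) = 0 := by
    linear_combination 27*b^3*h + 3*b^3*z^3*x*b7 (K := K)
  have b0 := bR_ne (K := K)
  apply mul_left_cancel₀ (pow_ne_zero 4 b0)
  rw [h1, h2, h3]
  linear_combination ((3*b*x)*3^3+3*(b^3*z)^3+(b^3*z)*(3*b*x)^3)*hK

lemma pt1 {e1 ε2 ε3 w xt yt Y : R K}
    (hr : ε2^4+9*e1^5*ε3-45*b*e1^3*ε2*ε3+9*b^2*e1*ε2^2*ε3+567*b^4*e1^2*ε3^2=0)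
    (hw : 9*e1*ε3*w = 1) (hx : xt = -(ε2^2*w)) (hy : yt = e1^2*ε2*w) (hY : Y = 5*xt+b^6*η*yt) :
    Y^2 = b^12*η^2*xt^3+21*xt^2+7*b^16*η^2*xt := by
  have key : ε2^4*w^2+e1^4*w-5*b*e1^2*ε2*w+b^2*ε2^2*w+7*b^4 = 0 := by
    linear_combination w^2*hr - (e1^4-5*b*e1^2*ε2+b^2*ε2^2)*w*hw - 7*b^4*(9*e1*ε3*w+1)*hw
  rw [hY, hx, hy]
  linear_combination (b^12*η^2*ε2^2*w)*key + ε2^4*w^2*four_eq (K := K) - 5*b^6*η*e1^2*ε2^3*w^2*two_eq (K := K)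

/-- projective Jacobi quartic -/
def JP (a p r : R K) : Prop := r^2 = a^4+21*a^2*p^2+112*p^4

lemma JP.dbl {a p r : R K} (h : JP a p r) :
    JP (a^4-112*p^4) (2*p*a*r) (a^8+42*a^6*p^2+672*a^4*p^4+4704*a^2*p^6+12544*p^8) := by
  unfold JP at *
  have h4 : r^4 = (a^4+21*a^2*p^2+112*p^4)^2 := by rw [← h]; ring
  linear_combination -84*(a^4-112*p^4)^2*p^2*a^2*h - 1792*p^4*a^4*h4

lemma JP.cancel {a p r c a1 p1 r1 : R K} (h : JP a p r) (hc : c ≠ 0) (ha : a = c*a1) (hp : p = c*p1) (hr : r = c^2*r1) :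
    JP a1 p1 r1 := by
  unfold JP at *
  apply mul_left_cancel₀ (pow_ne_zero 4 hc)
  rw [ha, hp, hr] at h
  linear_combination h

lemma JP.norm {a p r i : R K} (h : JP a p r) (hi : a*i = 1) : JP 1 (p*i) (r*i^2) := by
  unfold JP at *
  have i2 : (a*i)^2 = 1 := by rw [hi]; ring
  have i4 : (a*i)^4 = 1 := by rw [hi]; ring
  linear_combination i^4*h + i4+21*p^2*i^2*i2

lemma JE {x y : R K} (h : y^2 = x^3+21*x^2+112*x) : JP (x^2-112) (2*y) (x^4+42*x^3+672*x^2+4704*x+12544) := by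
  unfold JP
  have h4 : y^4 = (x^3+21*x^2+112*x)^2 := by rw [← h]; ring
  linear_combination -84*(x^2-112)^2*h - 1792*h4

lemma JP.neg {a p r : R K} (h : JP a p r) : JP a (-p) r := by
  unfold JP at *; linear_combination h

/-- 8g as a Jacobi point -/
lemma B8 : ∃ θ ω : R K, JP 1 θ ω ∧ Rp θ ⟨12,3,2,6,1,1,6⟩ ∧ Rp ω ⟨13,1,4,2,2,5,4⟩ := by
  obtain ⟨E1, hE1⟩ : ∃ E1, E1 = 3+3*b-b^3 := ⟨_, rfl⟩
  obtain ⟨E2, hE2⟩ : ∃ E2, E2 = 9-3*b^2-3*b^3 := ⟨_, rfl⟩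
  have RE1 : Rp E1 ⟨3,3,0,7,0,0,0⟩ := by
    rw [hE1]
    exact ((((Rp.num 3).add ((Rp.num 3).mul Rp.b)).sub (Rp.b.pow 3))).to (by decide +kernel)
  have RE2 : Rp E2 ⟨9,0,5,5,0,0,0⟩ := by
    rw [hE2]
    exact ((((Rp.num 9).sub ((Rp.num 3).mul (Rp.b.pow 2))).sub ((Rp.num 3).mul (Rp.b.pow 3)))).to (by decide +kernel)
  have uw : IsUnit (9*E1*(-1)) := ((((Rp.num 9).mul RE1).mul Rp.one.neg)).unit (by decide +kernel)
  obtain ⟨w, hw⟩ := uw.exists_right_inv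
  obtain ⟨xt, hxt⟩ : ∃ xt, xt = -(E2^2*w) := ⟨_, rfl⟩
  obtain ⟨Y, hY⟩ : ∃ Y, Y = 5*xt+b^6*η*(E1^2*E2*w) := ⟨_, rfl⟩
  obtain ⟨δ, hδ⟩ : ∃ δ, δ = xt^2-7*b^4 := ⟨_, rfl⟩
  obtain ⟨ρ1, hρ1⟩ : ∃ ρ1, ρ1 = 21*η*xt^3+b^5*η^2*xt^4+21*b^16*η^3*xt^2+147*b^4*η*xt+49*b^13*η^2 := ⟨_, rfl⟩
  obtain ⟨δ2, hδ2⟩ : ∃ δ2, δ2 = δ^4-7*b^8*Y^4 := ⟨_, rfl⟩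
  obtain ⟨p2, hp2⟩ : ∃ p2, p2 = Y*δ*ρ1 := ⟨_, rfl⟩
  obtain ⟨ρ2, hρ2⟩ : ∃ ρ2, ρ2 = b^3*η^4*δ^8+21*η^3*δ^6*Y^2+21*b^18*η^5*δ^4*Y^4+147*b^8*η^3*δ^2*Y^6+49*b^19*η^4*Y^8 := ⟨_, rfl⟩
  obtain ⟨δ3, hδ3⟩ : ∃ δ3, δ3 = η^4*δ2^4-7*b^16*p2^4 := ⟨_, rfl⟩
  have Rw : Rp w ⟨7,1,3,2,1,0,6⟩ := ((((Rp.num 9).mul RE1).mul Rp.one.neg)).inv hw (by decide +kernel)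
  have Rxt : Rp xt ⟨3,7,7,0,0,3,0⟩ := by
    rw [hxt]
    exact (((RE2.pow 2).mul Rw).neg).to (by decide +kernel)
  have RY : Rp Y ⟨9,5,1,2,2,1,5⟩ := by
    rw [hY]
    exact ((((Rp.num 5).mul Rxt).add (((Rp.b.pow 6).mul Rp.eta).mul (((RE1.pow 2).mul RE2).mul Rw)))).to (by decide +kernel)
  have Rδ : Rp δ ⟨13,2,3,4,2,2,2⟩ := by
    rw [hδ]
    exact (((Rxt.pow 2).sub ((Rp.num 7).mul (Rp.b.pow 4)))).to (by decide +kernel)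
  have Rρ1 : Rp ρ1 ⟨1,1,4,7,1,6,6⟩ := by
    rw [hρ1]
    exact ((((((((Rp.num 21).mul Rp.eta).mul (Rxt.pow 3)).add (((Rp.b.pow 5).mul (Rp.eta.pow 2)).mul (Rxt.pow 4))).add ((((Rp.num 21).mul (Rp.b.pow 16)).mul (Rp.eta.pow 3)).mul (Rxt.pow 2))).add ((((Rp.num 147).mul (Rp.b.pow 4)).mul Rp.eta).mul Rxt)).add (((Rp.num 49).mul (Rp.b.pow 13)).mul (Rp.eta.pow 2)))).to (by decide +kernel)
  have Rδ2 : Rp δ2 ⟨9,4,0,4,6,6,4⟩ := by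
    rw [hδ2]
    exact (((Rδ.pow 4).sub (((Rp.num 7).mul (Rp.b.pow 8)).mul (RY.pow 4)))).to (by decide +kernel)
  have Rp2 : Rp p2 ⟨9,0,7,0,0,3,5⟩ := by
    rw [hp2]
    exact (((RY.mul Rδ).mul Rρ1)).to (by decide +kernel)
  have Rρ2 : Rp ρ2 ⟨9,4,1,5,2,4,3⟩ := by
    rw [hρ2]
    exact ((((((((Rp.b.pow 3).mul (Rp.eta.pow 4)).mul (Rδ.pow 8)).add ((((Rp.num 21).mul (Rp.eta.pow 3)).mul (Rδ.pow 6)).mul (RY.pow 2))).add (((((Rp.num 21).mul (Rp.b.pow 18)).mul (Rp.eta.pow 5)).mul (Rδ.pow 4)).mul (RY.pow 4))).add (((((Rp.num 147).mul (Rp.b.pow 8)).mul (Rp.eta.pow 3)).mul (Rδ.pow 2)).mul (RY.pow 6))).add ((((Rp.num 49).mul (Rp.b.pow 19)).mul (Rp.eta.pow 4)).mul (RY.pow 8)))).to (by decide +kernel)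
  have Rδ3 : Rp δ3 ⟨1,0,4,0,0,0,0⟩ := by
    rw [hδ3]
    exact ((((Rp.eta.pow 4).mul (Rδ2.pow 4)).sub (((Rp.num 7).mul (Rp.b.pow 16)).mul (Rp2.pow 4)))).to (by decide +kernel)
  have ui : IsUnit (η*δ3) := (Rp.eta.mul Rδ3).unit (by decide +kernel)
  obtain ⟨i, hi⟩ := ui.exists_right_inv
  obtain ⟨θ, hθ⟩ : ∃ θ, θ = b*p2*δ2*ρ2*i := ⟨_, rfl⟩
  obtain ⟨ω, hω⟩ : ∃ ω, ω = (η^10*δ2^8+21*b*η^7*δ2^6*p2^2+21*b^23*η^7*δ2^4*p2^4+147*b^17*η^3*δ2^2*p2^6+49*b^32*η^2*p2^8)*i^2 := ⟨_, rfl⟩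
  have Ri : Rp i ⟨9,0,4,0,0,0,0⟩ := ((Rp.eta.mul Rδ3)).inv hi (by decide +kernel)
  have Rθ : Rp θ ⟨12,3,2,6,1,1,6⟩ := by
    rw [hθ]
    exact (((((Rp.b.mul Rp2).mul Rδ2).mul Rρ2).mul Ri)).to (by decide +kernel)
  have Rω : Rp ω ⟨13,1,4,2,2,5,4⟩ := by
    rw [hω]
    exact ((((((((Rp.eta.pow 10).mul (Rδ2.pow 8)).add (((((Rp.num 21).mul Rp.b).mul (Rp.eta.pow 7)).mul (Rδ2.pow 6)).mul (Rp2.pow 2))).add (((((Rp.num 21).mul (Rp.b.pow 23)).mul (Rp.eta.pow 7)).mul (Rδ2.pow 4)).mul (Rp2.pow 4))).add (((((Rp.num 147).mul (Rp.b.pow 17)).mul (Rp.eta.pow 3)).mul (Rδ2.pow 2)).mul (Rp2.pow 6))).add ((((Rp.num 49).mul (Rp.b.pow 32)).mul (Rp.eta.pow 2)).mul (Rp2.pow 8))).mul (Ri.pow 2))).to (by decide +kernel)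
  refine ⟨θ, ω, ?_, Rθ, Rω⟩
  have b0 := bR_ne (K := K)
  have η0 : η ≠ 0 := (IsUnit.of_mul_eq_one 9 (by rw [mul_comm]; exact nine_eta)).ne_zero
  have h2 := two_eq (K := K)
  have h16 := sixteen_eq (K := K)
  have h32 : (32 : R K) = b^35*η^5 := by linear_combination 2*h16 + b^28*η^4*h2
  have h256 : (256 : R K) = b^56*η^8 := by linear_combination (16+b^28*η^4)*h16
  have r2 := hrR1 (K := K) (x := 1) (z := -1) (by norm_num) (e1 := E1) (ε2 := E2) (ε3 := -1) (by rw [hE1]; ring) (by rw [hE2]; ring) (by ring)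
  have hp := pt1 r2 hw hxt rfl hY
  have J0 := JE (K := K) (x := b^12*η^2*xt) (y := b^12*η^2*Y) (by
    linear_combination b^24*η^4*hp - 7*b^12*η^2*xt*h16)
  have J1 : JP (b^5*η*δ) Y (b^5*ρ1) := by
    refine J0.cancel (c := b^19*η^3) (mul_ne_zero (pow_ne_zero _ b0) (pow_ne_zero _ η0)) ?_ ?_ ?_
    · rw [hδ]; linear_combination -7*h16
    · linear_combination b^12*η^2*Y*h2
    · rw [hρ1]; linear_combination 21*b^36*η^6*xt^3*h2 + (21*b^24*η^4*xt^2+147*b^12*η^2*xt)*h32+49*h256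
  have J2 : JP (b^3*η^2*δ2) p2 (b^3*ρ2) := by
    refine J1.dbl.cancel (c := b^17*η^2) (mul_ne_zero (pow_ne_zero _ b0) (pow_ne_zero _ η0)) ?_ ?_ ?_
    · rw [hδ2]; linear_combination -7*Y^4*h16
    · rw [hp2]; linear_combination Y*(b^5*η*δ)*(b^5*ρ1)*h2
    · rw [hρ2]; linear_combination 21*(b^5*η*δ)^6*Y^2*h2 + (21*(b^5*η*δ)^4*Y^4+147*(b^5*η*δ)^2*Y^6)*h32+49*Y^8*h256
  have J3 : JP (η*δ3) (b*p2*δ2*ρ2) (η^10*δ2^8+21*b*η^7*δ2^6*p2^2+21*b^23*η^7*δ2^4*p2^4+147*b^17*η^3*δ2^2*p2^6+49*b^32*η^2*p2^8) := by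
    refine J2.dbl.cancel (c := b^12*η^3) (mul_ne_zero (pow_ne_zero _ b0) (pow_ne_zero _ η0)) ?_ ?_ ?_
    · rw [hδ3]; linear_combination -7*p2^4*h16
    · linear_combination p2*(b^3*η^2*δ2)*(b^3*ρ2)*h2
    · linear_combination 21*(b^3*η^2*δ2)^6*p2^2*h2 + (21*(b^3*η^2*δ2)^4*p2^4+147*(b^3*η^2*δ2)^2*p2^6)*h32+49*p2^8*h256
  rw [hθ, hω]
  exact J3.norm hi

lemma Jd {θ ω i : R K} (h : JP 1 θ ω) (hi : (1-112*θ^4)*i = 1) :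
    JP 1 (2*θ*ω*i) ((1+42*θ^2+672*θ^4+4704*θ^6+12544*θ^8)*i^2) := by
  have := h.dbl.norm (i := i) (by linear_combination hi)
  convert this using 1 <;> ring

lemma u112 (θ : R K) : ∃ i : R K, (1-112*θ^4)*i = 1 := by
  have h2 := two_eq (K := K)
  exact (unit_of (1-112*θ^4) ⟨-b^6*η*56*θ^4, by linear_combination -56*θ^4*h2⟩).exists_right_inv

lemma B32 : ∃ κ ω : R K, JP 1 (2^2*κ) ω ∧ Rp κ ⟨0,7,7,0,7,0,0⟩ ∧ Cg 22 ω 1 := by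
  obtain ⟨θ, ω, J, Rθ, Rω⟩ := B8 (K := K)
  obtain ⟨i, hi⟩ := u112 θ
  have Ri : Rp i ⟨1,0,0,0,0,0,0⟩ := (Rp.one.sub ((Rp.num 112).mul (Rθ.pow 4))).inv hi (by decide +kernel)
  have J2 := Jd J hi
  obtain ⟨ω2, hω2⟩ : ∃ ω2, ω2 = (1+42*θ^2+672*θ^4+4704*θ^6+12544*θ^8)*i^2 := ⟨_, rfl⟩
  have Rω2 : Rp ω2 ⟨1,4,2,4,0,4,4⟩ := by
    rw [hω2]
    exact ((((((Rp.one.add ((Rp.num 42).mul (Rθ.pow 2))).add ((Rp.num 672).mul (Rθ.pow 4))).add ((Rp.num 4704).mul (Rθ.pow 6))).add ((Rp.num 12544).mul (Rθ.pow 8))).mul (Ri.pow 2))).to (by decide +kernel)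
  rw [← hω2] at J2
  have Rθ4 : Rp (2*θ*ω*i) ⟨0,6,6,4,2,0,4⟩ := (((((Rp.num 2).mul Rθ).mul Rω).mul Ri)).to (by decide +kernel)
  obtain ⟨i2, hi2⟩ := u112 (2*θ*ω*i)
  have Ri2 : Rp i2 ⟨1,0,0,0,0,0,0⟩ := ((Rp.one.sub ((Rp.num 112).mul (Rθ4.pow 4)))).inv hi2 (by decide +kernel)
  have J3 := Jd J2 hi2
  refine ⟨θ*ω*i*ω2*i2, (1+42*(2*θ*ω*i)^2+672*(2*θ*ω*i)^4+4704*(2*θ*ω*i)^6+12544*(2*θ*ω*i)^8)*i2^2, ?_, (((((Rθ.mul Rω).mul Ri).mul Rω2).mul Ri2)).to (by decide +kernel), ?_⟩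
  · convert J3 using 1; ring
  · have : Rp _ (V.C 1) := ((((((Rp.one.add ((Rp.num 42).mul (Rθ4.pow 2))).add ((Rp.num 672).mul (Rθ4.pow 4))).add ((Rp.num 4704).mul (Rθ4.pow 6))).add ((Rp.num 12544).mul (Rθ4.pow 8))).mul (Ri2.pow 2))).to (by decide +kernel)
    unfold Rp at this; rw [evR_C] at this; push_cast at this; exact this

/-- the points 2^(k+5) g -/
lemma Bk (k : ℕ) : ∃ κ ω : R K, JP 1 (2^(k+2)*κ) ω ∧ Rp κ ⟨0,7,7,0,7,0,0⟩ ∧ Cg 22 ω 1 := by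
  induction k with
  | zero => exact B32
  | succ k ih =>
  obtain ⟨κ, ω, J, Rκ, Cω⟩ := ih
  have h4 := four_eq (K := K)
  obtain ⟨i, hi⟩ := u112 (2^(k+2)*κ)
  have J2 := Jd J hi
  have e : 2^(k+2)*κ = b^14*(η^2*2^k*κ) := by rw [pow_add]; linear_combination 2^k*κ*h4
  obtain ⟨q, hq⟩ := Cω
  have i1 : i = 1 + b^22*(112*b^34*(η^2*2^k*κ)^4*i) := by rw [e] at hi; linear_combination hi
  refine ⟨κ*ω*i, (1+42*(2^(k+2)*κ)^2+672*(2^(k+2)*κ)^4+4704*(2^(k+2)*κ)^6+12544*(2^(k+2)*κ)^8)*i^2, ?_, ?_, ?_⟩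
  · convert J2 using 1; ring
  · refine Cg.trans (y := κ) ⟨κ*q*i+κ*(112*b^34*(η^2*2^k*κ)^4*i), ?_⟩ Rκ
    linear_combination κ*i*hq + κ*i1
  · rw [e]
    refine ⟨b^6*(η^2*2^k*κ)^2*(42+672*(b^14*(η^2*2^k*κ))^2+4704*(b^14*(η^2*2^k*κ))^4+12544*(b^14*(η^2*2^k*κ))^6)*i^2 + (i+1)*(112*b^34*(η^2*2^k*κ)^4*i), ?_⟩
    linear_combination (i+1)*i1
end C2

namespace C2
open Polynomial Module NumberField

variable {K : Type} [Field K] [NumberField K] [KD K]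
local notation "β" => (KD.b : K)
local notation "b" => (bR : R K)
local notation "η" => (eta : R K)

lemma Jadd {θ1 ω1 θ2 ω2 i : R K} (h1 : JP 1 θ1 ω1) (h2 : JP 1 θ2 ω2) (hi : (1-112*(θ1*θ2)^2)*i = 1) :
    ∃ ω3, JP 1 ((θ1*ω2+θ2*ω1)*i) ω3 := by
  refine ⟨_, JP.norm (a := 1-112*(θ1*θ2)^2) (p := θ1*ω2+θ2*ω1)
    (r := (1+112*(θ1*θ2)^2)*(ω1*ω2+21*(θ1*θ2))+224*(θ1*θ2)*(θ1^2+θ2^2)) ?_ hi⟩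
  unfold JP at *
  have hp : (ω1*ω2)^2 = (1+21*θ1^2+112*θ1^4)*(1+21*θ2^2+112*θ2^4) := by
    rw [mul_pow, h1, h2]; ring
  have hN : (θ1*ω2+θ2*ω1)^2 = θ1^2*(1+21*θ2^2+112*θ2^4)+θ2^2*(1+21*θ1^2+112*θ1^4)+2*(θ1*θ2)*(ω1*ω2) := by
    linear_combination θ1^2*h2+θ2^2*h1
  have hN4 : (θ1*ω2+θ2*ω1)^4 = (θ1^2*(1+21*θ2^2+112*θ2^4)+θ2^2*(1+21*θ1^2+112*θ1^4)+2*(θ1*θ2)*(ω1*ω2))^2 := by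
    rw [← hN]; ring
  linear_combination ((1+112*(θ1*θ2)^2)^2-448*(θ1*θ2)^2)*hp - 21*(1-112*(θ1*θ2)^2)^2*hN - 112*hN4

lemma comb {m r : ℕ} {κ1 κ2 ω1 ω2 : R K} {k M : V} (h1 : JP 1 (2^(m+2)*κ1) ω1) (h2 : JP 1 (2^(m+2)*κ2) ω2)
    (c1 : Cg 22 ω1 1) (c2 : Cg 22 ω2 1) {κ0 : R K} (hs : κ1+κ2 = 2^r*κ0) (hr : r ≤ 2)
    (hk : Cg 8 κ0 (evR k)) (hc : cert k M = true) (hk0 : ¬ b^8 ∣ (evR k : R K)) : False := by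
  have t2 := two_eq (K := K)
  have h4 := four_eq (K := K)
  have b0 := bR_ne (K := K)
  obtain ⟨i, hi⟩ : ∃ i, (1-112*((2^(m+2)*κ1)*(2^(m+2)*κ2))^2)*i = 1 :=
    (unit_of (1-112*((2^(m+2)*κ1)*(2^(m+2)*κ2))^2) ⟨-b^6*η*56*((2^(m+2)*κ1)*(2^(m+2)*κ2))^2, by linear_combination -56*((2^(m+2)*κ1)*(2^(m+2)*κ2))^2*t2⟩).exists_right_inv
  obtain ⟨ω3, J⟩ := Jadd h1 h2 hi
  obtain ⟨q1, e1⟩ := c1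
  obtain ⟨q2, e2⟩ := c2
  obtain ⟨c, hc4⟩ : ∃ c : R K, 4 = 2^r*c := by
    refine ⟨2^(2-r), ?_⟩
    rw [← pow_add]; rw [show r+(2-r) = 2 by omega]; norm_num
  have b14 : b^14 = 2^r*(c*81) := by linear_combination -81*h4 + 81*hc4 - b^14*(9*η+1)*nine_eta (K := K)
  have hi1 : i = 1 + b^8*(b^20*7*η^4*((2^(m+2)*κ1)*(2^(m+2)*κ2))^2*i) := by
    linear_combination hi + 7*((2^(m+2)*κ1)*(2^(m+2)*κ2))^2*i*sixteen_eq (K := K)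
  obtain ⟨κ3, hκ3⟩ : ∃ κ3, κ3 = (κ0 + b^8*(c*81)*(κ1*q2+κ2*q1))*i := ⟨_, rfl⟩
  have C3 : Cg 8 κ3 (evR k) := by
    refine Cg.trans (y := κ0) ⟨(c*81)*(κ1*q2+κ2*q1)*i + κ0*(b^20*7*η^4*((2^(m+2)*κ1)*(2^(m+2)*κ2))^2*i), ?_⟩ hk
    rw [hκ3]; linear_combination κ0*hi1
  have hθ : (2^(m+2)*κ1*ω2+2^(m+2)*κ2*ω1)*i = 2^(m+1+r+1)*κ3 := by
    rw [hκ3, show m+1+r+1 = (m+2)+r by omega, pow_add]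
    linear_combination 2^(m+2)*i*(κ1*e2+κ2*e1+hs + b^8*(κ1*q2+κ2*q1)*b14)
  rw [hθ] at J
  have κ30 : κ3 ≠ 0 := by
    rintro rfl
    apply hk0
    have := C3
    unfold Cg at this
    rw [zero_sub, dvd_neg] at this; exact this
  have h20 : (2 : R K) ≠ 0 := by have := int_ne (K := K) (n := 2) (by norm_num); simpa using this
  have θ0 := coe_ne (mul_ne_zero (pow_ne_zero (m+1+r+1) h20) κ30)
  have J' := congrArg Subtype.val J
  generalize hT : 2^(m+1+r+1)*κ3 = T at *
  have J2 : (ω3 : K)^2 = 1 + 21*(T : K)^2+112*(T : K)^4 := by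
    push_cast at J'; rw [J']
    change 1^4 + 21*1^2*(T : K)^2+112*(T : K)^4 = _
    ring
  refine S_all (m+1+r) (s := (T : K)⁻¹) (w := (ω3 : K)/(T : K)^2) (κ := κ3) hc ?_ ?_ C3
  · rw [hT]; exact inv_mul_cancel₀ θ0
  · field_simp; rw [J2]; ring

lemma nd (i : ℕ) (hi : i < 8) {x u : R K} (hx : x = b^i*(1+b*u)) : ¬ b^8 ∣ x := by
  intro h
  rw [hx] at h
  have := b_pow_dvd_cancel (unit_of (1+b*u) ⟨u, by ring⟩) h
  omega
lemma n001 : ¬ b^8 ∣ (evR k001 : R K) := nd 4 (by norm_num) (u := 0) (by rw [evR_def]; simp [k001])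
lemma n010 : ¬ b^8 ∣ (evR k010 : R K) := nd 2 (by norm_num) (u := 0) (by rw [evR_def]; simp [k010])
lemma n110 : ¬ b^8 ∣ (evR k110 : R K) := nd 1 (by norm_num) (u := 1) (by rw [evR_def]; simp [k110]; ring)
lemma n101 : ¬ b^8 ∣ (evR k101 : R K) := nd 1 (by norm_num) (u := b^2) (by rw [evR_def]; simp [k101]; ring)
lemma n011 : ¬ b^8 ∣ (evR k011 : R K) := nd 2 (by norm_num) (u := b) (by rw [evR_def]; simp [k011]; ring)

end C2

namespace C2
open Polynomial Module NumberField

variable {K : Type} [Field K] [NumberField K] [KD K]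
local notation "β" => (KD.b : K)
local notation "b" => (bR : R K)
local notation "η" => (eta : R K)

lemma chordR {x1 y1 x2 y2 θ u v : R K} (h1 : y1^2 = x1^3+21*x1^2+112*x1) (h2 : y2^2 = x2^3+21*x2^2+112*x2)
    (hθ : θ*(y1+y2) = x1-x2) (h0 : x1-x2 ≠ 0) (hu : u = 1-θ^2*(21+x1+x2)) (hv : v = u-θ^2*x1+θ^3*y1) :
    v^2 = u^3+21*u^2*θ^2+112*u*θ^4 := by
  apply mul_left_cancel₀ h0
  rw [hv, hu]
  linear_combination θ^4*(1-θ^2*(21+x1+x2)-θ^2*x2)*h1 - θ^4*(1-θ^2*(21+x1+x2)-θ^2*x1)*h2 + θ^2*(1-θ^2*(21+x1+x2)-θ^2*x1)*(θ*y2+(x1-x2-θ*y1))*hθ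

def E1V (T P r : ℤ) : V := (V.sub (V.add (V.C 3) (V.mul (V.C 3) ⟨0,1,0,0,0,0,0⟩).rd).rd (V.pw ⟨0,1,0,0,0,0,0⟩ 3)).rd
def E2V (T P r : ℤ) : V := (V.sub (V.sub (V.C 9) (V.mul (V.C 3) (V.pw ⟨0,1,0,0,0,0,0⟩ 2)).rd).rd (V.mul (V.C 3) (V.pw ⟨0,1,0,0,0,0,0⟩ 3)).rd).rd
def f1V (T P r : ℤ) : V := (V.add (V.mul (V.C 3) ⟨0,1,0,0,0,0,0⟩).rd (V.mul (V.pw ⟨0,1,0,0,0,0,0⟩ 3) (V.C r)).rd).rd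
def f3V (T P r : ℤ) : V := (V.add (V.add ((V.C (-1)).mul (V.C 1)).rd (V.C r)).rd (V.mul (V.C T) (V.C r)).rd).rd
def f2V (T P r : ℤ) : V := (V.add (V.add (V.C 9) (V.mul (V.mul (V.C 3) (V.pw ⟨0,1,0,0,0,0,0⟩ 2)).rd (V.C r)).rd).rd (V.mul (V.mul (V.C 3) (V.pw ⟨0,1,0,0,0,0,0⟩ 3)).rd (f3V T P r)).rd).rd
def e1V (T P r : ℤ) : V := (V.add (E1V T P r) (V.mul (V.C T) (f1V T P r)).rd).rd
def ε3V (T P r : ℤ) : V := (V.add ((V.C (-1)).mul (V.C 1)).rd (V.mul (V.C T) (f3V T P r)).rd).rd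
def nV (T P r : ℤ) : V := (V.add (V.mul (V.mul (E1V T P r) (f2V T P r)).rd (V.add (V.mul (V.C 2) (E2V T P r)).rd (V.mul (V.C T) (f2V T P r)).rd).rd).rd (V.mul (V.pw (E2V T P r) 2) (V.add (V.add ((V.C (-1)).mul (f1V T P r)).rd (V.mul (E1V T P r) (f3V T P r)).rd).rd (V.mul (V.mul (V.C T) (f1V T P r)).rd (f3V T P r)).rd).rd).rd).rd
def mV (T P r : ℤ) : V := (V.sub (V.add (V.add (V.mul (E1V T P r) (f2V T P r)).rd (V.mul (E2V T P r) (f1V T P r)).rd).rd (V.mul (V.mul (V.C T) (f1V T P r)).rd (f2V T P r)).rd).rd (V.mul (V.mul (E1V T P r) (E2V T P r)).rd (f3V T P r)).rd).rd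
def DV (T P r : ℤ) : V := (V.add ((V.C (-1)).mul (V.mul (e1V T P r) (V.add (V.mul (V.mul (V.mul (V.pw ⟨0,1,0,0,0,0,0⟩ 6) (V.C 57)).rd (E1V T P r)).rd (V.add (V.mul (E1V T P r) (E2V T P r)).rd (V.mul (V.C P) (mV T P r)).rd).rd).rd (V.mul (V.mul (V.C 5) (V.pw (E2V T P r) 2)).rd (ε3V T P r)).rd).rd).rd).rd (V.mul (V.mul (V.C 5) (V.C P)).rd (nV T P r)).rd).rd
def WV (T r : ℤ) : V := (V.add (V.add (V.add (V.add (V.C 7) (V.mul (V.C 9) (V.C T)).rd).rd (V.mul (V.C 3) (V.pw (V.C T) 2)).rd).rd (V.C r)).rd (V.mul (V.mul (V.C 2) (V.add (V.C 1) (V.C T)).rd).rd (V.add (V.sub (V.mul (V.C 3) (V.C r)).rd (V.mul (V.mul (V.C 3) (V.C T)).rd (V.pw (V.C r) 2)).rd).rd (V.mul (V.pw (V.C T) 2) (V.pw (V.C r) 3)).rd).rd).rd).rd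
def ckQ (T P r : ℤ) (e : V) : Bool := c22 (WV T r) (V.C 0) && (c22 (nV T P r) (e.mul (DV T P r)) && (decide ((DV T P r).a0 % 2 = 1) && (decide (e.a0 % 2 = 0) && decide (e.a1 % 2 = 1))))

lemma rho_of {t tp ρ : R K} {T r : ℤ} (ht : Rp t (V.C T)) (htp : t = 2*tp)
    (hW : 7+9*t+3*t^2+ρ+2*(1+t)*(3*ρ-3*t*ρ^2+t^2*ρ^3) = 0) (hc : c22 (WV T r) (V.C 0) = true) : Rp ρ (V.C r) := by
  have h : Rp (7+9*t+3*t^2+(r : R K)+2*(1+t)*(3*(r : R K)-3*t*(r : R K)^2+t^2*(r : R K)^3)) (WV T r) := (((((Rp.num 7).add ((Rp.num 9).mul ht)).add ((Rp.num 3).mul (ht.pow 2))).add (Rp.int r)).add (((Rp.num 2).mul (Rp.one.add ht)).mul ((((Rp.num 3).mul (Rp.int r)).sub (((Rp.num 3).mul ht).mul ((Rp.int r).pow 2))).add ((ht.pow 2).mul ((Rp.int r).pow 3)))))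
  obtain ⟨q, hq⟩ := h.to hc
  rw [evR_C] at hq
  push_cast at hq
  unfold Rp
  rw [evR_C]
  generalize (r : R K) = r' at *
  obtain ⟨i, hi⟩ := (unit_of (1+2*(1+t)*(3-3*t*(ρ+r')+t^2*(ρ^2+ρ*r'+r'^2))) ⟨b^6*η*((1+t)*(3-3*t*(ρ+r')+t^2*(ρ^2+ρ*r'+r'^2))), by linear_combination ((1+t)*(3-3*t*(ρ+r')+t^2*(ρ^2+ρ*r'+r'^2)))*two_eq (K := K)⟩).exists_right_inv
  refine ⟨-q*i, ?_⟩
  linear_combination -i*hq + i*hW - (ρ-r')*hi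

lemma b_unit {e : R K} {X : V} (h : Rp e X) (h0 : X.a0 % 2 = 0) (h1 : X.a1 % 2 = 1) : ∃ u : R K, e = b*(1+b*u) := by
  obtain ⟨q, hq⟩ := h
  obtain ⟨k, hk⟩ : ∃ k, X.a0 = 2*k := ⟨X.a0/2, by omega⟩
  obtain ⟨l, hl⟩ : ∃ l, X.a1 = 2*l+1 := ⟨X.a1/2, by omega⟩
  rw [evR_def, hk, hl] at hq
  push_cast at hq
  exact ⟨b^5*η*k+b^6*η*l + X.a2+X.a3*b+X.a4*b^2+X.a5*b^3+X.a6*b^4+b^20*q, by linear_combination hq + (k+l*b)*two_eq (K := K)⟩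

lemma q1pts {t tp ρ : R K} {T P r : ℤ} {e0 : V} (ht : Rp t (V.C T)) (hp : Rp tp (V.C P)) (htp : t = 2*tp) (ht0 : t ≠ 0)
    (hW : 7+9*t+3*t^2+ρ+2*(1+t)*(3*ρ-3*t*ρ^2+t^2*ρ^3) = 0) (hc : ckQ T P r e0 = true) :
    ∃ e x1 x2 y1 u v: R K, Rp e e0 ∧ b ∣ x1 + x2 ∧ (∃ w, e = b*(1+b*w)) ∧ u = 1-(tp*e)^2*(21+b^12*x1+b^12*x2) ∧
      v = u-(tp*e)^2*(b^12*x1)+(tp*e)^3*y1 ∧ v^2 = u^3+21*u^2*(tp*e)^2+112*u*(tp*e)^4 := by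
  simp only [ckQ, Bool.and_eq_true, decide_eq_true_eq] at hc
  obtain ⟨hcW, hcn, hcD, hce0, hce1⟩ := hc
  have hρ := rho_of ht htp hW hcW
  have h2 := two_eq (K := K)
  obtain ⟨E1, hE1⟩ : ∃ E1, E1 = 3+3*b-b^3 := ⟨_, rfl⟩
  obtain ⟨E2, hE2⟩ : ∃ E2, E2 = 9-3*b^2-3*b^3 := ⟨_, rfl⟩
  obtain ⟨f1, hf1⟩ : ∃ f1, f1 = 3*b+b^3*ρ := ⟨_, rfl⟩
  obtain ⟨f3, hf3⟩ : ∃ f3, f3 = -1+ρ+t*ρ := ⟨_, rfl⟩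
  obtain ⟨f2, hf2⟩ : ∃ f2, f2 = 9+3*b^2*ρ+3*b^3*f3 := ⟨_, rfl⟩
  obtain ⟨e1, he1⟩ : ∃ e1, e1 = E1+t*f1 := ⟨_, rfl⟩
  obtain ⟨ε2, hε2⟩ : ∃ ε2, ε2 = E2+t*f2 := ⟨_, rfl⟩
  obtain ⟨ε3, hε3⟩ : ∃ ε3, ε3 = -1+t*f3 := ⟨_, rfl⟩
  obtain ⟨n, hn⟩ : ∃ n, n = E1*f2*(2*E2+t*f2)+E2^2*(-f1+E1*f3+t*f1*f3) := ⟨_, rfl⟩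
  obtain ⟨m, hm⟩ : ∃ m, m = E1*f2+E2*f1+t*f1*f2-E1*E2*f3 := ⟨_, rfl⟩
  obtain ⟨D, hD⟩ : ∃ D, D = -(e1*(b^6*η*E1*(E1*E2+tp*m)+5*E2^2*ε3))+5*tp*n := ⟨_, rfl⟩
  have RE1 : Rp E1 (E1V T P r) := by rw [hE1]; exact (((Rp.num 3).add ((Rp.num 3).mul Rp.b)).sub (Rp.b.pow 3))
  have RE2 : Rp E2 (E2V T P r) := by rw [hE2]; exact (((Rp.num 9).sub ((Rp.num 3).mul (Rp.b.pow 2))).sub ((Rp.num 3).mul (Rp.b.pow 3)))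
  have Rf1 : Rp f1 (f1V T P r) := by rw [hf1]; exact (((Rp.num 3).mul Rp.b).add ((Rp.b.pow 3).mul hρ))
  have Rf3 : Rp f3 (f3V T P r) := by rw [hf3]; exact ((Rp.one.neg.add hρ).add (ht.mul hρ))
  have Rf2 : Rp f2 (f2V T P r) := by rw [hf2]; exact (((Rp.num 9).add (((Rp.num 3).mul (Rp.b.pow 2)).mul hρ)).add (((Rp.num 3).mul (Rp.b.pow 3)).mul Rf3))
  have Re1 : Rp e1 (e1V T P r) := by rw [he1]; exact (RE1.add (ht.mul Rf1))
  have Rε3 : Rp ε3 (ε3V T P r) := by rw [hε3]; exact (Rp.one.neg.add (ht.mul Rf3))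
  have Rn : Rp n (nV T P r) := by rw [hn]; exact (((RE1.mul Rf2).mul (((Rp.num 2).mul RE2).add (ht.mul Rf2))).add ((RE2.pow 2).mul ((Rf1.neg.add (RE1.mul Rf3)).add ((ht.mul Rf1).mul Rf3))))
  have Rm : Rp m (mV T P r) := by rw [hm]; exact ((((RE1.mul Rf2).add (RE2.mul Rf1)).add ((ht.mul Rf1).mul Rf2)).sub ((RE1.mul RE2).mul Rf3))
  have RD : Rp D (DV T P r) := by rw [hD]; exact ((Re1.mul (((((Rp.b.pow 6).mul Rp.eta).mul RE1).mul ((RE1.mul RE2).add (hp.mul Rm))).add (((Rp.num 5).mul (RE2.pow 2)).mul Rε3))).neg.add (((Rp.num 5).mul hp).mul Rn))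
  obtain ⟨d, hd⟩ := (RD.unit hcD).exists_right_inv
  have d0 : d ≠ 0 := by rintro rfl; simp at hd
  have Re : Rp (n*d) e0 := Rn.div RD hd rfl hcn
  obtain ⟨w, hw⟩ := b_unit Re hce0 hce1
  have b0 := bR_ne (K := K)
  have hn0 : n*d ≠ 0 := by
    rw [hw]; exact mul_ne_zero b0 (unit_of (1+b*w) ⟨w, by ring⟩).ne_zero
  have uE1 : IsUnit E1 := unit_of _ ⟨b^6*η+3-b^2, by rw [hE1]; linear_combination h2⟩
  have ue1 : IsUnit e1 := unit_of _ ⟨b^6*η+3-b^2+b^6*η*tp*f1, by rw [he1, hE1, htp]; linear_combination (1+tp*f1)*h2⟩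
  have uε3 : IsUnit ε3 := unit_of _ ⟨b^6*η*(-1+tp*f3), by rw [hε3, htp]; linear_combination (-1+tp*f3)*h2⟩
  have u9 : IsUnit (9 : R K) := IsUnit.of_mul_eq_one η nine_eta
  have uη : IsUnit η := IsUnit.of_mul_eq_one 9 (by rw [mul_comm]; exact nine_eta)
  obtain ⟨w1, hw1⟩ := ((u9.mul ue1).mul uε3).exists_right_inv
  obtain ⟨w2, hw2⟩ := ((u9.mul uE1).mul isUnit_one.neg).exists_right_inv
  have w10 : w1 ≠ 0 := by rintro rfl; simp at hw1
  have w20 : w2 ≠ 0 := by rintro rfl; simp at hw2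
  have hC : 3*(1+t)^3+(-1+t*ρ)+2*(-1+t*ρ)^3*(1+t) = 0 := by
    linear_combination t*hW
  have r1 := hrR1 hC (e1 := e1) (ε2 := ε2) (ε3 := ε3) (by rw [he1, hE1, hf1]; ring) (by rw [hε2, hE2, hf2, hf3]; ring) (by rw [hε3, hf3]; ring)
  have r2 := hrR1 (K := K) (x := 1) (z := -1) (by norm_num) (e1 := E1) (ε2 := E2) (ε3 := -1) (by rw [hE1]; ring) (by rw [hE2]; ring) (by ring)
  obtain ⟨X1, hX1⟩ : ∃ X1, X1 = -(ε2^2*w1) := ⟨_, rfl⟩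
  obtain ⟨X2, hX2⟩ : ∃ X2, X2 = -(E2^2*w2) := ⟨_, rfl⟩
  obtain ⟨Y1, hY1⟩ : ∃ Y1, Y1 = 5*X1+b^6*η*(e1^2*ε2*w1) := ⟨_, rfl⟩
  obtain ⟨Y2, hY2⟩ : ∃ Y2, Y2 = 5*X2+b^6*η*(E1^2*E2*w2) := ⟨_, rfl⟩
  have p1 := pt1 r1 hw1 hX1 rfl hY1
  have p2 := pt1 r2 hw2 hX2 rfl hY2
  have h16 := sixteen_eq (K := K)
  have P1 : (b^12*η^2*Y1)^2 = (b^12*(η^2*X1))^3+21*(b^12*(η^2*X1))^2+112*(b^12*(η^2*X1)) := by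
    linear_combination b^24*η^4*p1 - 7*b^12*η^2*X1*h16
  have P2 : (b^12*η^2*Y2)^2 = (b^12*(η^2*X2))^3+21*(b^12*(η^2*X2))^2+112*(b^12*(η^2*X2)) := by
    linear_combination b^24*η^4*p2 - 7*b^12*η^2*X2*h16
  have n2 : ε2^2*E1 + E2^2*e1*ε3 = t*n := by rw [hε2, hε3, he1, hn]; ring
  have n4 : e1*ε2-E1*E2*ε3 = 2*(E1*E2+tp*m) := by rw [hε2, hε3, he1, hm, htp]; ring
  have dx : b^12*(η^2*X1) - b^12*(η^2*X2) = b^12*η^2*(9*w1*w2*(t*n)) := by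
    rw [hX1, hX2]
    linear_combination b^12*η^2*9*w1*w2*n2 + b^12*η^2*(ε2^2*w1*hw2 - E2^2*w2*hw1)
  have sy : b^12*η^2*Y1 + b^12*η^2*Y2 = b^12*η^2*(9*w1*w2*(2*D)) := by
    rw [hY1, hY2, hX1, hX2, hD]
    linear_combination 5*b^12*η^2*9*w1*w2*(n2+n*htp) + 5*b^12*η^2*(ε2^2*w1*hw2+E2^2*w2*hw1) - b^18*η^3*(e1^2*ε2*w1*hw2+E1^2*E2*w2*hw1)-b^18*η^3*9*w1*w2*e1*E1*n4
  have dx0 : b^12*(η^2*X1) - b^12*(η^2*X2) ≠ 0 := by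
    rw [dx]
    exact mul_ne_zero (mul_ne_zero (pow_ne_zero _ b0) (pow_ne_zero _ uη.ne_zero)) (mul_ne_zero (mul_ne_zero (mul_ne_zero u9.ne_zero w10) w20) (mul_ne_zero ht0 (left_ne_zero_of_mul hn0)))
  have hθ : (tp*(n*d))*(b^12*η^2*Y1 + b^12*η^2*Y2) = b^12*(η^2*X1) - b^12*(η^2*X2) := by
    rw [sy, dx, htp]; linear_combination b^12*η^2*(9*w1*w2*(2*tp*n))*hd
  have uE2 : IsUnit E2 := unit_of _ ⟨b^6*η*4-3*b-3*b^2, by rw [hE2]; linear_combination 4*h2⟩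
  have uε2 : IsUnit ε2 := unit_of _ ⟨b^6*η*4-3*b-3*b^2+b^6*η*tp*f2, by rw [hε2, hE2, htp]; linear_combination (4+tp*f2)*h2⟩
  have uw1 : IsUnit w1 := IsUnit.of_mul_eq_one (9*e1*ε3) (by rw [mul_comm]; exact hw1)
  have uw2 : IsUnit w2 := IsUnit.of_mul_eq_one (9*E1*(-1)) (by rw [mul_comm]; exact hw2)
  have hX : b ∣ η^2*X1+η^2*X2 := by
    rw [hX1, hX2]
    exact sum_even ((uη.pow 2).mul ((uε2.pow 2).mul uw1).neg) ((uη.pow 2).mul ((uE2.pow 2).mul uw2).neg)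
  exact ⟨n*d, η^2*X1, η^2*X2, b^12*η^2*Y1, _, _, Re, hX, ⟨w, hw⟩, rfl, rfl, chordR P1 P2 hθ dx0 rfl rfl⟩
end C2

namespace C2
open Polynomial Module NumberField

variable {K : Type} [Field K] [NumberField K] [KD K]
local notation "β" => (KD.b : K)
local notation "b" => (bR : R K)
local notation "η" => (eta : R K)

lemma bQ1 : bad ⟨5,0,3,0,2,0,3⟩ = true := by decide +kernel

lemma Q1k1 {s ρ : R K} {s0 r : ℤ} {e0 : V} (hs : Rp s (V.C s0)) (hs0 : s ≠ 0)
    (hW : 7+9*(2*s)+3*(2*s)^2+ρ+2*(1+2*s)*(3*ρ-3*(2*s)*ρ^2+(2*s)^2*ρ^3) = 0) (hc : ckQ (2*s0) s0 r e0 = true)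
    (hT : c15 (((V.C 1).sub ((V.C 21).mul (((V.C s0).mul e0).rd.pw 2)).rd).rd) ⟨5,0,3,0,2,0,3⟩ = true) (_hK : β ≠ 0) : False := by
  have h20 : (2 : R K) ≠ 0 := by have := int_ne (K := K) (n := 2) (by norm_num); simpa using this
  have h2 : Rp (2*s) (V.C (2*s0)) := ((Rp.num 2).mul hs).to (by simp [c22, V.rd, V.mul, V.C])
  obtain ⟨e, x1, x2, y1, u, v, Re, ⟨q, hq⟩, ⟨w, hw⟩, hu, hv, huv⟩ := q1pts h2 hs rfl (mul_ne_zero h20 hs0) hW hc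
  have b0 := bR_ne (K := K)
  have he0 : e ≠ 0 := by
    rw [hw]; exact mul_ne_zero b0 (unit_of (1+b*w) ⟨w, by ring⟩).ne_zero
  have θ0 := coe_ne (mul_ne_zero hs0 he0)
  have Ru : Rp (1-21*(s*e)^2) _ := Rp.one.sub ((Rp.num 21).mul ((hs.mul Re).pow 2))
  generalize hθ : s*e = θ at *
  have huv' : (v : K)^2 = u^3+21*u^2*(θ:K)^2+112*u*(θ:K)^4 := by
    have := congrArg Subtype.val huv
    push_cast at this; exact this
  refine K1 (T := ⟨5,0,3,0,2,0,3⟩) (x := (u : K)/(θ : K)^2) (y := (v : K)/(θ : K)^3) (h := (θ : K)⁻¹) (u := u) rfl bQ1 (inv_ne_zero θ0) ?_ ?_ ?_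
  · field_simp; rw [huv']; ring
  · field_simp
  · have c1 : Cg 15 u (1-21*(s*e)^2) := by
      refine ⟨-(s*(1+b*w))^2*q, ?_⟩
      rw [hu, ← hθ, hw]
      linear_combination -b^12*(s*b*(1+b*w))^2*hq
    rw [hθ] at c1
    exact c1.trans ((Ru.mono (by norm_num)).trans (cg_of_c15 hT))

lemma JEp {u v θ : R K} (h : v^2 = u^3+21*u^2*θ^2+112*u*θ^4) :
    JP (u^2-112*θ^4) (2*θ*v) (u^4+42*u^3*θ^2+672*u^2*θ^4+4704*u*θ^6+12544*θ^8) := by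
  unfold JP
  have h4 : v^4 = (u^3+21*u^2*θ^2+112*u*θ^4)^2 := by rw [← h]; ring
  linear_combination -84*θ^2*(u^2-112*θ^4)^2*h - 1792*θ^4*h4

lemma Apt {s ρ : R K} {m : ℕ} {T P r : ℤ} {e0 : V} (hT : Rp (2^(m+2)*s) (V.C T)) (hP : Rp (2^(m+1)*s) (V.C P)) (hs0 : s ≠ 0)
    (hW : 7+9*(2^(m+2)*s)+3*(2^(m+2)*s)^2+ρ+2*(1+2^(m+2)*s)*(3*ρ-3*(2^(m+2)*s)*ρ^2+(2^(m+2)*s)^2*ρ^3) = 0) (hc : ckQ T P r e0 = true) :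
    ∃ e q ω : R K, Rp e e0 ∧ JP 1 (2^(m+2)*(s*e*(1+b^16*4^m*q))) ω ∧ Cg 22 ω 1 := by
  have h20 : (2 : R K) ≠ 0 := by have := int_ne (K := K) (n := 2) (by norm_num); simpa using this
  have h2 := two_eq (K := K)
  obtain ⟨e, x1, x2, y1, u, v, Re, -, ⟨w, hw⟩, hu, hv, huv⟩ := q1pts hT hP (by ring) (mul_ne_zero (pow_ne_zero _ h20) hs0) hW hc
  have hθ : (2^(m+1)*s*e)^2 = b^16*4^m*(η*s*(1+b*w))^2 := by
    have : 2^(m+1)*s*e = b^8*2^m*(η*s*(1+b*w)) := by rw [hw, pow_succ]; linear_combination 2^m*s*b*(1+b*w)*h2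
    rw [this, show (4 : R K) = 2^2 by norm_num, ← pow_mul, mul_comm 2 m, pow_mul]; ring
  generalize hθ' : 2^(m+1)*s*e = θ at *
  have hJ := JEp huv
  have ud : IsUnit (u^2-112*θ^4) := by
    obtain ⟨a, ha⟩ : ∃ a, u = 1+b*a := ⟨-(b^15*4^m*(η*s*(1+b*w))^2)*(21+b^12*x1+b^12*x2), by rw [hu, hθ]; ring⟩
    exact unit_of _ ⟨2*a+b*a^2-b^6*η*56*θ^4, by rw [ha]; linear_combination -56*θ^4*h2⟩
  obtain ⟨i, hi⟩ := ud.exists_right_inv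
  have J := hJ.norm hi
  obtain ⟨p, hp⟩ : ∃ p, v*i = 1+θ^2*p := by
    refine ⟨i*(u*(21+b^12*x1+b^12*x2)-b^12*x1+θ*y1+112*θ^2), ?_⟩
    linear_combination i*hv + hi - i*u*hu
  refine ⟨e, (η*s*(1+b*w))^2*p, (u^4+42*u^3*θ^2+672*u^2*θ^4+4704*u*θ^6+12544*θ^8)*i^2, Re, ?_, ?_⟩
  · convert J using 1
    rw [pow_succ]
    linear_combination 2*(1+b^16*4^m*((η*s*(1+b*w))^2*p))*hθ' - 2*θ*hp - 2*θ*p*hθ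
  · refine ⟨b*4^m*(η*s*(1+b*w))^2*η*(21*u^3+448*u^2*θ^2+2352*u*θ^4)*i^2, ?_⟩
    linear_combination ((u^2-112*θ^4)*i+1)*hi + i^2*(21*u^3+448*u^2*θ^2+2352*u*θ^4)*(2*hθ+b^16*4^m*(η*s*(1+b*w))^2*h2)
end C2

namespace C2
open Polynomial Module NumberField

variable {K : Type} [Field K] [NumberField K] [KD K]
local notation "β" => (KD.b : K)
local notation "b" => (bR : R K)
local notation "η" => (eta : R K)

lemma BkS (k : ℕ) {σ : ℤ} (hσ : σ = 1 ∨ σ = -1) :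
    ∃ κ ω : R K, JP 1 (2^(k+2)*κ) ω ∧ Rp κ ((V.C σ).mul ⟨0,7,7,0,7,0,0⟩).rd ∧ Cg 22 ω 1 := by
  obtain ⟨κ, ω, h1, h2, h3⟩ := Bk (K := K) k
  rcases hσ with rfl | rfl
  · exact ⟨κ, ω, h1, h2.to (by decide +kernel), h3⟩
  · refine ⟨-κ, ω, ?_, h2.neg, h3⟩
    rw [mul_neg]; exact h1.neg

def sm (s0 σ : ℤ) (e0 : V) : V := (((V.C s0).mul e0).rd.add ((V.C σ).mul ⟨0,7,7,0,7,0,0⟩).rd).rd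

lemma caseA {s ρ : R K} {m : ℕ} {T P r s0 σ : ℤ} {e0 k M : V} (hs : Rp s (V.C s0)) (hσ : σ = 1 ∨ σ = -1)
    (hT : Rp (2^(m+1+2)*s) (V.C T)) (hP : Rp (2^(m+1+1)*s) (V.C P)) (hs0 : s ≠ 0)
    (hW : 7+9*(2^(m+1+2)*s)+3*(2^(m+1+2)*s)^2+ρ+2*(1+2^(m+1+2)*s)*(3*ρ-3*(2^(m+1+2)*s)*ρ^2+(2^(m+1+2)*s)^2*ρ^3) = 0)
    (hc : ckQ T P r e0 = true) (hk : c22 (sm s0 σ e0) ((V.C 4).mul k) = true)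
    (hM : cert k M = true) (hk0 : ¬ b^8 ∣ (evR k : R K)) : False := by
  obtain ⟨e, q, ω, he, h1, c1⟩ := Apt hT hP hs0 hW hc
  obtain ⟨κ, ω', h2, hκ, c2⟩ := BkS (K := K) (m+1) hσ
  obtain ⟨p, hp⟩ := ((hs.mul he).add hκ).to hk
  rw [evR_mul, evR_C] at hp
  push_cast at hp
  have h4 := four_eq (K := K)
  have b14 : b^14 = 4*81 := by linear_combination -81*h4 - b^14*(9*η+1)*nine_eta (K := K)
  refine comb h1 h2 c1 c2 (r := 2) (κ0 := evR k + b^8*(81*(p+b^8*η^2*4^m*s*e*q))) ?_ le_rfl ⟨81*(p+b^8*η^2*4^m*s*e*q), by ring⟩ hM hk0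
  rw [pow_succ 4]
  linear_combination hp + b^16*4^m*s*e*q*h4 + b^8*(p+b^8*η^2*4^m*s*e*q)*b14

lemma caseA2 {s ρ : R K} {T P r s0 σ : ℤ} {e0 k M : V} (hs : Rp s (V.C s0)) (hσ : σ = 1 ∨ σ = -1)
    (hT : Rp (2^(0+2)*s) (V.C T)) (hP : Rp (2^(0+1)*s) (V.C P)) (hs0 : s ≠ 0)
    (hW : 7+9*(2^(0+2)*s)+3*(2^(0+2)*s)^2+ρ+2*(1+2^(0+2)*s)*(3*ρ-3*(2^(0+2)*s)*ρ^2+(2^(0+2)*s)^2*ρ^3) = 0)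
    (hc : ckQ T P r e0 = true) (hk : c15 (sm s0 σ e0) ((V.C 2).mul k) = true)
    (hM : cert k M = true) (hk0 : ¬ b^8 ∣ (evR k : R K)) : False := by
  obtain ⟨e, q, ω, he, h1, c1⟩ := Apt hT hP hs0 hW hc
  obtain ⟨κ, ω', h2, hκ, c2⟩ := BkS (K := K) 0 hσ
  obtain ⟨p, hp⟩ := (Cg.mono (m := 15) ((hs.mul he).add hκ) (by norm_num)).trans (cg_of_c15 hk)
  rw [evR_mul, evR_C] at hp
  push_cast at hp
  have b7' := b7 (K := K)
  refine comb h1 h2 c1 c2 (r := 1) (κ0 := evR k + b^8*(9*(p+b*s*e*q))) ?_ (by norm_num) ⟨9*(p+b*s*e*q), by ring⟩ hM hk0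
  linear_combination hp + b^8*(p+b*s*e*q)*b7'

def lst8 : List ℤ := [1,3,5,7,9,11,13,15]

lemma Rp.im (n : ℤ) {s : R K} {s0 : ℤ} (hs : Rp s (V.C s0)) : Rp ((n : R K)*s) (V.C (n*s0)) :=
  ((Rp.int n).mul hs).to (by simp [c22, V.rd, V.mul, V.C])

lemma fin1 {s ρ : R K} {s0 : ℤ} (hs : Rp s (V.C s0)) (hs0 : s ≠ 0) (hm : s0 ∈ lst8)
    (hW : 7+9*(2*s)+3*(2*s)^2+ρ+2*(1+2*s)*(3*ρ-3*(2*s)*ρ^2+(2*s)^2*ρ^3) = 0) : False := by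
  have H : ∀ s0 ∈ lst8, ∃ p ∈ [((13 : ℤ), V.mk 10 1 0 5 6 6 2), (1, V.mk 2 1 2 5 2 2 0), (5, V.mk 10 1 4 5 6 6 6), (9, V.mk 2 1 6 5 2 2 4)],
      ckQ (2*s0) s0 p.1 p.2 = true ∧ c15 (((V.C 1).sub ((V.C 21).mul (((V.C s0).mul p.2).rd.pw 2)).rd).rd) ⟨5,0,3,0,2,0,3⟩ = true := by
    decide +kernel
  obtain ⟨p, -, h1, h2⟩ := H s0 hm
  exact Q1k1 hs hs0 hW h1 h2 b_ne

lemma fin2 {s ρ : R K} {s0 : ℤ} (hs : Rp s (V.C s0)) (hs0 : s ≠ 0) (hm : s0 ∈ lst8)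
    (hW : 7+9*(2^(0+2)*s)+3*(2^(0+2)*s)^2+ρ+2*(1+2^(0+2)*s)*(3*ρ-3*(2^(0+2)*s)*ρ^2+(2^(0+2)*s)^2*ρ^3) = 0) : False := by
  have H : ∀ s0 ∈ lst8, ∃ p ∈ [((3 : ℤ), V.mk 0 3 1 4 1 4 0), (11, V.mk 0 3 5 4 5 4 0)], ∃ σ ∈ [(1 : ℤ), -1],
      ckQ (4*s0) (2*s0) p.1 p.2 = true ∧ c15 (sm s0 σ p.2) ((V.C 2).mul k011) = true := by
    decide +kernel
  obtain ⟨p, -, σ, hσ, h1, h2⟩ := H s0 hm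
  have hT : Rp (2^(0+2)*s) (V.C (4*s0)) := by
    have := Rp.im 4 hs
    convert this using 1; push_cast; ring
  have hP : Rp (2^(0+1)*s) (V.C (2*s0)) := by
    have := Rp.im 2 hs
    convert this using 1; push_cast; ring
  exact caseA2 hs (by simpa using hσ) hT hP hs0 hW h1 h2 c011 n011

lemma fin3 {s ρ : R K} {s0 : ℤ} (hs : Rp s (V.C s0)) (hs0 : s ≠ 0) (hm : s0 ∈ lst8)
    (hW : 7+9*(2^(0+1+2)*s)+3*(2^(0+1+2)*s)^2+ρ+2*(1+2^(0+1+2)*s)*(3*ρ-3*(2^(0+1+2)*s)*ρ^2+(2^(0+1+2)*s)^2*ρ^3) = 0) : False := by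
  have H : ∀ s0 ∈ lst8, ckQ (8*s0) (4*s0) 7 ⟨0,7,3,0,7,0,0⟩ = true ∧ ∃ σ ∈ [(1 : ℤ), -1],
      (c22 (sm s0 σ ⟨0,7,3,0,7,0,0⟩) ((V.C 4).mul k010) = true ∨ c22 (sm s0 σ ⟨0,7,3,0,7,0,0⟩) ((V.C 4).mul k101) = true) := by
    decide +kernel
  obtain ⟨h1, σ, hσ, h2⟩ := H s0 hm
  have hT : Rp (2^(0+1+2)*s) (V.C (8*s0)) := by
    have := Rp.im 8 hs
    convert this using 1; push_cast; ring
  have hP : Rp (2^(0+1+1)*s) (V.C (4*s0)) := by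
    have := Rp.im 4 hs
    convert this using 1; push_cast; ring
  rcases h2 with h2 | h2
  · exact caseA hs (by simpa using hσ) hT hP hs0 hW h1 h2 c010 n010
  · exact caseA hs (by simpa using hσ) hT hP hs0 hW h1 h2 c101 n101

lemma c22_rd2 {c d : V} (h : c22 c d = true) : c22 c.rd d = true := by
  simp only [c22, decide_eq_true_eq, V.rd, V.mk.injEq] at *; omega

lemma fin4 {s ρ : R K} {s0 : ℤ} (m : ℕ) (hs : Rp s (V.C s0)) (hs0 : s ≠ 0) (hm : s0 ∈ lst8)
    (hW : 7+9*(2^(m+1+1+2)*s)+3*(2^(m+1+1+2)*s)^2+ρ+2*(1+2^(m+1+1+2)*s)*(3*ρ-3*(2^(m+1+1+2)*s)*ρ^2+(2^(m+1+1+2)*s)^2*ρ^3) = 0) : False := by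
  have H : ∀ s0 ∈ lst8, ∃ σ ∈ [(1 : ℤ), -1],
      (c22 (sm s0 σ ⟨0,7,7,0,3,0,0⟩) ((V.C 4).mul k001) = true ∨ c22 (sm s0 σ ⟨0,7,7,0,3,0,0⟩) ((V.C 4).mul k110) = true) := by
    decide +kernel
  have Hc : ∀ P ∈ [(0 : ℤ), 8], ckQ 0 P 15 ⟨0,7,7,0,3,0,0⟩ = true := by decide +kernel
  have H8 : ∀ s0 ∈ lst8, c22 (((V.C 2).pw 3).mul (V.C s0)) (V.C 8) = true := by decide +kernel
  obtain ⟨σ, hσ, h2⟩ := H s0 hm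
  have h16 : ∀ a : R K, Rp (16*a) (V.C 0) := fun a => by
    unfold Rp; rw [evR_C]
    exact ⟨b^6*η^4*a, by push_cast; linear_combination a*sixteen_eq (K := K)⟩
  have hT : Rp (2^(m+1+1+2)*s) (V.C 0) := by
    have := h16 (2^m*s)
    convert this using 1; ring
  obtain ⟨P, hPm, hP⟩ : ∃ P ∈ [(0 : ℤ), 8], Rp (2^(m+1+1+1)*s) (V.C P) := by
    rcases m with _ | m
    · exact ⟨8, by simp, ((((Rp.num 2).pow 3).mul hs).to (c22_rd2 (H8 s0 hm)))⟩
    · refine ⟨0, by simp, ?_⟩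
      have := h16 (2^m*s)
      convert this using 1; ring
  have h1 := Hc P hPm
  rcases h2 with h2 | h2
  · exact caseA hs (by simpa using hσ) hT hP hs0 hW h1 h2 c001 n001
  · exact caseA hs (by simpa using hσ) hT hP hs0 hW h1 h2 c110 n110

lemma caseQ1 {x y z : ℤ} (h : 3*x^3*y+y^3*z+2*z^3*x = 0) (hx : x % 2 = 1) (hy : y % 2 = 1)
    (hne : x ≠ y) (_hK : β ≠ 0) : False := by
  obtain ⟨i, hi⟩ := (odd_unit (K := K) (Int.odd_iff.mpr hy)).exists_right_inv
  obtain ⟨k, c, hc, e⟩ := ex_two_odd (sub_ne_zero.mpr hne)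
  rcases k with _ | k
  · have := Int.odd_iff.mp hc; simp at e; omega
  have c0 : c ≠ 0 := by rintro rfl; simp at hc
  have A := congrArg (Int.cast : ℤ → R K) h
  have Ae := congrArg (Int.cast : ℤ → R K) e
  push_cast at A Ae
  obtain ⟨s, hs⟩ : ∃ s : R K, s = c*i := ⟨_, rfl⟩
  have s0 : s ≠ 0 := by
    rw [hs]; exact mul_ne_zero (int_ne c0) (by rintro rfl; simp at hi)
  obtain ⟨t, ht⟩ : ∃ t : R K, t = 2^(k+1)*s := ⟨_, rfl⟩
  obtain ⟨τ, hτ⟩ : ∃ τ : R K, τ = 1 + z*i := ⟨_, rfl⟩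
  have hz' : (z:R K)*i = -1+τ := by rw [hτ]; ring
  have hx' : (x:R K)*i = 1+t := by rw [ht, hs]; linear_combination i*Ae + hi
  have B : 3*(1+t)^3+(-1+τ)+2*(-1+τ)^3*(1+t) = 0 := by
    rw [← hz', ← hx']
    have i3 : ((y:R K)*i)^3 = 1 := by rw [hi]; ring
    linear_combination i^4*A - 3*(x:R K)^3*i^3*hi - (z:R K)*i*i3
  have h2 := two_eq (K := K)
  obtain ⟨u, hu⟩ := (unit_of (1+2*(1+t)*(3-3*τ+τ^2)) ⟨b^6*η*(1+t)*(3-3*τ+τ^2), by linear_combination (1+t)*(3-3*τ+τ^2)*h2⟩).exists_right_inv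
  obtain ⟨ρ, hρ⟩ : ∃ ρ : R K, ρ = -(7+9*t+3*t^2)*u := ⟨_, rfl⟩
  have hτρ : τ = t*ρ := by
    rw [hρ]; linear_combination u*B - τ*hu
  have hW : 7+9*t+3*t^2+ρ+2*(1+t)*(3*ρ-3*t*ρ^2+t^2*ρ^3) = 0 := by
    have : ρ*(1+2*(1+t)*(3-3*τ+τ^2)) = -(7+9*t+3*t^2) := by
      rw [hρ]; linear_combination -(7+9*t+3*t^2)*hu
    rw [hτρ] at this
    linear_combination this
  have hm : (c*y^3) % 16 ∈ lst8 := by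
    have : (c*y^3) % 2 = 1 := Int.odd_iff.mp (hc.mul (Int.odd_iff.mpr hy).pow)
    have : (c*y^3) % 16 % 2 = 1 := by omega
    have h1 : 0 ≤ (c*y^3) % 16 := by omega
    have h2 : (c*y^3) % 16 < 16 := by omega
    generalize (c*y^3) % 16 = n at *
    interval_cases n <;> simp_all [lst8]
  have hsR : Rp s (V.C ((c*y^3) % 16)) := by
    obtain ⟨n, hn⟩ : ∃ n, (c*y^3) % 16 = c*y^3 - 16*n := ⟨(c*y^3)/16, by omega⟩
    obtain ⟨l, hl⟩ : ∃ l, y^4 = 1 + 16*l := by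
      have : y % 16 = 1 ∨ y % 16 = 3 ∨ y % 16 = 5 ∨ y % 16 = 7 ∨ y % 16 = 9 ∨ y % 16 = 11 ∨ y % 16 = 13 ∨ y % 16 = 15 := by omega
      have h : y^4 % 16 = 1 := by
        rcases this with h | h | h | h | h | h | h | h <;> simp [pow_succ, Int.mul_emod, h]
      exact ⟨y^4/16, by omega⟩
    rw [hn]
    unfold Rp; rw [evR_C, hs]
    have hl' := congrArg (Int.cast : ℤ → R K) hl
    push_cast at hl' ⊢
    refine ⟨b^6*η^4*(n - c*i*l), ?_⟩
    linear_combination (n - c*i*l)*sixteen_eq (K := K) - c*i*hl' + c*y^3*hi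
  rw [ht] at hW
  rcases k with _ | _ | _ | m
  · exact fin1 hsR s0 hm (by simpa using hW)
  · exact fin2 hsR s0 hm hW
  · exact fin3 hsR s0 hm hW
  · exact fin4 m hsR s0 hm hW

end C2

namespace C2
open Polynomial Module NumberField

lemma irr : Irreducible (X^7 - C (18 : ℚ) : ℚ[X]) := by
  apply X_pow_sub_C_irreducible_of_prime (by norm_num)
  intro q hq
  have h1 := congrArg (padicValRat 2) hq
  have q0 : q ≠ 0 := by rintro rfl; norm_num at hq
  haveI : Fact (Nat.Prime 2) := ⟨Nat.prime_two⟩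
  rw [padicValRat.pow] at h1
  have h18 : padicValRat 2 (18 : ℚ) = 1 := by
    rw [show (18 : ℚ) = 2*9 by norm_num, padicValRat.mul (by norm_num) (by norm_num)]
    have : padicValRat 2 (9 : ℚ) = 0 := by
      rw [show (9 : ℚ) = ((9 : ℤ) : ℚ) by norm_num, padicValRat.of_int]
      simp [padicValInt.eq_zero_of_not_dvd (p := 2) (z := 9) (by norm_num)]
    rw [this]
    have := padicValRat.self (p := 2) (by norm_num)
    simpa using this
  rw [h18] at h1
  omega

instance irrF : Fact (Irreducible (X^7 - C (18 : ℚ) : ℚ[X])) := ⟨irr⟩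

abbrev KK : Type := AdjoinRoot (X^7 - C (18 : ℚ) : ℚ[X])

lemma pne : (X^7 - C (18 : ℚ) : ℚ[X]) ≠ 0 := irr.ne_zero

instance nfK : NumberField KK where
  to_charZero := charZero_of_injective_algebraMap (algebraMap ℚ KK).injective
  to_finiteDimensional := (AdjoinRoot.powerBasis pne).finite

lemma dg : (AdjoinRoot.powerBasis pne).dim = 7 := by
  rw [AdjoinRoot.powerBasis_dim, natDegree_X_pow_sub_C]

noncomputable instance kdK : KD KK where
  b := AdjoinRoot.root _
  hb := by
    have := AdjoinRoot.eval₂_root (X^7 - C (18 : ℚ) : ℚ[X])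
    simp only [eval₂_sub, eval₂_pow, eval₂_X, eval₂_C] at this
    have h := sub_eq_zero.mp this
    rw [h]; exact map_ofNat _ 18
  bas := ((AdjoinRoot.powerBasis pne).basis.reindex (finCongr dg))
  hbas := fun i => by simp

lemma K0 : (KD.b : KK) ≠ 0 := b_ne

end C2

open C2 in
theorem rational_points_C2 (x y z : ℤ)
    (hcop : Int.gcd x (Int.gcd y z : ℤ) = 1) (hnz : ¬ (x = 0 ∧ y = 0 ∧ z = 0))
    (h : 3 * x ^ 3 * y + y ^ 3 * z + 2 * z ^ 3 * x = 0) :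
    (x, y, z) = (1, 0, 0) ∨ (x, y, z) = (-1, 0, 0) ∨
    (x, y, z) = (0, 1, 0) ∨ (x, y, z) = (0, -1, 0) ∨
    (x, y, z) = (0, 0, 1) ∨ (x, y, z) = (0, 0, -1) ∨
    (x, y, z) = (1, 1, -1) ∨ (x, y, z) = (-1, -1, 1) ∨
    (x, y, z) = (1, -2, -1) ∨ (x, y, z) = (-1, 2, 1) := by
  have hd : ∀ d : ℤ, d ∣ x → d ∣ y → d ∣ z → d = 1 ∨ d = -1 := by
    intro d h1 h2 h3
    have := Int.dvd_coe_gcd h1 (Int.dvd_coe_gcd h2 h3)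
    rw [hcop] at this
    have := Int.isUnit_iff.mp (isUnit_of_dvd_one (by simpa using this))
    exact this
  simp only [Prod.mk.injEq]
  by_cases hx0 : x = 0
  · subst hx0
    have : y^3*z = 0 := by linarith
    rcases mul_eq_zero.mp this with h' | h'
    · have hy : y = 0 := by simpa using h'
      subst hy
      have := hd z (dvd_zero _) (dvd_zero _) dvd_rfl
      rcases this with rfl | rfl <;> simp
    · subst h'
      have := hd y (dvd_zero _) dvd_rfl (dvd_zero _)
      rcases this with rfl | rfl <;> simp
  by_cases hy0 : y = 0
  · subst hy0
    have : z^3*x = 0 := by linarith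
    rcases mul_eq_zero.mp this with h' | h'
    · have hz : z = 0 := by simpa using h'
      subst hz
      have := hd x dvd_rfl (dvd_zero _) (dvd_zero _)
      rcases this with rfl | rfl <;> simp
    · exact absurd h' hx0
  by_cases hz0 : z = 0
  · subst hz0
    have : x^3*y = 0 := by linarith
    rcases mul_eq_zero.mp this with h' | h'
    · exact absurd (by simpa using h') hx0
    · exact absurd h' hy0
  rcases Int.emod_two_eq_zero_or_one x with hx | hx <;> rcases Int.emod_two_eq_zero_or_one y with hy | hy
  · rcases Int.emod_two_eq_zero_or_one z with hz | hz
    · have := hd 2 (Int.dvd_of_emod_eq_zero hx) (Int.dvd_of_emod_eq_zero hy) (Int.dvd_of_emod_eq_zero hz)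
      exfalso; omega
    · exact (caseZ h hx hy hz hx0 hy0 K0).elim
  · exact (caseY h hx hy hz0 hx0 K0).elim
  · rcases Int.emod_two_eq_zero_or_one z with hz | hz
    · exact (caseX h hx hz hy0 hz0 K0).elim
    · by_cases hne : z + x = 0
      · have hz' : z = -x := by omega
        subst hz'
        have h1 : x*((y+2*x)*(y^2-2*x*y+x^2)) = 0 := by linear_combination -h
        rcases mul_eq_zero.mp h1 with h' | h'
        · exact absurd h' hx0
        · rcases mul_eq_zero.mp h' with h2 | h2
          · have hy' : y = -2*x := by omega
            have := hd x dvd_rfl ⟨-2, by omega⟩ ⟨-1, by ring⟩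
            subst hy'
            rcases this with rfl | rfl <;> simp
          · have : (y-x)^2 = 0 := by linear_combination h2
            have : y - x = 0 := by simpa using this
            exfalso; omega
      · exact (caseQ2 h hx hy hz hne K0).elim
  · by_cases hne : x = y
    · subst hne
      have h1 : x*((z+x)*(2*z^2-2*x*z+3*x^2)) = 0 := by linear_combination h
      rcases mul_eq_zero.mp h1 with h' | h'
      · exact absurd h' hx0
      · rcases mul_eq_zero.mp h' with h2 | h2
        · have hz' : z = -x := by omega
          have := hd x dvd_rfl dvd_rfl ⟨-1, by omega⟩
          subst hz'
          rcases this with rfl | rfl <;> simp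
        · exfalso
          have : 0 < x^2 := by positivity
          nlinarith [sq_nonneg (z-x), sq_nonneg z]
    · exact (caseQ1 h hx hy hne K0).elim
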